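/- arXiv:1910.06231 — 3 statements merged into one kernel-verified Lean document; each statement's English description precedes it below -/
import Mathlib

section
/- Let A be a set of n lines in ℝ² in general position and let ℓ be any line in the plane, determining a partition of ℝ² into two closed half-planes C₁ and C₂. Then μ_A(C₁)·μ_A(C₂) ≥ n. -/
open scoped Classical

/-- A line in the plane: the solution set of `a*x + b*y = c` with `(a,b) ≠ (0,0)`. -/
def IsLine (L : Set (ℝ × ℝ)) : Prop :=
  ∃ a b c : ℝ, (a, b) ≠ (0, 0) ∧ L = {p : ℝ × ℝ | a * p.1 + b * p.2 = c}

/-- The incidence set of a finite family of lines: all pairwise intersection points. -/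
def incSet (L : Finset (Set (ℝ × ℝ))) : Set (ℝ × ℝ) :=
  {p | ∃ ℓ₁ ∈ L, ∃ ℓ₂ ∈ L, ℓ₁ ≠ ℓ₂ ∧ p ∈ ℓ₁ ∧ p ∈ ℓ₂}

/-- Two lines are non-parallel if they meet in exactly one point. -/
def NotParallel (L₁ L₂ : Set (ℝ × ℝ)) : Prop := ∃! p : ℝ × ℝ, p ∈ L₁ ∩ L₂

/-- No two lines of the family are parallel. -/
def PairwiseNonParallel (L : Finset (Set (ℝ × ℝ))) : Prop :=
  ∀ ℓ₁ ∈ L, ∀ ℓ₂ ∈ L, ℓ₁ ≠ ℓ₂ → NotParallel ℓ₁ ℓ₂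

/-- A family of lines is in general position: no two parallel, no three concurrent, and any
three collinear points of the incidence set lie on a common line of the family. -/
def GenPos (L : Finset (Set (ℝ × ℝ))) : Prop :=
  PairwiseNonParallel L ∧
  (∀ ℓ₁ ∈ L, ∀ ℓ₂ ∈ L, ∀ ℓ₃ ∈ L, ℓ₁ ≠ ℓ₂ → ℓ₁ ≠ ℓ₃ → ℓ₂ ≠ ℓ₃ →
    ¬ ∃ p : ℝ × ℝ, p ∈ ℓ₁ ∧ p ∈ ℓ₂ ∧ p ∈ ℓ₃) ∧
  (∀ p q s : ℝ × ℝ, p ∈ incSet L → q ∈ incSet L → s ∈ incSet L →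
    p ≠ q → p ≠ s → q ≠ s → Collinear ℝ ({p, q, s} : Set (ℝ × ℝ)) →
    ∃ ℓ ∈ L, p ∈ ℓ ∧ q ∈ ℓ ∧ s ∈ ℓ)

/-- `mu A K` is the largest cardinality of a subset of `A` whose incidence set lies in `K`. -/
noncomputable def mu (A : Finset (Set (ℝ × ℝ))) (K : Set (ℝ × ℝ)) : ℕ :=
  (A.powerset.filter (fun A' => incSet A' ⊆ K)).sup Finset.card

/-- A convex partition of the plane into `r` parts: closed convex sets covering `ℝ²`
with pairwise disjoint interiors. -/
def ConvexPartition {r : ℕ} (C : Fin r → Set (ℝ × ℝ)) : Prop :=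
  (∀ j, IsClosed (C j)) ∧ (∀ j, Convex ℝ (C j)) ∧
  (⋃ j, C j) = Set.univ ∧
  Pairwise fun i j => interior (C i) ∩ interior (C j) = ∅

/-- The subsets of `A` that are chains for `r` and have `i` as their greatest element. -/
noncomputable def chainsTo {α : Type*} (r : α → α → Prop) (A : Finset α) (i : α) :
    Finset (Finset α) :=
  A.powerset.filter fun S =>
    i ∈ S ∧ (∀ j ∈ S, j ≠ i → r j i) ∧ ∀ j ∈ S, ∀ k ∈ S, j ≠ k → r j k ∨ r k j

/-- The largest size of an `r`-chain in `A` with greatest element `i`. -/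
noncomputable def chainHeight {α : Type*} (r : α → α → Prop) (A : Finset α) (i : α) : ℕ :=
  (chainsTo r A i).sup Finset.card

lemma singleton_mem_chainsTo {α : Type*} (r : α → α → Prop) {A : Finset α} {i : α}
    (hi : i ∈ A) : {i} ∈ chainsTo r A i := by
  simp [chainsTo, hi]

lemma one_le_chainHeight {α : Type*} (r : α → α → Prop) {A : Finset α} {i : α}
    (hi : i ∈ A) : 1 ≤ chainHeight r A i :=
  Finset.le_sup (f := Finset.card) (singleton_mem_chainsTo r hi)

lemma chainHeight_le {α : Type*} {r : α → α → Prop} {A : Finset α} {M : ℕ}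
    (h : ∀ S ⊆ A, (∀ j ∈ S, ∀ k ∈ S, j ≠ k → r j k ∨ r k j) → S.card ≤ M) (i : α) :
    chainHeight r A i ≤ M := by
  refine Finset.sup_le fun S hS => ?_
  simp only [chainsTo, Finset.mem_filter, Finset.mem_powerset] at hS
  exact h S hS.1 hS.2.2.2

lemma chainHeight_lt {α : Type*} {r : α → α → Prop} (hirr : ∀ i, ¬ r i i)
    (htrans : ∀ i j k, r i j → r j k → r i k) {A : Finset α} {i j : α}
    (hi : i ∈ A) (hj : j ∈ A) (hij : r i j) : chainHeight r A i < chainHeight r A j := by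
  obtain ⟨S, hS, hSc⟩ := Finset.exists_mem_eq_sup (chainsTo r A i)
    ⟨_, singleton_mem_chainsTo r hi⟩ Finset.card
  simp only [chainsTo, Finset.mem_filter, Finset.mem_powerset] at hS
  obtain ⟨hSA, hiS, htop, hchain⟩ := hS
  have hlt : ∀ k ∈ S, r k j := fun k hk => by
    by_cases hki : k = i
    · exact hki ▸ hij
    · exact htrans k i j (htop k hk hki) hij
  have hjS : j ∉ S := fun hjS => hirr j (hlt j hjS)
  have hmem : insert j S ∈ chainsTo r A j := by
    simp only [chainsTo, Finset.mem_filter, Finset.mem_powerset]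
    refine ⟨Finset.insert_subset hj hSA, Finset.mem_insert_self _ _, ?_, ?_⟩
    · intro k hk hkj
      exact hlt k (Finset.mem_of_mem_insert_of_ne hk hkj)
    · intro k hk l hl hkl
      rcases Finset.mem_insert.1 hk with rfl | hkS
      · exact Or.inr (hlt l (Finset.mem_of_mem_insert_of_ne hl hkl.symm))
      · rcases Finset.mem_insert.1 hl with rfl | hl
        · exact Or.inl (hlt k hkS)
        · exact hchain k hkS l hl hkl
  have hle := Finset.le_sup (f := Finset.card) hmem
  rw [Finset.card_insert_of_notMem hjS, ← hSc] at hle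
  exact hle

/-- If any two elements of `A` are comparable for one of two strict orders, and chains for these
orders have size at most `M` and `N`, then `A` has at most `M * N` elements. -/
lemma card_le_mul_of_chains {α : Type*} {r s : α → α → Prop} (hr : ∀ i, ¬ r i i)
    (hs : ∀ i, ¬ s i i) (hr' : ∀ i j k, r i j → r j k → r i k)
    (hs' : ∀ i j k, s i j → s j k → s i k) {A : Finset α}
    (htot : ∀ i ∈ A, ∀ j ∈ A, i ≠ j → (r i j ∨ r j i) ∨ (s i j ∨ s j i)) {M N : ℕ}
    (hM : ∀ S ⊆ A, (∀ j ∈ S, ∀ k ∈ S, j ≠ k → r j k ∨ r k j) → S.card ≤ M)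
    (hN : ∀ S ⊆ A, (∀ j ∈ S, ∀ k ∈ S, j ≠ k → s j k ∨ s k j) → S.card ≤ N) :
    A.card ≤ M * N := by
  have h := Finset.card_le_card_of_injOn (s := A) (t := Finset.Icc 1 M ×ˢ Finset.Icc 1 N)
    (fun i => (chainHeight r A i, chainHeight s A i))
    (fun i hi => by
      simp only [Finset.coe_product, Finset.coe_Icc, Set.mem_prod, Set.mem_Icc]
      exact ⟨⟨one_le_chainHeight r hi, chainHeight_le hM i⟩,
        one_le_chainHeight s hi, chainHeight_le hN i⟩)
    (fun i hi j hj hij => by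
      by_contra hne
      obtain ⟨h1, h2⟩ := Prod.mk.inj hij
      rcases htot i hi j hj hne with (h | h) | (h | h)
      · exact (chainHeight_lt hr hr' hi hj h).ne h1
      · exact (chainHeight_lt hr hr' hj hi h).ne' h1
      · exact (chainHeight_lt hs hs' hi hj h).ne h2
      · exact (chainHeight_lt hs hs' hj hi h).ne' h2)
  simpa using h

lemma card_le_mu {A S : Finset (Set (ℝ × ℝ))} {K : Set (ℝ × ℝ)} (hS : S ⊆ A)
    (hK : incSet S ⊆ K) : S.card ≤ mu A K :=
  Finset.le_sup (f := Finset.card) (Finset.mem_filter.2 ⟨Finset.mem_powerset.2 hS, hK⟩)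

/-- `M` and `K` are the slope and the intercept of the line `L` in the coordinates
`u = a * x + b * y - c` and `v = a * y - b * x`. A line `u = d` has slope `⊤`, and its intercept
is `⊤` or `⊥` according to the sign of `d`. -/
def HasSlopeIntercept (a b c : ℝ) (L : Set (ℝ × ℝ)) (M K : EReal) : Prop :=
  (∃ m k : ℝ, M = m ∧ K = k ∧
    ∀ p, p ∈ L ↔ a * p.2 - b * p.1 = m * (a * p.1 + b * p.2 - c) + k) ∨
  ∃ d : ℝ, M = ⊤ ∧ (d ≤ 0 ∧ K = ⊤ ∨ 0 < d ∧ K = ⊥) ∧ ∀ p, p ∈ L ↔ a * p.1 + b * p.2 - c = d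

lemma IsLine.exists_hasSlopeIntercept {a b : ℝ} (c : ℝ) (hab : (a, b) ≠ (0, 0))
    {L : Set (ℝ × ℝ)} (hL : IsLine L) : ∃ M K, HasSlopeIntercept a b c L M K := by
  obtain ⟨p, q, e, hpq, rfl⟩ := hL
  have hN : 0 < a ^ 2 + b ^ 2 := by
    rcases eq_or_ne a 0 with rfl | ha
    · have hb : b ≠ 0 := fun hb => hab (by rw [hb])
      positivity
    · positivity
  by_cases hD : a * q - b * p = 0
  · have hE : a * p + b * q ≠ 0 := by
      intro hE
      refine hpq (Prod.ext ?_ ?_)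
      · have : (a ^ 2 + b ^ 2) * p = 0 := by linear_combination a * hE - b * hD
        exact (mul_eq_zero.1 this).resolve_left hN.ne'
      · have : (a ^ 2 + b ^ 2) * q = 0 := by linear_combination b * hE + a * hD
        exact (mul_eq_zero.1 this).resolve_left hN.ne'
    have key : ∀ z : ℝ × ℝ, z ∈ {z : ℝ × ℝ | p * z.1 + q * z.2 = e} ↔
        a * z.1 + b * z.2 - c = (a ^ 2 + b ^ 2) * e / (a * p + b * q) - c := by
      intro z
      rw [sub_left_inj, eq_div_iff hE, Set.mem_ofPred_eq, ← mul_right_inj' hN.ne']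
      have : (a ^ 2 + b ^ 2) * (p * z.1 + q * z.2) =
          (a * z.1 + b * z.2) * (a * p + b * q) := by
        linear_combination (a * z.2 - b * z.1) * hD
      rw [this]
    rcases le_or_gt ((a ^ 2 + b ^ 2) * e / (a * p + b * q) - c) 0 with hd | hd
    · exact ⟨⊤, ⊤, Or.inr ⟨_, rfl, Or.inl ⟨hd, rfl⟩, key⟩⟩
    · exact ⟨⊤, ⊥, Or.inr ⟨_, rfl, Or.inr ⟨hd, rfl⟩, key⟩⟩
  · refine ⟨_, _, Or.inl ⟨-(a * p + b * q) / (a * q - b * p),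
      ((a ^ 2 + b ^ 2) * e - (a * p + b * q) * c) / (a * q - b * p), rfl, rfl, fun z => ?_⟩⟩
    rw [Set.mem_ofPred_eq, ← mul_right_inj' hN.ne', div_mul_eq_mul_div, ← add_div,
      eq_div_iff hD]
    constructor <;> intro h <;> linear_combination h

lemma HasSlopeIntercept.eq_of_slope_eq {a b c : ℝ} {L L' : Set (ℝ × ℝ)} {M K K' : EReal}
    (h : HasSlopeIntercept a b c L M K) (h' : HasSlopeIntercept a b c L' M K')
    {p : ℝ × ℝ} (hp : p ∈ L) (hp' : p ∈ L') : L = L' := by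
  rcases h with ⟨m, k, rfl, -, h⟩ | ⟨d, rfl, -, h⟩ <;>
    rcases h' with ⟨m', k', hm, -, h'⟩ | ⟨d', hm, -, h'⟩
  · obtain rfl := EReal.coe_injective hm
    have hk : k = k' := by linarith [(h p).1 hp, (h' p).1 hp']
    ext z
    rw [h, h', hk]
  · exact absurd hm (EReal.coe_ne_top m)
  · exact absurd hm.symm (EReal.coe_ne_top m')
  · have hd : d = d' := by linarith [(h p).1 hp, (h' p).1 hp']
    ext z
    rw [h, h', hd]

lemma HasSlopeIntercept.le_of_intercept_le {a b c : ℝ} {L L' : Set (ℝ × ℝ)}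
    {M M' K K' : EReal} (h : HasSlopeIntercept a b c L M K)
    (h' : HasSlopeIntercept a b c L' M' K') (hM : M < M') (hK : K ≤ K')
    {p : ℝ × ℝ} (hp : p ∈ L) (hp' : p ∈ L') : a * p.1 + b * p.2 ≤ c := by
  rcases h with ⟨m, k, rfl, rfl, h⟩ | ⟨d, rfl, -, h⟩
  · have h1 := (h p).1 hp
    rcases h' with ⟨m', k', rfl, rfl, h'⟩ | ⟨d', rfl, ⟨hd, rfl⟩ | ⟨hd, rfl⟩, h'⟩
    · have h2 := (h' p).1 hp'
      rw [EReal.coe_lt_coe_iff] at hM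
      rw [EReal.coe_le_coe_iff] at hK
      by_contra! hc
      nlinarith [mul_pos (sub_pos.2 hM) (sub_pos.2 hc)]
    · linarith [(h' p).1 hp']
    · exact absurd (le_bot_iff.1 hK) (EReal.coe_ne_bot k)
  · exact absurd hM not_top_lt

lemma HasSlopeIntercept.ge_of_intercept_ge {a b c : ℝ} {L L' : Set (ℝ × ℝ)}
    {M M' K K' : EReal} (h : HasSlopeIntercept a b c L M K)
    (h' : HasSlopeIntercept a b c L' M' K') (hM : M < M') (hK : K' ≤ K)
    {p : ℝ × ℝ} (hp : p ∈ L) (hp' : p ∈ L') : c ≤ a * p.1 + b * p.2 := by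
  rcases h with ⟨m, k, rfl, rfl, h⟩ | ⟨d, rfl, -, h⟩
  · have h1 := (h p).1 hp
    rcases h' with ⟨m', k', rfl, rfl, h'⟩ | ⟨d', rfl, ⟨hd, rfl⟩ | ⟨hd, rfl⟩, h'⟩
    · have h2 := (h' p).1 hp'
      rw [EReal.coe_lt_coe_iff] at hM
      rw [EReal.coe_le_coe_iff] at hK
      by_contra! hc
      nlinarith [mul_pos (sub_pos.2 hM) (sub_pos.2 hc)]
    · exact absurd (top_le_iff.1 hK) (EReal.coe_ne_top k)
    · linarith [(h' p).1 hp']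
  · exact absurd hM not_top_lt

/-- **Lemma (two parts).** For `A` a set of `n` lines in general position and any line `ℓ`
splitting the plane into two closed half-planes `C₁`, `C₂`, we have `μ_A(C₁)·μ_A(C₂) ≥ n`. -/
theorem two_parts_lemma (n : ℕ) (A : Finset (Set (ℝ × ℝ)))
    (hlines : ∀ ℓ ∈ A, IsLine ℓ) (hcard : A.card = n) (hgp : GenPos A)
    (a b c : ℝ) (hab : (a, b) ≠ (0, 0)) :
    n ≤ mu A {p : ℝ × ℝ | a * p.1 + b * p.2 ≤ c} *
        mu A {p : ℝ × ℝ | c ≤ a * p.1 + b * p.2} := by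
  have hex : ∀ L : Set (ℝ × ℝ), ∃ M K, L ∈ A → HasSlopeIntercept a b c L M K := fun L => by
    by_cases hL : L ∈ A
    · obtain ⟨M, K, h⟩ := (hlines L hL).exists_hasSlopeIntercept c hab
      exact ⟨M, K, fun _ => h⟩
    · exact ⟨0, 0, fun h => absurd h hL⟩
  choose M K hMK using hex
  rw [← hcard]
  refine card_le_mul_of_chains (r := fun L L' => M L < M L' ∧ K L ≤ K L')
    (s := fun L L' => M L < M L' ∧ K L' ≤ K L) (fun L h => lt_irrefl _ h.1)
    (fun L h => lt_irrefl _ h.1)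
    (fun _ _ _ h h' => ⟨h.1.trans h'.1, h.2.trans h'.2⟩)
    (fun _ _ _ h h' => ⟨h.1.trans h'.1, h'.2.trans h.2⟩) ?_ ?_ ?_
  · intro L hL L' hL' hne
    obtain ⟨p, hp, -⟩ := hgp.1 L hL L' hL' hne
    have hM : M L ≠ M L' := fun hM =>
      hne ((hMK L hL).eq_of_slope_eq (hM ▸ hMK L' hL') hp.1 hp.2)
    rcases hM.lt_or_gt with h | h <;> rcases le_total (K L) (K L') with h' | h' <;> simp [h, h']
  · rintro S hS hchain
    refine card_le_mu hS ?_
    rintro p ⟨L, hL, L', hL', hne, hp, hp'⟩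
    rcases hchain L hL L' hL' hne with h | h
    · exact (hMK L (hS hL)).le_of_intercept_le (hMK L' (hS hL')) h.1 h.2 hp hp'
    · exact (hMK L' (hS hL')).le_of_intercept_le (hMK L (hS hL)) h.1 h.2 hp' hp
  · rintro S hS hchain
    refine card_le_mu hS ?_
    rintro p ⟨L, hL, L', hL', hne, hp, hp'⟩
    rcases hchain L hL L' hL' hne with h | h
    · exact (hMK L (hS hL)).ge_of_intercept_ge (hMK L' (hS hL')) h.1 h.2 hp hp'
    · exact (hMK L' (hS hL')).ge_of_intercept_ge (hMK L (hS hL)) h.1 h.2 hp' hp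
end

section
/- Let A be a set of n lines in ℝ² in general position, and let (C₁, C₂, C₃) be a convex partition of ℝ² into three parts. Then μ_A(C₁)·μ_A(C₂)·μ_A(C₃) ≥ 2n/3. -/
open scoped Classical

/-- The determinant of two plane vectors. -/
def crossDet (u v : ℝ × ℝ) : ℝ := u.1 * v.2 - u.2 * v.1

/-- `d` is a direction vector of the line `ℓ`. -/
def IsDir (ℓ : Set (ℝ × ℝ)) (d : ℝ × ℝ) : Prop :=
  d ≠ 0 ∧ ∀ p ∈ ℓ, ∀ q, q ∈ ℓ ↔ ∃ t : ℝ, q = p + t • d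

/-- `d` is a direction of recession of `K`; every vector is one when `K` is empty. -/
def IsRec (K : Set (ℝ × ℝ)) (d : ℝ × ℝ) : Prop :=
  ∀ p ∈ K, ∀ t : ℝ, 0 ≤ t → p + t • d ∈ K

/-- A finite strict order has a chain and an antichain whose sizes multiply to at least the
number of elements. -/
theorem exists_chain_antichain {α : Type*} (S : Finset α) (R : α → α → Prop)
    (irr : ∀ x ∈ S, ¬ R x x)
    (tr : ∀ x ∈ S, ∀ y ∈ S, ∀ z ∈ S, R x y → R y z → R x z) :
    ∃ X ⊆ S, ∃ Y ⊆ S, (∀ x ∈ X, ∀ y ∈ X, x ≠ y → R x y ∨ R y x) ∧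
      (∀ x ∈ Y, ∀ y ∈ Y, ¬ R x y) ∧ S.card ≤ X.card * Y.card := by
  let chains := S.powerset.filter (fun T => ∀ x ∈ T, ∀ y ∈ T, x ≠ y → R x y ∨ R y x)
  have mem_chains : ∀ T, T ∈ chains ↔
      T ⊆ S ∧ ∀ x ∈ T, ∀ y ∈ T, x ≠ y → R x y ∨ R y x := by simp [chains]
  have extend : ∀ T ∈ chains, ∀ y ∈ S, (∀ t ∈ T, R t y) →
      insert y T ∈ chains ∧ (insert y T).card = T.card + 1 := by
    intro T hT y hy h
    rw [mem_chains] at hT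
    refine ⟨(mem_chains _).2 ⟨Finset.insert_subset hy hT.1, ?_⟩,
      Finset.card_insert_of_notMem fun hyT => irr y hy (h y hyT)⟩
    intro a ha b hb hab
    rcases Finset.mem_insert.1 ha with rfl | ha' <;>
      rcases Finset.mem_insert.1 hb with rfl | hb'
    · exact absurd rfl hab
    · exact Or.inr (h _ hb')
    · exact Or.inl (h _ ha')
    · exact hT.2 _ ha' _ hb' hab
  have hempty : ∅ ∈ chains := (mem_chains _).2 (by simp)
  obtain ⟨X, hX, hmax⟩ := Finset.exists_max_image chains Finset.card ⟨_, hempty⟩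
  let c : α → ℕ := fun y => (chains.filter (fun T => ∀ t ∈ T, R t y)).sup Finset.card
  have c_spec : ∀ y, ∃ T ∈ chains, (∀ t ∈ T, R t y) ∧ c y = T.card := by
    intro y
    obtain ⟨T, hT, h⟩ := Finset.exists_mem_eq_sup (chains.filter (fun T => ∀ t ∈ T, R t y))
      ⟨∅, by simp [hempty]⟩ Finset.card
    rw [Finset.mem_filter] at hT
    exact ⟨T, hT.1, hT.2, h⟩
  have c_lt : ∀ y ∈ S, c y ∈ Finset.range X.card := by
    intro y hy
    obtain ⟨T, hT, h, hc⟩ := c_spec y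
    obtain ⟨h1, h2⟩ := extend T hT y hy h
    have := hmax _ h1
    rw [Finset.mem_range]
    omega
  have c_mono : ∀ x ∈ S, ∀ y ∈ S, R x y → c x < c y := by
    intro x hx y hy hxy
    obtain ⟨T, hT, h, hc⟩ := c_spec x
    obtain ⟨h1, h2⟩ := extend T hT x hx h
    have hle : (insert x T).card ≤ c y := by
      refine Finset.le_sup (f := Finset.card) (Finset.mem_filter.2 ⟨h1, fun t ht => ?_⟩)
      rcases Finset.mem_insert.1 ht with rfl | ht
      · exact hxy
      · exact tr t (((mem_chains _).1 hT).1 ht) x hx y hy (h t ht) hxy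
    omega
  rcases S.eq_empty_or_nonempty with rfl | ⟨y₀, hy₀⟩
  · exact ⟨∅, by simp, ∅, by simp, by simp, by simp, by simp⟩
  obtain ⟨k, -, hk⟩ := Finset.exists_max_image (Finset.range X.card)
    (fun k => (S.filter (fun y => c y = k)).card) ⟨_, c_lt y₀ hy₀⟩
  refine ⟨X, ((mem_chains _).1 hX).1, S.filter (fun y => c y = k), Finset.filter_subset _ _,
    ((mem_chains _).1 hX).2, ?_, ?_⟩
  · intro x hx y hy hxy
    rw [Finset.mem_filter] at hx hy
    have := c_mono x hx.1 y hy.1 hxy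
    omega
  · have := Finset.card_le_mul_card_image_of_maps_to c_lt _ hk
    rw [Finset.card_range] at this
    linarith

theorem card_le_mu_s7 {A X : Finset (Set (ℝ × ℝ))} {K : Set (ℝ × ℝ)} (hX : X ⊆ A)
    (h : ∀ a ∈ X, ∀ b ∈ X, a ≠ b → ∀ p ∈ a, p ∈ b → p ∈ K) : X.card ≤ mu A K := by
  refine Finset.le_sup (f := Finset.card) (Finset.mem_filter.2 ⟨Finset.mem_powerset.2 hX, ?_⟩)
  rintro p ⟨a, ha, b, hb, hab, hpa, hpb⟩
  exact h a ha b hb hab p hpa hpb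

theorem mu_mono {A : Finset (Set (ℝ × ℝ))} {K K' : Set (ℝ × ℝ)} (h : K ⊆ K') :
    mu A K ≤ mu A K' := by
  refine Finset.sup_mono fun X hX => ?_
  rw [Finset.mem_filter] at hX ⊢
  exact ⟨hX.1, hX.2.trans h⟩

theorem one_le_mu {A : Finset (Set (ℝ × ℝ))} (hA : A.Nonempty) (K : Set (ℝ × ℝ)) :
    1 ≤ mu A K := by
  obtain ⟨a, ha⟩ := hA
  rw [← Finset.card_singleton a]
  refine card_le_mu_s7 (Finset.singleton_subset_iff.2 ha) fun x hx y hy hxy => ?_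
  rw [Finset.mem_singleton] at hx hy
  exact absurd (hx.trans hy.symm) hxy

theorem IsLine.exists_isDir {ℓ : Set (ℝ × ℝ)} (h : IsLine ℓ) : ∃ d, IsDir ℓ d := by
  obtain ⟨a, b, c, hab, rfl⟩ := h
  have hab' : 0 < a ^ 2 + b ^ 2 := by
    by_contra! hle
    have ha : a = 0 := by nlinarith [sq_nonneg a, sq_nonneg b]
    have hb : b = 0 := by nlinarith [sq_nonneg a, sq_nonneg b]
    exact hab (by rw [ha, hb])
  refine ⟨(b, -a), fun h0 => ?_, ?_⟩
  · simp only [Prod.mk_eq_zero, neg_eq_zero] at h0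
    exact hab (by rw [h0.1, h0.2])
  · rintro ⟨p1, p2⟩ hp ⟨q1, q2⟩
    simp only [Set.mem_ofPred_eq] at hp ⊢
    constructor
    · intro hq
      refine ⟨(b * (q1 - p1) - a * (q2 - p2)) / (a ^ 2 + b ^ 2), ?_⟩
      ext
      · simp only [Prod.fst_add, Prod.smul_mk, smul_eq_mul]
        field_simp
        linear_combination a * hq - a * hp
      · simp only [Prod.snd_add, Prod.smul_mk, smul_eq_mul]
        field_simp
        linear_combination b * hq - b * hp
    · rintro ⟨t, ht⟩
      simp only [Prod.smul_mk, smul_eq_mul, Prod.mk_add_mk, Prod.mk.injEq] at ht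
      rw [ht.1, ht.2]
      linear_combination hp

theorem IsDir.neg {ℓ : Set (ℝ × ℝ)} {d : ℝ × ℝ} (h : IsDir ℓ d) : IsDir ℓ (-d) := by
  refine ⟨neg_ne_zero.2 h.1, fun p hp q => (h.2 p hp q).trans ⟨?_, ?_⟩⟩ <;>
  · rintro ⟨t, ht⟩
    exact ⟨-t, by simp [ht]⟩

theorem IsDir.exists_eq_lineMap {ℓ : Set (ℝ × ℝ)} {d p q w : ℝ × ℝ} (h : IsDir ℓ d)
    (hp : p ∈ ℓ) (hq : q ∈ ℓ) (hw : w ∈ ℓ) (hpq : p ≠ q) : ∃ t : ℝ, w = q + t • (p - q) := by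
  obtain ⟨k, hk⟩ := (h.2 q hq p).1 hp
  obtain ⟨m, hm⟩ := (h.2 q hq w).1 hw
  have hk0 : k ≠ 0 := by
    rintro rfl
    exact hpq (by simpa using hk)
  refine ⟨m / k, ?_⟩
  rw [hm, hk, add_sub_cancel_left, smul_smul, div_mul_cancel₀ _ hk0]

theorem IsDir.lineMap_mem {ℓ : Set (ℝ × ℝ)} {d p q : ℝ × ℝ} (h : IsDir ℓ d)
    (hp : p ∈ ℓ) (hq : q ∈ ℓ) (t : ℝ) : q + t • (p - q) ∈ ℓ := by
  obtain ⟨k, hk⟩ := (h.2 q hq p).1 hp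
  refine (h.2 q hq _).2 ⟨t * k, ?_⟩
  rw [hk, add_sub_cancel_left, smul_smul]

theorem crossDet_ne_zero {ℓ ℓ' : Set (ℝ × ℝ)} {d d' : ℝ × ℝ} (h : IsDir ℓ d) (h' : IsDir ℓ' d')
    (hpar : NotParallel ℓ ℓ') : crossDet d d' ≠ 0 := by
  intro h0
  obtain ⟨p, ⟨hp, hp'⟩, huniq⟩ := hpar
  have hd' : 0 < d'.1 ^ 2 + d'.2 ^ 2 := by
    by_contra! hle
    exact h'.1 (Prod.ext (by simp; nlinarith [sq_nonneg d'.1, sq_nonneg d'.2])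
      (by simp; nlinarith [sq_nonneg d'.1, sq_nonneg d'.2]))
  have hmem : p + (1 : ℝ) • d ∈ ℓ' := by
    refine (h'.2 p hp' _).2 ⟨(d.1 * d'.1 + d.2 * d'.2) / (d'.1 ^ 2 + d'.2 ^ 2), ?_⟩
    unfold crossDet at h0
    ext
    · simp only [Prod.fst_add, Prod.smul_fst, smul_eq_mul]
      field_simp
      linear_combination d'.2 * h0
    · simp only [Prod.snd_add, Prod.smul_snd, smul_eq_mul]
      field_simp
      linear_combination -d'.1 * h0
  have := huniq _ ⟨(h.2 p hp _).2 ⟨1, rfl⟩, hmem⟩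
  rw [one_smul, add_eq_left] at this
  exact h.1 this

/-- A direction along which some ray returns to a closed convex set arbitrarily far out is a
direction of recession. -/
theorem isRec_of_unbounded {K : Set (ℝ × ℝ)} (hc : IsClosed K) (hK : Convex ℝ K)
    {p d : ℝ × ℝ} (h : ∀ T : ℝ, ∃ t ≥ T, p + t • d ∈ K) : IsRec K d := by
  intro x hx s hs
  choose t ht htK using h
  have htop : Filter.Tendsto (fun n : ℕ => t n) Filter.atTop Filter.atTop :=
    Filter.tendsto_atTop_mono (fun n => ht n) tendsto_natCast_atTop_atTop
  have h0 : Filter.Tendsto (fun n : ℕ => s / t n) Filter.atTop (nhds 0) :=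
    htop.const_div_atTop s
  have hlim : Filter.Tendsto (fun n : ℕ => x + s • d + (s / t n) • (p - x))
      Filter.atTop (nhds (x + s • d + (0 : ℝ) • (p - x))) :=
    tendsto_const_nhds.add (h0.smul_const _)
  rw [zero_smul, add_zero] at hlim
  refine hc.mem_of_tendsto hlim ?_
  filter_upwards [htop.eventually_ge_atTop (max s 1)] with n hn
  have hpos : 0 < t n := lt_of_lt_of_le one_pos ((le_max_right s 1).trans hn)
  have hmem := hK hx (htK n) (sub_nonneg.2 ((div_le_one hpos).2 ((le_max_left s 1).trans hn)))
    (div_nonneg hs hpos.le) (sub_add_cancel 1 (s / t n))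
  convert hmem using 1
  ext
  · simp
    field_simp
    ring
  · simp
    field_simp
    ring

theorem exists_isRec_of_cover {K₁ K₂ K₃ : Set (ℝ × ℝ)} (c₁ : Convex ℝ K₁)
    (hc₂ : IsClosed K₂) (c₂ : Convex ℝ K₂) (hc₃ : IsClosed K₃) (c₃ : Convex ℝ K₃)
    (hcov : ∀ p, p ∈ K₁ ∨ p ∈ K₂ ∨ p ∈ K₃) (hne : K₁ ≠ Set.univ) (d : ℝ × ℝ) :
    (IsRec K₂ d ∨ IsRec K₂ (-d)) ∨ (IsRec K₃ d ∨ IsRec K₃ (-d)) := by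
  by_contra! hcon
  obtain ⟨⟨h2, h2'⟩, h3, h3'⟩ := hcon
  have far : ∀ v, ¬ IsRec K₂ v → ¬ IsRec K₃ v → ∀ p, ∃ t ≥ (0 : ℝ), p + t • v ∈ K₁ := by
    intro v hv2 hv3 p
    have b2 := mt (isRec_of_unbounded hc₂ c₂ (p := p)) hv2
    have b3 := mt (isRec_of_unbounded hc₃ c₃ (p := p)) hv3
    push Not at b2 b3
    obtain ⟨T, hT⟩ := b2
    obtain ⟨T', hT'⟩ := b3
    refine ⟨max 0 (max T T'), le_max_left _ _, ?_⟩
    rcases hcov (p + max 0 (max T T') • v) with h | h | h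
    · exact h
    · exact absurd h (hT _ ((le_max_left _ _).trans (le_max_right _ _)))
    · exact absurd h (hT' _ ((le_max_right _ _).trans (le_max_right _ _)))
  refine hne (Set.eq_univ_of_forall fun p => ?_)
  obtain ⟨t, ht, htK⟩ := far d h2 h3 p
  obtain ⟨s, hs, hsK⟩ := far (-d) h2' h3' p
  rcases eq_or_lt_of_le ht with rfl | ht
  · simpa using htK
  have hsum : 0 < t + s := by linarith
  have := c₁ htK hsK (div_nonneg hs hsum.le) (div_nonneg ht.le hsum.le) (by field_simp; ring)
  convert this using 1
  ext
  · simp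
    field_simp
    ring
  · simp
    field_simp
    ring

/-- Let `x`, `y`, `z` be lines through points of `K` on the boundary line `e ⬝ p = c`, in this
order. If `x` and `z` both meet `y` in `K` strictly above that line, then they meet in `K`, and
their common point also lies strictly above that line. -/
theorem Convex.inter_mem_of_ordered {K : Set (ℝ × ℝ)} (hK : Convex ℝ K)
    {e₁ e₂ c α β s t σ τ : ℝ} {px py pz q r w d : ℝ × ℝ}
    (hx : px ∈ K) (hz : pz ∈ K) (hq : q ∈ K) (hr : r ∈ K)
    (cx : e₁ * px.1 + e₂ * px.2 = c) (cy : e₁ * py.1 + e₂ * py.2 = c)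
    (cz : e₁ * pz.1 + e₂ * pz.2 = c)
    (cq : c < e₁ * q.1 + e₂ * q.2) (cr : c < e₁ * r.1 + e₂ * r.2)
    (hσ : σ < 0) (hτ : 0 < τ)
    (hpx : px = py + σ • (e₂, -e₁)) (hpz : pz = py + τ • (e₂, -e₁))
    (hqd : q = py + α • d) (hrd : r = py + β • d)
    (hws : w = q + s • (px - q)) (hwt : w = r + t • (pz - r)) :
    w ∈ K ∧ c < e₁ * w.1 + e₂ * w.2 := by
  have ed : e₁ * d.1 + e₂ * d.2 ≠ 0 := by
    intro h0
    have : e₁ * q.1 + e₂ * q.2 = c := by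
      rw [hqd]
      simp only [Prod.fst_add, Prod.snd_add, Prod.smul_fst, Prod.smul_snd, smul_eq_mul]
      linear_combination cy + α * h0
    linarith
  have w1 : q.1 + s * (px.1 - q.1) = r.1 + t * (pz.1 - r.1) := by
    simpa using congrArg Prod.fst (hws.symm.trans hwt)
  have w2 : q.2 + s * (px.2 - q.2) = r.2 + t * (pz.2 - r.2) := by
    simpa using congrArg Prod.snd (hws.symm.trans hwt)
  have hq1 : q.1 = py.1 + α * d.1 := by simp [hqd]
  have hq2 : q.2 = py.2 + α * d.2 := by simp [hqd]
  have hr1 : r.1 = py.1 + β * d.1 := by simp [hrd]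
  have hr2 : r.2 = py.2 + β * d.2 := by simp [hrd]
  have hx1 : px.1 = py.1 + σ * e₂ := by simp [hpx]
  have hx2 : px.2 = py.2 - σ * e₁ := by simp [hpx, sub_eq_add_neg]
  have hz1 : pz.1 = py.1 + τ * e₂ := by simp [hpz]
  have hz2 : pz.2 = py.2 - τ * e₁ := by simp [hpz, sub_eq_add_neg]
  have hst : s * σ = t * τ := by
    apply mul_right_cancel₀ ed
    rw [hq1, hr1, hx1, hz1] at w1
    rw [hq2, hr2, hx2, hz2] at w2
    linear_combination d.2 * w1 - d.1 * w2
  have hh : (1 - s) * (e₁ * q.1 + e₂ * q.2 - c) = (1 - t) * (e₁ * r.1 + e₂ * r.2 - c) := by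
    linear_combination e₁ * w1 + e₂ * w2 - s * cx + t * cz
  have cw : e₁ * w.1 + e₂ * w.2 - c = (1 - s) * (e₁ * q.1 + e₂ * q.2 - c) := by
    rw [hws]
    simp only [Prod.fst_add, Prod.snd_add, Prod.smul_fst, Prod.smul_snd, smul_eq_mul,
      Prod.fst_sub, Prod.snd_sub]
    linear_combination s * cx
  rcases le_total 0 s with h0 | h0
  · have ht0 : t ≤ 0 := by
      by_contra! h
      nlinarith [mul_pos h hτ, mul_nonneg h0 (neg_nonneg.2 hσ.le)]
    have hpos : 0 < (1 - t) * (e₁ * r.1 + e₂ * r.2 - c) :=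
      mul_pos (by linarith) (by linarith)
    have hs1 : s < 1 := by
      by_contra! h
      nlinarith [mul_nonneg (sub_nonneg.2 h) (sub_nonneg.2 cq.le)]
    exact ⟨hws ▸ hK.add_smul_sub_mem hq hx ⟨h0, hs1.le⟩, by linarith⟩
  · have ht0 : 0 ≤ t := by
      by_contra! h
      nlinarith [mul_pos (neg_pos.2 h) hτ, mul_nonneg (neg_nonneg.2 h0) (neg_nonneg.2 hσ.le)]
    have hpos : 0 < (1 - s) * (e₁ * q.1 + e₂ * q.2 - c) :=
      mul_pos (by linarith) (by linarith)
    have ht1 : t < 1 := by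
      by_contra! h
      nlinarith [mul_nonneg (sub_nonneg.2 h) (sub_nonneg.2 cr.le)]
    exact ⟨hwt ▸ hK.add_smul_sub_mem hr hz ⟨ht0, ht1.le⟩, by linarith⟩

theorem eq_add_smul_of_same_level {e₁ e₂ c : ℝ} {p q : ℝ × ℝ} (he : 0 < e₁ ^ 2 + e₂ ^ 2)
    (hp : e₁ * p.1 + e₂ * p.2 = c) (hq : e₁ * q.1 + e₂ * q.2 = c) :
    p = q + (((e₂ * p.1 - e₁ * p.2) - (e₂ * q.1 - e₁ * q.2)) / (e₁ ^ 2 + e₂ ^ 2)) •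
      (e₂, -e₁) := by
  ext
  · simp only [Prod.fst_add, Prod.smul_fst, smul_eq_mul]
    field_simp
    linear_combination e₁ * hp - e₁ * hq
  · simp only [Prod.snd_add, Prod.smul_snd, smul_eq_mul]
    field_simp
    linear_combination e₂ * hp - e₂ * hq

theorem NotParallel.eq_of_mem {a b : Set (ℝ × ℝ)} (h : NotParallel a b) {p q : ℝ × ℝ}
    (hpa : p ∈ a) (hpb : p ∈ b) (hqa : q ∈ a) (hqb : q ∈ b) : p = q :=
  h.unique ⟨hpa, hpb⟩ ⟨hqa, hqb⟩

/-- If all crossings of `S` lie in `K ∪ K'` and every line of `S` meets `K ∩ K'`, then `S` has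
a subfamily with crossings in `K` and one with crossings in `K'` whose sizes multiply to at
least `S.card`. -/
theorem exists_subfamilies_of_meet_inter {S : Finset (Set (ℝ × ℝ))}
    (hdir : ∀ ℓ ∈ S, ∃ d, IsDir ℓ d)
    (hpar : ∀ a ∈ S, ∀ b ∈ S, a ≠ b → NotParallel a b)
    {K K' : Set (ℝ × ℝ)} (hK : Convex ℝ K) {e₁ e₂ c : ℝ}
    (he : (K ∩ K').Nonempty → 0 < e₁ ^ 2 + e₂ ^ 2)
    (hsep : ∀ p ∈ K, c ≤ e₁ * p.1 + e₂ * p.2) (hsep' : ∀ p ∈ K', e₁ * p.1 + e₂ * p.2 ≤ c)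
    (hcov : ∀ a ∈ S, ∀ b ∈ S, a ≠ b → ∀ p ∈ a, p ∈ b → p ∈ K ∨ p ∈ K')
    (hmeet : ∀ a ∈ S, ∃ p ∈ a, p ∈ K ∧ p ∈ K') :
    ∃ X ⊆ S, ∃ Y ⊆ S, (∀ a ∈ X, ∀ b ∈ X, a ≠ b → ∀ p ∈ a, p ∈ b → p ∈ K) ∧
      (∀ a ∈ Y, ∀ b ∈ Y, a ≠ b → ∀ p ∈ a, p ∈ b → p ∈ K') ∧ S.card ≤ X.card * Y.card := by
  choose! P hPl hPK hPK' using hmeet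
  have he' : ∀ a ∈ S, 0 < e₁ ^ 2 + e₂ ^ 2 := fun a ha => he ⟨P a, hPK a ha, hPK' a ha⟩
  have hlev : ∀ a ∈ S, e₁ * (P a).1 + e₂ * (P a).2 = c := fun a ha =>
    le_antisymm (hsep' _ (hPK' a ha)) (hsep _ (hPK a ha))
  let g : ℝ × ℝ → ℝ := fun p => e₂ * p.1 - e₁ * p.2
  let R : Set (ℝ × ℝ) → Set (ℝ × ℝ) → Prop := fun a b =>
    g (P a) < g (P b) ∧ ∃ p ∈ a, p ∈ b ∧ p ∈ K ∧ c < e₁ * p.1 + e₂ * p.2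
  have gne : ∀ a b, g (P a) < g (P b) → a ≠ b := by
    rintro a b h rfl
    exact lt_irrefl _ h
  have off : ∀ a ∈ S, ∀ p, c < e₁ * p.1 + e₂ * p.2 → P a ≠ p := by
    rintro a ha p hp rfl
    linarith [hlev a ha]
  have tr : ∀ x ∈ S, ∀ y ∈ S, ∀ z ∈ S, R x y → R y z → R x z := by
    rintro x hx y hy z hz ⟨hxy, q, hqx, hqy, hqK, hqc⟩ ⟨hyz, r, hry, hrz, hrK, hrc⟩
    have hxz := hxy.trans hyz
    refine ⟨hxz, ?_⟩
    obtain ⟨w, ⟨hwx, hwz⟩, -⟩ := hpar x hx z hz (gne x z hxz)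
    refine ⟨w, hwx, hwz, ?_⟩
    obtain ⟨dx, hdx⟩ := hdir x hx
    obtain ⟨dy, hdy⟩ := hdir y hy
    obtain ⟨dz, hdz⟩ := hdir z hz
    obtain ⟨s, hs⟩ := hdx.exists_eq_lineMap (hPl x hx) hqx hwx (off x hx q hqc)
    obtain ⟨t, ht⟩ := hdz.exists_eq_lineMap (hPl z hz) hrz hwz (off z hz r hrc)
    obtain ⟨α, hα⟩ := (hdy.2 _ (hPl y hy) q).1 hqy
    obtain ⟨β, hβ⟩ := (hdy.2 _ (hPl y hy) r).1 hry
    exact hK.inter_mem_of_ordered (hPK x hx) (hPK z hz) hqK hrK (hlev x hx) (hlev y hy)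
      (hlev z hz) hqc hrc (div_neg_of_neg_of_pos (sub_neg.2 hxy) (he' x hx))
      (div_pos (sub_pos.2 hyz) (he' x hx))
      (eq_add_smul_of_same_level (he' x hx) (hlev x hx) (hlev y hy))
      (eq_add_smul_of_same_level (he' x hx) (hlev z hz) (hlev y hy)) hα hβ hs ht
  obtain ⟨X, hX, Y, hY, hXR, hYR, hcard⟩ := exists_chain_antichain S R
    (fun x _ h => lt_irrefl _ h.1) tr
  refine ⟨X, hX, Y, hY, ?_, ?_, hcard⟩
  · intro a ha b hb hab p hpa hpb
    have hp := hpar a (hX ha) b (hX hb) hab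
    rcases hXR a ha b hb hab with ⟨-, q, hqa, hqb, hq, -⟩ | ⟨-, q, hqb, hqa, hq, -⟩ <;>
    · rw [hp.eq_of_mem hpa hpb hqa hqb]
      exact hq
  · have key : ∀ a ∈ Y, ∀ b ∈ Y, g (P a) < g (P b) → ∀ p ∈ a, p ∈ b → p ∈ K' := by
      intro a ha b hb hg p hpa hpb
      have haS := hY ha
      have hbS := hY hb
      have hab := gne a b hg
      refine (hcov a haS b hbS hab p hpa hpb).elim (fun hpK => ?_) id
      have hpc : e₁ * p.1 + e₂ * p.2 = c := by
        refine le_antisymm ?_ (hsep p hpK)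
        by_contra! h
        exact hYR a ha b hb ⟨hg, p, hpa, hpb, hpK, h⟩
      by_cases hpPa : p = P a
      · exact hpPa ▸ hPK' a haS
      suffices p = P b from this ▸ hPK' b hbS
      obtain ⟨d, hd⟩ := hdir a haS
      refine (hpar a haS b hbS hab).eq_of_mem hpa hpb ?_ (hPl b hbS)
      have e := eq_add_smul_of_same_level (he' a haS) (hlev b hbS) (hlev a haS)
      have e' := eq_add_smul_of_same_level (he' a haS) hpc (hlev a haS)
      set m := (e₂ * p.1 - e₁ * p.2 - (e₂ * (P a).1 - e₁ * (P a).2)) / (e₁ ^ 2 + e₂ ^ 2)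
      have hm : m ≠ 0 := by
        intro h0
        rw [h0, zero_smul, add_zero] at e'
        exact hpPa e'
      have := hd.lineMap_mem hpa (hPl a haS)
        ((e₂ * (P b).1 - e₁ * (P b).2 - (e₂ * (P a).1 - e₁ * (P a).2)) /
          (e₁ ^ 2 + e₂ ^ 2) / m)
      rw [e', add_sub_cancel_left, smul_smul, div_mul_cancel₀ _ hm, ← e] at this
      exact this
    intro a ha b hb hab p hpa hpb
    rcases lt_trichotomy (g (P a)) (g (P b)) with h | h | h
    · exact key a ha b hb h p hpa hpb
    · have haS := hY ha
      have hbS := hY hb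
      have e := eq_add_smul_of_same_level (he' a haS) (hlev b hbS) (hlev a haS)
      have h0 : e₂ * (P b).1 - e₁ * (P b).2 - (e₂ * (P a).1 - e₁ * (P a).2) = 0 :=
        sub_eq_zero.2 h.symm
      rw [h0, zero_div, zero_smul, add_zero] at e
      rw [(hpar a haS b hbS hab).eq_of_mem hpa hpb (hPl a haS) (e ▸ hPl b hbS)]
      exact hPK' a haS
    · exact key b hb a ha h p hpb hpa

/-- As `exists_subfamilies_of_meet_inter`, but lines all of whose crossings lie in `K` are
allowed to miss `K ∩ K'`. -/
theorem card_le_mu_mul_mu {A S : Finset (Set (ℝ × ℝ))} (hSA : S ⊆ A)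
    (hdir : ∀ ℓ ∈ S, ∃ d, IsDir ℓ d)
    (hpar : ∀ a ∈ S, ∀ b ∈ S, a ≠ b → NotParallel a b)
    {K K' : Set (ℝ × ℝ)} (hK : Convex ℝ K) {e₁ e₂ c : ℝ}
    (he : (K ∩ K').Nonempty → 0 < e₁ ^ 2 + e₂ ^ 2)
    (hsep : ∀ p ∈ K, c ≤ e₁ * p.1 + e₂ * p.2) (hsep' : ∀ p ∈ K', e₁ * p.1 + e₂ * p.2 ≤ c)
    (hcov : ∀ a ∈ S, ∀ b ∈ S, a ≠ b → ∀ p ∈ a, p ∈ b → p ∈ K ∨ p ∈ K')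
    (hmeet : ∀ a ∈ S, (∃ p ∈ a, p ∈ K ∧ p ∈ K') ∨
      ∀ b ∈ S, a ≠ b → ∀ p ∈ a, p ∈ b → p ∈ K) :
    S.card ≤ mu A K * mu A K' := by
  rcases S.eq_empty_or_nonempty with rfl | hS
  · simp
  let p : Set (ℝ × ℝ) → Prop := fun a => ∃ p ∈ a, p ∈ K ∧ p ∈ K'
  have hT : S.filter p ⊆ S := Finset.filter_subset _ _
  obtain ⟨X, hX, Y, hY, hXK, hYK, hcard⟩ := exists_subfamilies_of_meet_inter (S := S.filter p)
    (fun a ha => hdir a (hT ha)) (fun a ha b hb => hpar a (hT ha) b (hT hb)) hK he hsep hsep'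
    (fun a ha b hb => hcov a (hT ha) b (hT hb)) (fun a ha => (Finset.mem_filter.1 ha).2)
  have hU : ∀ a ∈ S.filter (fun a => ¬ p a), a ∈ S ∧
      ∀ b ∈ S, a ≠ b → ∀ p ∈ a, p ∈ b → p ∈ K := by
    intro a ha
    rw [Finset.mem_filter] at ha
    exact ⟨ha.1, (hmeet a ha.1).resolve_left ha.2⟩
  have h1 : (X ∪ S.filter (fun a => ¬ p a)).card ≤ mu A K := by
    refine card_le_mu_s7 (Finset.union_subset ((hX.trans hT).trans hSA)
      ((Finset.filter_subset _ _).trans hSA)) ?_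
    intro a ha b hb hab q hqa hqb
    rcases Finset.mem_union.1 ha with ha | ha
    · rcases Finset.mem_union.1 hb with hb | hb
      · exact hXK a ha b hb hab q hqa hqb
      · exact (hU b hb).2 a (hT (hX ha)) hab.symm q hqb hqa
    · refine (hU a ha).2 b ?_ hab q hqa hqb
      rcases Finset.mem_union.1 hb with hb | hb
      · exact hT (hX hb)
      · exact (hU b hb).1
  rw [Finset.card_union_of_disjoint ((Finset.disjoint_filter_filter_not S S p).mono_left hX)] at h1
  have h2 : Y.card ≤ mu A K' := card_le_mu_s7 ((hY.trans hT).trans hSA) hYK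
  have h3 : 1 ≤ mu A K' := one_le_mu (hS.mono hSA) K'
  have h4 := Finset.card_filter_add_card_filter_not (s := S) p
  calc S.card ≤ X.card * Y.card + (S.filter (fun a => ¬ p a)).card := by omega
    _ ≤ X.card * mu A K' + (S.filter (fun a => ¬ p a)).card * mu A K' :=
      add_le_add (Nat.mul_le_mul_left _ h2) (Nat.le_mul_of_pos_right _ h3)
    _ = (X.card + (S.filter (fun a => ¬ p a)).card) * mu A K' := (add_mul _ _ _).symm
    _ ≤ mu A K * mu A K' := Nat.mul_le_mul_right _ h1

theorem IsRec.inter_mem {K : Set (ℝ × ℝ)} {a b c q r w : ℝ × ℝ} {t u v : ℝ}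
    (ha : IsRec K a) (hc : IsRec K c) (hab : 0 < crossDet a b) (hbc : 0 < crossDet b c)
    (hac : 0 < crossDet a c) (hq : q ∈ K) (hr : r ∈ K) (hrq : r = q + t • b)
    (hwq : w = q + v • a) (hwr : w = r + u • c) : w ∈ K := by
  have h := hwr.symm.trans hwq
  rw [hrq] at h
  have h1 : q.1 + t * b.1 + u * c.1 = q.1 + v * a.1 := by simpa using congrArg Prod.fst h
  have h2 : q.2 + t * b.2 + u * c.2 = q.2 + v * a.2 := by simpa using congrArg Prod.snd h
  have hv : t * crossDet b c = v * crossDet a c := by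
    unfold crossDet
    linear_combination c.2 * h1 - c.1 * h2
  have hu : t * crossDet a b = -u * crossDet a c := by
    unfold crossDet
    linear_combination a.1 * h2 - a.2 * h1
  rcases le_total 0 t with ht | ht
  · rw [hwq]
    refine ha q hq v (nonneg_of_mul_nonneg_left ?_ hac)
    rw [← hv]
    positivity
  · rw [hwr]
    refine hc r hr u (nonneg_of_mul_nonneg_left (b := crossDet a c) ?_ hac)
    nlinarith [mul_nonneg (neg_nonneg.2 ht) hab.le]

/-- A nonempty set with three directions of recession that positively span the plane is the
whole plane. -/
theorem IsRec.eq_univ {K : Set (ℝ × ℝ)} (hK : K.Nonempty) {a b c : ℝ × ℝ}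
    (ha : IsRec K a) (hb : IsRec K b) (hc : IsRec K c) (hab : 0 < crossDet a b)
    (hbc : 0 < crossDet b c) (hca : 0 < crossDet c a) : K = Set.univ := by
  obtain ⟨q, hq⟩ := hK
  refine Set.eq_univ_of_forall fun p => ?_
  have large : ∀ x m : ℝ, 0 < m → ∀ k ≥ |x| / m, 0 ≤ x + k * m := by
    intro x m hm k hk
    rw [ge_iff_le, div_le_iff₀ hm] at hk
    linarith [neg_abs_le x]
  set α := crossDet (p - q) b / crossDet a b with hα
  set β := crossDet a (p - q) / crossDet a b with hβ
  set k := max 0 (max (|α| / crossDet b c) (|β| / crossDet c a))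
  have k0 : 0 ≤ k := le_max_left _ _
  have k1 := large α _ hbc k ((le_max_left _ _).trans (le_max_right _ _))
  have k2 := large β _ hca k ((le_max_right _ _).trans (le_max_right _ _))
  have hmem := hc _ (hb _ (ha q hq _ k1) _ k2) (k * crossDet a b) (mul_nonneg k0 hab.le)
  convert hmem using 1
  have h1 : α * crossDet a b = crossDet (p - q) b := div_mul_cancel₀ _ hab.ne'
  have h2 : β * crossDet a b = crossDet a (p - q) := div_mul_cancel₀ _ hab.ne'
  clear_value α β k
  ext
  · apply mul_right_cancel₀ hab.ne'
    simp only [Prod.fst_add, Prod.smul_fst, smul_eq_mul]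
    unfold crossDet at *
    simp only [Prod.fst_sub, Prod.snd_sub] at *
    linear_combination -a.1 * h1 - b.1 * h2
  · apply mul_right_cancel₀ hab.ne'
    simp only [Prod.snd_add, Prod.smul_snd, smul_eq_mul]
    unfold crossDet at *
    simp only [Prod.fst_sub, Prod.snd_sub] at *
    linear_combination -a.2 * h1 - b.2 * h2

theorem crossDet_swap (u v : ℝ × ℝ) : crossDet v u = -crossDet u v := by
  unfold crossDet
  ring

/-- A line that starts in `K₁` at infinity and misses `K₂ ∩ K₃` misses `K₂` or `K₃` outside
`K₁`. -/
theorem subset_union_of_disjoint_inter {K₁ K₂ K₃ ℓ : Set (ℝ × ℝ)} {d : ℝ × ℝ}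
    (hd : IsDir ℓ d) (hrec : IsRec K₁ d) (hc₂ : IsClosed K₂) (hc₃ : IsClosed K₃)
    (hcov : ∀ p, p ∈ K₁ ∨ p ∈ K₂ ∨ p ∈ K₃) (h : ¬ ∃ p ∈ ℓ, p ∈ K₂ ∧ p ∈ K₃) :
    (∀ p ∈ ℓ, p ∉ K₁ → p ∈ K₂) ∨ (∀ p ∈ ℓ, p ∉ K₁ → p ∈ K₃) := by
  by_contra! hcon
  obtain ⟨⟨p, hp, hp1, hp2⟩, q, hq, hq1, hq3⟩ := hcon
  have hp3 := ((hcov p).resolve_left hp1).resolve_left hp2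
  have hq2 := ((hcov q).resolve_left hq1).resolve_right hq3
  let φ : ℝ → ℝ × ℝ := fun t => p + t • d
  have hφ : Continuous φ := by fun_prop
  obtain ⟨m, hm⟩ := (hd.2 p hp q).1 hq
  have hlower : IsLowerSet {t | φ t ∉ K₁} := by
    intro t s hst ht hs
    apply ht
    have := hrec _ hs (t - s) (sub_nonneg.2 hst)
    rwa [add_assoc, ← add_smul, add_sub_cancel] at this
  obtain ⟨t, -, ht2, ht3⟩ := isPreconnected_closed_iff.1 hlower.ordConnected.isPreconnected
    (φ ⁻¹' K₂) (φ ⁻¹' K₃) (hc₂.preimage hφ) (hc₃.preimage hφ)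
    (fun t ht => (hcov (φ t)).resolve_left ht)
    ⟨m, by simpa [φ, ← hm] using hq1, by simpa [φ, ← hm] using hq2⟩
    ⟨0, by simpa [φ] using hp1, by simpa [φ] using hp3⟩
  exact h ⟨φ t, (hd.2 p hp _).2 ⟨t, rfl⟩, ht2, ht3⟩

/-- A family of lines that all start in `K₁ ≠ ℝ²` at infinity satisfies the product bound. -/
theorem card_le_mu_mul_mu_mul_mu {A F : Finset (Set (ℝ × ℝ))} (hFA : F ⊆ A)
    (hpar : PairwiseNonParallel A) {K₁ K₂ K₃ : Set (ℝ × ℝ)}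
    (hF : ∀ ℓ ∈ F, ∃ d, IsDir ℓ d ∧ IsRec K₁ d)
    (hc₂ : IsClosed K₂) (c₂ : Convex ℝ K₂) (hc₃ : IsClosed K₃) (c₃ : Convex ℝ K₃)
    (hcov : ∀ p, p ∈ K₁ ∨ p ∈ K₂ ∨ p ∈ K₃) (hne : K₁ ≠ Set.univ) {e₁ e₂ c : ℝ}
    (he : (K₂ ∩ K₃).Nonempty → 0 < e₁ ^ 2 + e₂ ^ 2)
    (hsep : ∀ p ∈ K₂, c ≤ e₁ * p.1 + e₂ * p.2) (hsep' : ∀ p ∈ K₃, e₁ * p.1 + e₂ * p.2 ≤ c) :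
    F.card ≤ mu A K₁ * (mu A K₂ * mu A K₃) := by
  choose! D hD hDrec using hF
  have hparF : ∀ a ∈ F, ∀ b ∈ F, a ≠ b → NotParallel a b := fun a ha b hb =>
    hpar a (hFA ha) b (hFA hb)
  have hdet : ∀ a ∈ F, ∀ b ∈ F, a ≠ b → crossDet (D a) (D b) ≠ 0 := fun a ha b hb hab =>
    crossDet_ne_zero (hD a ha) (hD b hb) (hparF a ha b hb hab)
  have hself : ∀ u, crossDet u u = 0 := fun u => by
    unfold crossDet
    ring
  let R : Set (ℝ × ℝ) → Set (ℝ × ℝ) → Prop := fun a b =>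
    0 < crossDet (D a) (D b) ∧ ∃ p ∈ a, p ∈ b ∧ p ∈ K₁
  have tr : ∀ x ∈ F, ∀ y ∈ F, ∀ z ∈ F, R x y → R y z → R x z := by
    rintro x hx y hy z hz ⟨hxy, q, hqx, hqy, hq⟩ ⟨hyz, r, hry, hrz, hr⟩
    have hne' : x ≠ z := by
      rintro rfl
      rw [crossDet_swap] at hyz
      linarith
    have hxz : 0 < crossDet (D x) (D z) := by
      refine lt_of_le_of_ne ?_ (hdet x hx z hz hne').symm
      by_contra! h
      refine hne (IsRec.eq_univ ⟨q, hq⟩ (hDrec x hx) (hDrec y hy) (hDrec z hz) hxy hyz ?_)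
      rw [crossDet_swap]
      linarith
    obtain ⟨w, ⟨hwx, hwz⟩, -⟩ := hparF x hx z hz hne'
    obtain ⟨t, ht⟩ := ((hD y hy).2 q hqy r).1 hry
    obtain ⟨v, hv⟩ := ((hD x hx).2 q hqx w).1 hwx
    obtain ⟨u, hu⟩ := ((hD z hz).2 r hrz w).1 hwz
    exact ⟨hxz, w, hwx, hwz,
      (hDrec x hx).inter_mem (hDrec z hz) hxy hyz hxz hq hr ht hv hu⟩
  obtain ⟨X, hX, Y, hY, hXR, hYR, hcard⟩ := exists_chain_antichain F R
    (fun x _ h => by linarith [h.1, hself (D x)]) tr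
  have hXmu : X.card ≤ mu A K₁ := by
    refine card_le_mu_s7 (hX.trans hFA) fun a ha b hb hab p hpa hpb => ?_
    have hp := hparF a (hX ha) b (hX hb) hab
    rcases hXR a ha b hb hab with ⟨-, q, hqa, hqb, hq⟩ | ⟨-, q, hqb, hqa, hq⟩ <;>
    · rw [hp.eq_of_mem hpa hpb hqa hqb]
      exact hq
  have hY1 : ∀ a ∈ Y, ∀ b ∈ Y, a ≠ b → ∀ p ∈ a, p ∈ b → p ∉ K₁ := by
    intro a ha b hb hab p hpa hpb hp
    rcases lt_or_gt_of_ne (hdet a (hY ha) b (hY hb) hab) with h | h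
    · refine hYR b hb a ha ⟨?_, p, hpb, hpa, hp⟩
      rw [crossDet_swap]
      linarith
    · exact hYR a ha b hb ⟨h, p, hpa, hpb, hp⟩
  have hYdir : ∀ ℓ ∈ Y, ∃ d, IsDir ℓ d := fun ℓ hℓ => ⟨D ℓ, hD ℓ (hY hℓ)⟩
  have hYpar : ∀ a ∈ Y, ∀ b ∈ Y, a ≠ b → NotParallel a b := fun a ha b hb =>
    hparF a (hY ha) b (hY hb)
  have hYcov : ∀ a ∈ Y, ∀ b ∈ Y, a ≠ b → ∀ p ∈ a, p ∈ b → p ∈ K₂ ∨ p ∈ K₃ :=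
    fun a ha b hb hab p hpa hpb => (hcov p).resolve_left (hY1 a ha b hb hab p hpa hpb)
  have hdich := fun a (ha : a ∈ Y) =>
    subset_union_of_disjoint_inter (hD a (hY ha)) (hDrec a (hY ha)) hc₂ hc₃ hcov
  have hYmu : Y.card ≤ mu A K₂ * mu A K₃ := by
    by_cases hcase : ∀ a ∈ Y, (∃ p ∈ a, p ∈ K₂ ∧ p ∈ K₃) ∨ ∀ p ∈ a, p ∉ K₁ → p ∈ K₂
    · refine card_le_mu_mul_mu (hY.trans hFA) hYdir hYpar c₂ he hsep hsep' hYcov fun a ha => ?_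
      exact (hcase a ha).imp_right fun h b hb hab p hpa hpb =>
        h p hpa (hY1 a ha b hb hab p hpa hpb)
    · push Not at hcase
      obtain ⟨b, hb, hbm, q, hqb, hq1, hq2⟩ := hcase
      have hb3 := (hdich b hb (by push Not; exact hbm)).resolve_left
        fun h => hq2 (h q hqb hq1)
      rw [mul_comm]
      refine card_le_mu_mul_mu (e₁ := -e₁) (e₂ := -e₂) (c := -c) (hY.trans hFA) hYdir hYpar c₃
        (fun h => ?_) (fun p hp => ?_) (fun p hp => ?_)
        (fun a ha b hb hab p hpa hpb => (hYcov a ha b hb hab p hpa hpb).symm) fun a ha => ?_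
      · rw [neg_sq, neg_sq]
        exact he (Set.inter_comm K₃ K₂ ▸ h)
      · linarith [hsep' p hp]
      · linarith [hsep p hp]
      · by_cases ham : ∃ p ∈ a, p ∈ K₂ ∧ p ∈ K₃
        · obtain ⟨p, hpa, hp2, hp3⟩ := ham
          exact Or.inl ⟨p, hpa, hp3, hp2⟩
        right
        have ha3 : ∀ p ∈ a, p ∉ K₁ → p ∈ K₃ := by
          refine (hdich a ha ham).resolve_left fun ha2 => ?_
          have hab : a ≠ b := by
            rintro rfl
            exact hq2 (ha2 q hqb hq1)
          obtain ⟨w, ⟨hwa, hwb⟩, -⟩ := hYpar a ha b hb hab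
          have hw1 := hY1 a ha b hb hab w hwa hwb
          exact ham ⟨w, hwa, ha2 w hwa hw1, hb3 w hwb hw1⟩
        exact fun b hb hab p hpa hpb => ha3 p hpa (hY1 a ha b hb hab p hpa hpb)
  exact hcard.trans (Nat.mul_le_mul hXmu hYmu)

/-- Closures of disjoint open convex sets are weakly separated by a line. -/
theorem exists_separating_line {U V : Set (ℝ × ℝ)} (hU : IsOpen U) (cU : Convex ℝ U)
    (hV : IsOpen V) (cV : Convex ℝ V) (hUV : Disjoint U V) : ∃ e₁ e₂ c : ℝ,
      ((closure U ∩ closure V).Nonempty → 0 < e₁ ^ 2 + e₂ ^ 2) ∧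
      (∀ p ∈ closure U, c ≤ e₁ * p.1 + e₂ * p.2) ∧
      ∀ p ∈ closure V, e₁ * p.1 + e₂ * p.2 ≤ c := by
  obtain ⟨f, c, hfV, hfU⟩ := geometric_hahn_banach_open_open cV hV cU hU hUV.symm
  have hf : ∀ p, f p = f (1, 0) * p.1 + f (0, 1) * p.2 := by
    intro p
    have : p = p.1 • ((1, 0) : ℝ × ℝ) + p.2 • ((0, 1) : ℝ × ℝ) := by ext <;> simp
    conv_lhs => rw [this]
    simp only [map_add, map_smul, smul_eq_mul]
    ring
  refine ⟨f (1, 0), f (0, 1), c, ?_, ?_, ?_⟩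
  · rintro ⟨p, hpU, hpV⟩
    obtain ⟨u, hu⟩ := closure_nonempty_iff.1 ⟨p, hpU⟩
    obtain ⟨v, hv⟩ := closure_nonempty_iff.1 ⟨p, hpV⟩
    by_contra! h
    have h1 : f (1, 0) = 0 := by nlinarith [sq_nonneg (f (1, 0)), sq_nonneg (f (0, 1))]
    have h2 : f (0, 1) = 0 := by nlinarith [sq_nonneg (f (1, 0)), sq_nonneg (f (0, 1))]
    have hu' := hfU u hu
    have hv' := hfV v hv
    rw [hf, h1, h2] at hu' hv'
    linarith
  · intro p hp
    rw [← hf]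
    exact closure_minimal (fun q hq => (hfU q hq).le)
      (isClosed_le continuous_const f.continuous) hp
  · intro p hp
    rw [← hf]
    exact closure_minimal (fun q hq => (hfV q hq).le)
      (isClosed_le f.continuous continuous_const) hp

/-- The product bound for regular closed convex parts. -/
theorem two_mul_card_le_of_regular_cover {A : Finset (Set (ℝ × ℝ))} (hlines : ∀ ℓ ∈ A, IsLine ℓ)
    (hpar : PairwiseNonParallel A) {U₁ U₂ U₃ : Set (ℝ × ℝ)}
    (o₁ : IsOpen U₁) (c₁ : Convex ℝ U₁) (o₂ : IsOpen U₂) (c₂ : Convex ℝ U₂)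
    (o₃ : IsOpen U₃) (c₃ : Convex ℝ U₃)
    (d₁₂ : Disjoint U₁ U₂) (d₁₃ : Disjoint U₁ U₃) (d₂₃ : Disjoint U₂ U₃)
    (hcov : ∀ p, p ∈ closure U₁ ∨ p ∈ closure U₂ ∨ p ∈ closure U₃) :
    2 * A.card ≤ 3 * (mu A (closure U₁) * mu A (closure U₂) * mu A (closure U₃)) := by
  rcases A.eq_empty_or_nonempty with rfl | hA
  · simp
  have p₁ := one_le_mu hA (closure U₁)
  have p₂ := one_le_mu hA (closure U₂)
  have p₃ := one_le_mu hA (closure U₃)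
  have huniv : ∀ K, K = Set.univ → A.card ≤ mu A K := by
    rintro K rfl
    exact card_le_mu_s7 subset_rfl fun _ _ _ _ _ _ _ _ => Set.mem_univ _
  by_cases n₁ : closure U₁ = Set.univ
  · linarith [Nat.mul_le_mul (huniv _ n₁) (Nat.mul_le_mul p₂ p₃)]
  by_cases n₂ : closure U₂ = Set.univ
  · linarith [Nat.mul_le_mul (huniv _ n₂) (Nat.mul_le_mul p₁ p₃)]
  by_cases n₃ : closure U₃ = Set.univ
  · linarith [Nat.mul_le_mul (huniv _ n₃) (Nat.mul_le_mul p₁ p₂)]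
  let q : Set (ℝ × ℝ) → Set (ℝ × ℝ) → Prop := fun K ℓ => ∃ d, IsDir ℓ d ∧ IsRec K d
  have ends : ∀ ℓ ∈ A, ∀ {U V W : Set (ℝ × ℝ)}, Convex ℝ U → Convex ℝ V → Convex ℝ W →
      (∀ p, p ∈ closure U ∨ p ∈ closure V ∨ p ∈ closure W) → closure U ≠ Set.univ →
      q (closure V) ℓ ∨ q (closure W) ℓ := by
    intro ℓ hℓ U V W cU cV cW h hne
    obtain ⟨d, hd⟩ := (hlines ℓ hℓ).exists_isDir
    rcases exists_isRec_of_cover cU.closure isClosed_closure cV.closure isClosed_closure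
      cW.closure h hne d with (h | h) | (h | h)
    exacts [Or.inl ⟨d, hd, h⟩, Or.inl ⟨-d, hd.neg, h⟩, Or.inr ⟨d, hd, h⟩, Or.inr ⟨-d, hd.neg, h⟩]
  have hcov₂ : ∀ p, p ∈ closure U₂ ∨ p ∈ closure U₁ ∨ p ∈ closure U₃ := fun p => by
    have := hcov p
    tauto
  have hcov₃ : ∀ p, p ∈ closure U₃ ∨ p ∈ closure U₁ ∨ p ∈ closure U₂ := fun p => by
    have := hcov p
    tauto
  have bound : ∀ {U V W : Set (ℝ × ℝ)}, IsOpen V → Convex ℝ V → IsOpen W → Convex ℝ W →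
      Disjoint V W → (∀ p, p ∈ closure U ∨ p ∈ closure V ∨ p ∈ closure W) →
      closure U ≠ Set.univ → (A.filter (q (closure U))).card ≤
        mu A (closure U) * (mu A (closure V) * mu A (closure W)) := by
    intro U V W oV cV oW cW hVW h hne
    obtain ⟨e₁, e₂, c, he, hs, hs'⟩ := exists_separating_line oV cV oW cW hVW
    exact card_le_mu_mul_mu_mul_mu (Finset.filter_subset _ _) hpar
      (fun ℓ hℓ => (Finset.mem_filter.1 hℓ).2) isClosed_closure cV.closure isClosed_closure
      cW.closure h hne he hs hs'
  have b₁ := bound o₂ c₂ o₃ c₃ d₂₃ hcov n₁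
  have b₂ := bound o₁ c₁ o₃ c₃ d₁₃ hcov₂ n₂
  have b₃ := bound o₁ c₁ o₂ c₂ d₁₂ hcov₃ n₃
  clear_value q
  have count : 2 * A.card ≤ (A.filter (q (closure U₁))).card +
      (A.filter (q (closure U₂))).card + (A.filter (q (closure U₃))).card := by
    rw [Finset.card_filter, Finset.card_filter, Finset.card_filter, ← Finset.sum_add_distrib,
      ← Finset.sum_add_distrib, mul_comm, ← smul_eq_mul]
    refine Finset.card_nsmul_le_sum _ _ _ fun ℓ hℓ => ?_
    have e₁ := ends ℓ hℓ c₁ c₂ c₃ hcov n₁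
    have e₂ := ends ℓ hℓ c₂ c₁ c₃ hcov₂ n₂
    have e₃ := ends ℓ hℓ c₃ c₁ c₂ hcov₃ n₃
    by_cases h₁ : q (closure U₁) ℓ <;> by_cases h₂ : q (closure U₂) ℓ <;>
      by_cases h₃ : q (closure U₃) ℓ <;> simp_all
  linarith

/-- **Lemma (three parts).** For `A` a set of `n` lines in general position and any convex
partition `(C₁, C₂, C₃)` of the plane into three parts, `μ_A(C₁)·μ_A(C₂)·μ_A(C₃) ≥ 2n/3`. -/
theorem three_parts_lemma (n : ℕ) (A : Finset (Set (ℝ × ℝ)))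
    (hlines : ∀ ℓ ∈ A, IsLine ℓ) (hcard : A.card = n) (hgp : GenPos A)
    (C : Fin 3 → Set (ℝ × ℝ)) (hC : ConvexPartition C) :
    (2 * n : ℝ) / 3 ≤ (mu A (C 0) : ℝ) * (mu A (C 1) : ℝ) * (mu A (C 2) : ℝ) := by
  obtain ⟨hcl, hconv, hcov, hdisj⟩ := hC
  have hreg : ∀ p, p ∈ closure (interior (C 0)) ∨ p ∈ closure (interior (C 1)) ∨
      p ∈ closure (interior (C 2)) := by
    intro p
    have h := dense_iUnion_interior_of_closed hcl hcov p
    rw [closure_iUnion_of_finite, Set.mem_iUnion] at h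
    obtain ⟨j, hj⟩ := h
    fin_cases j
    exacts [Or.inl hj, Or.inr (Or.inl hj), Or.inr (Or.inr hj)]
  have hd : ∀ i j, i ≠ j → Disjoint (interior (C i)) (interior (C j)) := fun i j hij =>
    Set.disjoint_iff_inter_eq_empty.2 (hdisj hij)
  have key := two_mul_card_le_of_regular_cover hlines hgp.1 isOpen_interior (hconv 0).interior
    isOpen_interior (hconv 1).interior isOpen_interior (hconv 2).interior
    (hd 0 1 (by decide)) (hd 0 2 (by decide)) (hd 1 2 (by decide)) hreg
  have hmu : ∀ j, mu A (closure (interior (C j))) ≤ mu A (C j) := fun j =>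
    mu_mono (closure_minimal interior_subset (hcl j))
  have h3 := key.trans (Nat.mul_le_mul_left 3
    (Nat.mul_le_mul (Nat.mul_le_mul (hmu 0) (hmu 1)) (hmu 2)))
  rw [hcard] at h3
  rw [div_le_iff₀ three_pos, mul_comm _ (3 : ℝ)]
  exact_mod_cast h3
end

section
/- Let A and B be two finite sets of lines in ℝ² such that A ∪ B is in general position, and let r ≥ 2 be an integer. Then either there exists a pair (r₁, r₂) of positive integers with r₁ + r₂ = r for which there is an equitable (r₁, r₂) cut, or there exists a triple (r₁, r₂, r₃) of positive integers with r₁ + r₂ + r₃ = r for which there is an equitable (r₁, r₂, r₃) cut. -/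
open scoped Classical

/-- An equitable `(r₁, …, r_k)` cut for `A` and `B` (with `r₁ + ⋯ + r_k = r`): a convex
partition `(C₁, …, C_k)` such that `μ_A(C_i) ≥ (2|A|/3)^{r_i/r} − 2` and
`μ_B(C_i) ≥ (2|B|/3)^{r_i/r} − 2` for every `i`. -/
def EquitableCut (A B : Finset (Set (ℝ × ℝ))) (r : ℕ) {k : ℕ}
    (rs : Fin k → ℕ) (C : Fin k → Set (ℝ × ℝ)) : Prop :=
  ConvexPartition C ∧
  ∀ i : Fin k,
    ((2 * A.card / 3 : ℝ) ^ ((rs i : ℝ) / r) - 2 ≤ (mu A (C i) : ℝ)) ∧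
    ((2 * B.card / 3 : ℝ) ^ ((rs i : ℝ) / r) - 2 ≤ (mu B (C i) : ℝ))

/-- The abscissa of the intersection point of the lines `y = α i * x + β i` and
`y = α j * x + β j`. -/
noncomputable def crossX {ι : Type*} (α β : ι → ℝ) (i j : ι) : ℝ := (β j - β i) / (α i - α j)

/-- The intersection point of the lines `y = α i * x + β i` and `y = α j * x + β j`. -/
noncomputable def cross {ι : Type*} (α β : ι → ℝ) (i j : ι) : ℝ × ℝ :=
  (crossX α β i j, α i * crossX α β i j + β i)

/-- Some subfamily of `A` with at least `T` lines has all its intersection points in `K`. -/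
def HasCluster {ι : Type*} (α β : ι → ℝ) (A : Finset ι) (K : Set (ℝ × ℝ)) (T : ℝ) : Prop :=
  ∃ A' ⊆ A, T ≤ (A'.card : ℝ) ∧ ∀ i ∈ A', ∀ j ∈ A', i ≠ j → cross α β i j ∈ K

section Combinatorics

variable {ι : Type*}

/-- Mirsky's theorem, in product form. -/
lemma exists_chain_antichain_s8 (Z : Finset ι) (R : ι → ι → Prop)
    (htrans : ∀ i ∈ Z, ∀ j ∈ Z, ∀ k ∈ Z, R i j → R j k → R i k) (hirr : ∀ i ∈ Z, ¬ R i i) :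
    ∃ C ⊆ Z, ∃ D ⊆ Z, (∀ i ∈ C, ∀ j ∈ C, i ≠ j → R i j ∨ R j i) ∧
      (∀ i ∈ D, ∀ j ∈ D, ¬ R i j) ∧ Z.card ≤ C.card * D.card := by
  rcases Z.eq_empty_or_nonempty with rfl | hne
  · exact ⟨∅, by simp, ∅, by simp, by simp, by simp, by simp⟩
  set P : ι → Finset (Finset ι) := fun z => Z.powerset.filter fun S =>
    (∀ i ∈ S, ∀ j ∈ S, i ≠ j → R i j ∨ R j i) ∧ ∀ x ∈ S, x = z ∨ R x z with hP
  set f : ι → ℕ := fun z => (P z).sup Finset.card with hf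
  have hPne : ∀ z, (P z).Nonempty := fun z => ⟨∅, by simp [hP]⟩
  have hatt : ∀ z, ∃ S ∈ P z, f z = S.card := fun z =>
    Finset.exists_mem_eq_sup (P z) (hPne z) Finset.card
  have hpos : ∀ z ∈ Z, 1 ≤ f z := by
    intro z hz
    have : ({z} : Finset ι) ∈ P z := by
      simp [hP, hz]
    have h := Finset.le_sup (f := Finset.card) this
    rwa [Finset.card_singleton] at h
  have hlt : ∀ z ∈ Z, ∀ z' ∈ Z, R z z' → f z < f z' := by
    intro z hz z' hz' hR
    obtain ⟨S, hS, hfS⟩ := hatt z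
    simp only [hP, Finset.mem_filter, Finset.mem_powerset] at hS
    obtain ⟨hSZ, hch, hend⟩ := hS
    have hend' : ∀ x ∈ S, R x z' := by
      intro x hx
      rcases hend x hx with rfl | h
      · exact hR
      · exact htrans x (hSZ hx) z hz z' hz' h hR
    have hnot : z' ∉ S := fun h => hirr z' hz' (hend' z' h)
    have hmem : insert z' S ∈ P z' := by
      simp only [hP, Finset.mem_filter, Finset.mem_powerset]
      refine ⟨Finset.insert_subset hz' hSZ, ?_, ?_⟩
      · intro i hi j hj hij
        rcases Finset.mem_insert.1 hi with rfl | hi' <;>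
          rcases Finset.mem_insert.1 hj with rfl | hj'
        · exact absurd rfl hij
        · exact Or.inr (hend' j hj')
        · exact Or.inl (hend' i hi')
        · exact hch i hi' j hj' hij
      · intro x hx
        rcases Finset.mem_insert.1 hx with rfl | hx
        · exact Or.inl rfl
        · exact Or.inr (hend' x hx)
    have := Finset.le_sup (f := Finset.card) hmem
    rw [Finset.card_insert_of_notMem hnot] at this
    rw [hfS]
    exact this
  obtain ⟨z₀, hz₀, hmax⟩ := Finset.exists_max_image Z f hne
  obtain ⟨C, hC, hfC⟩ := hatt z₀
  simp only [hP, Finset.mem_filter, Finset.mem_powerset] at hC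
  obtain ⟨z₁, hz₁, hmax₁⟩ :=
    Finset.exists_max_image Z (fun z => (Z.filter fun x => f x = f z).card) hne
  refine ⟨C, hC.1, Z.filter fun x => f x = f z₁, Finset.filter_subset _ _, hC.2.1, ?_, ?_⟩
  · intro i hi j hj hR
    have h₁ := Finset.mem_filter.1 hi
    have h₂ := Finset.mem_filter.1 hj
    have := hlt i h₁.1 j h₂.1 hR
    omega
  · have h₁ := Finset.card_le_mul_card_image (f := f) Z
      (Z.filter fun x => f x = f z₁).card (by
        intro a ha
        obtain ⟨z, hz, rfl⟩ := Finset.mem_image.1 ha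
        exact hmax₁ z hz)
    have h₂ : (Z.image f).card ≤ C.card := by
      have : Z.image f ⊆ Finset.Icc 1 (f z₀) := by
        intro a ha
        obtain ⟨z, hz, rfl⟩ := Finset.mem_image.1 ha
        exact Finset.mem_Icc.2 ⟨hpos z hz, hmax z hz⟩
      have := Finset.card_le_card this
      rw [Nat.card_Icc] at this
      omega
    calc Z.card ≤ _ := h₁
      _ ≤ _ := Nat.mul_le_mul_left _ h₂
      _ = _ := Nat.mul_comm _ _

variable {α β : ι → ℝ}

lemma crossX_comm (i j : ι) : crossX α β i j = crossX α β j i := by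
  unfold crossX
  rw [← neg_sub (β i) (β j), ← neg_sub (α j) (α i), neg_div_neg_eq]

lemma cross_comm {i j : ι} (h : α i ≠ α j) : cross α β i j = cross α β j i := by
  have h' : α i - α j ≠ 0 := sub_ne_zero.2 h
  have : α i * crossX α β i j + β i = α j * crossX α β i j + β j := by
    unfold crossX
    field_simp
    ring
  rw [cross, cross, crossX_comm j i, this]

lemma crossX_between {a b c : ι} (hab : α a < α b) (hbc : α b < α c) :
    (crossX α β a b ≤ crossX α β a c ∧ crossX α β a c ≤ crossX α β b c) ∨
      (crossX α β b c ≤ crossX α β a c ∧ crossX α β a c ≤ crossX α β a b) := by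
  have key : ∀ {i j : ι}, α i < α j → crossX α β i j * (α j - α i) = β i - β j := by
    intro i j h
    have : α i - α j ≠ 0 := by linarith
    unfold crossX
    field_simp
    ring
  have h₁ := key hab
  have h₂ := key hbc
  have h₃ := key (hab.trans hbc)
  generalize crossX α β a b = x at *
  generalize crossX α β b c = y at *
  generalize crossX α β a c = z at *
  have e₁ : (z - x) * (α c - α a) = (y - x) * (α c - α b) := by linear_combination h₃ - h₁ - h₂
  have e₂ : (y - z) * (α c - α a) = (y - x) * (α b - α a) := by linear_combination h₁ + h₂ - h₃
  have hac : 0 < α c - α a := by linarith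
  rcases le_total x y with h | h
  · left
    constructor
    · have : 0 ≤ (z - x) * (α c - α a) := by rw [e₁]; exact mul_nonneg (by linarith) (by linarith)
      linarith [nonneg_of_mul_nonneg_left this hac]
    · have : 0 ≤ (y - z) * (α c - α a) := by rw [e₂]; exact mul_nonneg (by linarith) (by linarith)
      linarith [nonneg_of_mul_nonneg_left this hac]
  · right
    constructor
    · have : 0 ≤ (z - y) * (α c - α a) := by
        have : (z - y) * (α c - α a) = (x - y) * (α b - α a) := by linear_combination -e₂
        rw [this]; exact mul_nonneg (by linarith) (by linarith)
      linarith [nonneg_of_mul_nonneg_left this hac]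
    · have : 0 ≤ (x - z) * (α c - α a) := by
        have : (x - z) * (α c - α a) = (x - y) * (α c - α b) := by linear_combination -e₁
        rw [this]; exact mul_nonneg (by linarith) (by linarith)
      linarith [nonneg_of_mul_nonneg_left this hac]

/-- If each line meets `K` in a half-line, pointing right exactly for the lines of small slope,
then the lines split as in the Erdős–Szekeres theorem: crossings inside or outside `K`. -/
lemma exists_inside_outside (Z : Finset ι) (hα : Set.InjOn α Z) (K : Set (ℝ × ℝ))
    (up : ι → Prop)
    (hup : ∀ i ∈ Z, up i → ∀ x x' : ℝ, x ≤ x' → (x, α i * x + β i) ∈ K → (x', α i * x' + β i) ∈ K)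
    (hdown : ∀ i ∈ Z, ¬ up i →
      ∀ x x' : ℝ, x ≤ x' → (x', α i * x' + β i) ∈ K → (x, α i * x + β i) ∈ K)
    (hsep : ∀ i ∈ Z, ∀ j ∈ Z, up i → ¬ up j → α i < α j) :
    ∃ C ⊆ Z, ∃ D ⊆ Z, (∀ i ∈ C, ∀ j ∈ C, i ≠ j → cross α β i j ∈ K) ∧
      (∀ i ∈ D, ∀ j ∈ D, i ≠ j → cross α β i j ∉ K) ∧ Z.card ≤ C.card * D.card := by
  set before : ι → ι → Prop := fun i j => (up i ∧ ¬ up j) ∨ ((up i ↔ up j) ∧ α j < α i)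
    with hbefore
  have hne : ∀ i ∈ Z, ∀ j ∈ Z, before i j → α i ≠ α j := by
    intro i hi j hj h
    rcases h with h | h
    · exact (hsep i hi j hj h.1 h.2).ne
    · exact h.2.ne'
  have hl : ∀ i j, cross α β i j ∈ K ↔
      (crossX α β i j, α i * crossX α β i j + β i) ∈ K := fun i j => Iff.rfl
  have hr : ∀ i j, α i ≠ α j → (cross α β i j ∈ K ↔
      (crossX α β i j, α j * crossX α β i j + β j) ∈ K) := by
    intro i j h
    rw [cross_comm h, cross, crossX_comm]
  obtain ⟨C, hC, D, hD, hCR, hDR, hcard⟩ := exists_chain_antichain_s8 Z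
    (fun i j => before i j ∧ cross α β i j ∈ K) (by
      rintro i hi j hj k hk ⟨hij, hKij⟩ ⟨hjk, hKjk⟩
      have nij := hne i hi j hj hij
      have njk := hne j hj k hk hjk
      have hik : before i k := by
        simp only [hbefore] at hij hjk ⊢
        rcases hij with h | h <;> rcases hjk with h' | h'
        · exact absurd h'.1 h.2
        · exact Or.inl ⟨h.1, fun hh => h.2 (h'.1.2 hh)⟩
        · exact Or.inl ⟨h.1.2 h'.1, h'.2⟩
        · exact Or.inr ⟨h.1.trans h'.1, h'.2.trans h.2⟩
      refine ⟨hik, ?_⟩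
      have nik := hne i hi k hk hik
      have aij := (hl i j).1 hKij
      have bij := (hr i j nij).1 hKij
      have ajk := (hl j k).1 hKjk
      have bjk := (hr j k njk).1 hKjk
      have viaI : up i → crossX α β i j ≤ crossX α β i k → cross α β i k ∈ K := fun hu hx =>
        (hl i k).2 (hup i hi hu _ _ hx aij)
      have viaI' : ¬ up i → crossX α β i k ≤ crossX α β i j → cross α β i k ∈ K := fun hu hx =>
        (hl i k).2 (hdown i hi hu _ _ hx aij)
      have viaK : up k → crossX α β j k ≤ crossX α β i k → cross α β i k ∈ K := fun hu hx =>
        (hr i k nik).2 (hup k hk hu _ _ hx bjk)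
      have viaK' : ¬ up k → crossX α β i k ≤ crossX α β j k → cross α β i k ∈ K := fun hu hx =>
        (hr i k nik).2 (hdown k hk hu _ _ hx bjk)
      simp only [hbefore] at hij hjk
      rcases hij with h | h <;> rcases hjk with h' | h'
      · exact absurd h'.1 h.2
      · have nk : ¬ up k := fun hh => h.2 (h'.1.2 hh)
        rcases crossX_between (β := β) (hsep i hi k hk h.1 nk) h'.2 with hb | hb
        · exact viaK' nk (by rw [crossX_comm j k]; exact hb.1.trans hb.2)
        · exact viaI h.1 hb.2
      · have ui := h.1.2 h'.1
        rcases crossX_between (β := β) h.2 (hsep i hi k hk ui h'.2) with hb | hb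
        · exact viaI ui (by rw [crossX_comm i j]; exact hb.1.trans hb.2)
        · exact viaK' h'.2 hb.1
      · have hb := crossX_between (β := β) h'.2 h.2
        rw [crossX_comm k j, crossX_comm k i, crossX_comm j i] at hb
        by_cases hu : up i
        · have hk' : up k := h'.1.1 (h.1.1 hu)
          rcases hb with hb | hb
          · exact viaK hk' hb.1
          · exact viaI hu hb.1
        · have hk' : ¬ up k := fun hh => hu (h.1.2 (h'.1.2 hh))
          rcases hb with hb | hb
          · exact viaI' hu hb.2
          · exact viaK' hk' hb.2) (by
      rintro i hi ⟨h, -⟩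
      exact hne i hi i hi h rfl)
  refine ⟨C, hC, D, hD, ?_, ?_, hcard⟩
  · intro i hi j hj hij
    rcases hCR i hi j hj hij with h | h
    · exact h.2
    · rw [cross_comm (fun e => hij (hα (hC hi) (hC hj) e))]
      exact h.2
  · intro i hi j hj hij hK
    have hα' : α i ≠ α j := fun e => hij (hα (hD hi) (hD hj) e)
    have hK' := hK
    rw [cross_comm hα'] at hK'
    have h₁ := hDR i hi j hj
    have h₂ := hDR j hj i hi
    have : before i j ∨ before j i := by
      simp only [hbefore]
      rcases lt_or_gt_of_ne hα' with h | h <;> by_cases hu : up i <;> by_cases hu' : up j <;>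
        simp [hu, hu', h]
    rcases this with h | h
    · exact h₁ ⟨h, hK⟩
    · exact h₂ ⟨h, hK'⟩

lemma exists_halfplane_split (Z : Finset ι) (hα : Set.InjOn α Z) (p q w : ℝ) :
    ∃ C ⊆ Z, ∃ D ⊆ Z,
      (∀ i ∈ C, ∀ j ∈ C, i ≠ j → cross α β i j ∈ {z : ℝ × ℝ | p * z.1 + q * z.2 ≤ w}) ∧
      (∀ i ∈ D, ∀ j ∈ D, i ≠ j → cross α β i j ∈ {z : ℝ × ℝ | w ≤ p * z.1 + q * z.2}) ∧
      Z.card ≤ C.card * D.card := by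
  have main : ∀ p q w : ℝ, q ≤ 0 → ∃ C ⊆ Z, ∃ D ⊆ Z,
      (∀ i ∈ C, ∀ j ∈ C, i ≠ j → cross α β i j ∈ {z : ℝ × ℝ | w ≤ p * z.1 + q * z.2}) ∧
      (∀ i ∈ D, ∀ j ∈ D, i ≠ j → cross α β i j ∉ {z : ℝ × ℝ | w ≤ p * z.1 + q * z.2}) ∧
      Z.card ≤ C.card * D.card := by
    intro p q w hq
    refine exists_inside_outside Z hα _ (fun i => 0 ≤ p + q * α i) ?_ ?_ ?_
    · intro i _ hi x x' hx h
      simp only [Set.mem_ofPred_eq] at h ⊢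
      nlinarith [mul_le_mul_of_nonneg_left hx hi]
    · intro i _ hi x x' hx h
      simp only [Set.mem_ofPred_eq] at h ⊢
      nlinarith [mul_nonneg (sub_nonneg.2 hx) (le_of_lt (neg_pos.2 (not_le.1 hi)))]
    · intro i _ j _ hi hj
      by_contra! hc
      exact hj (by nlinarith)
  rcases le_total q 0 with hq | hq
  · obtain ⟨C, hC, D, hD, h₁, h₂, h⟩ := main p q w hq
    refine ⟨D, hD, C, hC, fun i hi j hj hij => ?_, h₁, by rwa [Nat.mul_comm]⟩
    have := h₂ i hi j hj hij
    simp only [Set.mem_ofPred_eq, not_le] at this ⊢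
    exact this.le
  · obtain ⟨C, hC, D, hD, h₁, h₂, h⟩ := main (-p) (-q) (-w) (by linarith)
    refine ⟨C, hC, D, hD, fun i hi j hj hij => ?_, fun i hi j hj hij => ?_, h⟩
    · have := h₁ i hi j hj hij
      simp only [Set.mem_ofPred_eq] at this ⊢
      linarith
    · have := h₂ i hi j hj hij
      simp only [Set.mem_ofPred_eq] at this ⊢
      linarith

/-- The cell below the apex `(s, h)` of a fan whose left and right rays have slopes `m`, `m'`. -/
def lowerCell (s h m m' : ℝ) : Set (ℝ × ℝ) :=
  {z | z.2 ≤ h + m * (z.1 - s) ∧ z.2 ≤ h + m' * (z.1 - s)}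

/-- The upper left cell of a fan with apex `(s, h)` and left ray of slope `m`. -/
def leftCell (s h m : ℝ) : Set (ℝ × ℝ) := {z | z.1 ≤ s ∧ h + m * (z.1 - s) ≤ z.2}

/-- The upper right cell of a fan with apex `(s, h)` and right ray of slope `m'`. -/
def rightCell (s h m' : ℝ) : Set (ℝ × ℝ) := {z | s ≤ z.1 ∧ h + m' * (z.1 - s) ≤ z.2}

lemma exists_fan_split (A : Finset ι) (hα : Set.InjOn α A) {s h m m' : ℝ} (hm : m' ≤ m) :
    ∃ Z₁ ⊆ A, ∃ Z₂ ⊆ A, ∃ Z₃ ⊆ A,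
      (∀ i ∈ Z₁, ∀ j ∈ Z₁, i ≠ j → cross α β i j ∈ lowerCell s h m m') ∧
      (∀ i ∈ Z₂, ∀ j ∈ Z₂, i ≠ j → cross α β i j ∈ leftCell s h m) ∧
      (∀ i ∈ Z₃, ∀ j ∈ Z₃, i ≠ j → cross α β i j ∈ rightCell s h m') ∧
      2 * A.card ≤ 3 * (Z₁.card * Z₂.card * Z₃.card) := by
  have hfin : ∀ Z ⊆ A, ∀ C ⊆ Z, ∀ D ⊆ Z, ∀ D₁ ⊆ D, ∀ D₂ ⊆ D, 2 * A.card ≤ 3 * Z.card →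
      Z.card ≤ C.card * D.card → D.card ≤ D₁.card * D₂.card →
      2 * A.card ≤ 3 * (C.card * D₁.card * D₂.card) := by
    intro Z _ C _ D _ D₁ _ D₂ _ h₁ h₂ h₃
    have := Nat.mul_le_mul_left C.card h₃
    rw [← mul_assoc] at this
    omega
  set E₁ := A.filter fun i => m' < α i ∧ α i < m with hE₁
  set E₂ := A.filter fun i => m < α i with hE₂
  set E₃ := A.filter fun i => α i < m' with hE₃
  have d₁₂ : Disjoint E₁ E₂ := Finset.disjoint_filter.2 fun i _ hi hi' => by linarith [hi.2]
  have d₁₂₃ : Disjoint (E₁ ∪ E₂) E₃ := by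
    rw [Finset.disjoint_union_left]
    exact ⟨Finset.disjoint_filter.2 fun i _ hi hi' => by linarith [hi.1],
      Finset.disjoint_filter.2 fun i _ hi hi' => by linarith⟩
  have hsum : E₁.card + E₂.card + E₃.card ≤ A.card := by
    rw [← Finset.card_union_of_disjoint d₁₂, ← Finset.card_union_of_disjoint d₁₂₃]
    exact Finset.card_le_card (Finset.union_subset (Finset.union_subset
      (Finset.filter_subset _ _) (Finset.filter_subset _ _)) (Finset.filter_subset _ _))
  have hrest : ∀ p : ι → Prop, 3 * (A.filter p).card ≤ A.card →
      2 * A.card ≤ 3 * (A.filter fun i => ¬ p i).card := by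
    intro p hp
    have := Finset.card_filter_add_card_filter_not (s := A) p
    omega
  have hcase : 3 * E₁.card ≤ A.card ∨ 3 * E₂.card ≤ A.card ∨ 3 * E₃.card ≤ A.card := by omega
  rcases hcase with hE | hE | hE
  · set Z := A.filter fun i => ¬ (m' < α i ∧ α i < m) with hZdef
    have hZ : 2 * A.card ≤ 3 * Z.card := by
      convert hrest (fun i => m' < α i ∧ α i < m) (by convert hE)
    have hZA : Z ⊆ A := Finset.filter_subset _ _
    have hmem : ∀ i ∈ Z, α i ≤ m' ∨ m ≤ α i := by
      intro i hi
      have := (Finset.mem_filter.1 hi).2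
      by_contra! hc
      exact this hc
    obtain ⟨C, hC, D, hD, hCK, hDK, hcard⟩ := exists_inside_outside (β := β) Z
      (hα.mono (by exact_mod_cast hZA)) (lowerCell s h m m') (fun i => α i ≤ m') (by
        rintro i hi hu x x' hx ⟨h₁, h₂⟩
        simp only at h₁ h₂
        constructor <;> simp only
        · nlinarith [mul_nonneg (sub_nonneg.2 hx) (sub_nonneg.2 (le_trans hu hm))]
        · nlinarith [mul_nonneg (sub_nonneg.2 hx) (sub_nonneg.2 hu)]) (by
        rintro i hi hu x x' hx ⟨h₁, h₂⟩
        have hu' := (hmem i hi).resolve_left hu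
        simp only at h₁ h₂
        constructor <;> simp only
        · nlinarith [mul_nonneg (sub_nonneg.2 hx) (sub_nonneg.2 hu')]
        · nlinarith [mul_nonneg (sub_nonneg.2 hx) (sub_nonneg.2 (le_trans hm hu'))]) (by
        intro i hi j hj hu hu'
        linarith [not_le.1 hu'])
    obtain ⟨D₁, hD₁, D₂, hD₂, h₁, h₂, hcard'⟩ := exists_halfplane_split (α := α) (β := β) D
      (hα.mono (by exact_mod_cast hD.trans hZA)) 1 0 s
    refine ⟨C, hC.trans hZA, D₁, hD₁.trans (hD.trans hZA), D₂, hD₂.trans (hD.trans hZA),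
      hCK, ?_, ?_, hfin Z hZA C hC D hD D₁ hD₁ D₂ hD₂ hZ hcard hcard'⟩
    · intro i hi j hj hij
      have h₃ := hDK i (hD₁ hi) j (hD₁ hj) hij
      have h₄ := h₁ i hi j hj hij
      generalize cross α β i j = z at *
      simp only [lowerCell, leftCell, Set.mem_ofPred_eq] at *
      refine ⟨by linarith, ?_⟩
      by_contra! hc
      exact h₃ ⟨hc.le, by nlinarith⟩
    · intro i hi j hj hij
      have h₃ := hDK i (hD₂ hi) j (hD₂ hj) hij
      have h₄ := h₂ i hi j hj hij
      generalize cross α β i j = z at *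
      simp only [lowerCell, rightCell, Set.mem_ofPred_eq] at *
      refine ⟨by linarith, ?_⟩
      by_contra! hc
      exact h₃ ⟨by nlinarith, hc.le⟩
  · have hZ := hrest (fun i => m < α i) hE
    set Z := A.filter fun i => ¬ (m < α i) with hZdef
    have hZA : Z ⊆ A := Finset.filter_subset _ _
    obtain ⟨C, hC, D, hD, hCK, hDK, hcard⟩ := exists_inside_outside (β := β) Z
      (hα.mono (by exact_mod_cast hZA)) (leftCell s h m) (fun _ => False)
      (fun _ _ h => h.elim) (by
        rintro i hi - x x' hx ⟨h₁, h₂⟩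
        have := not_lt.1 (Finset.mem_filter.1 hi).2
        simp only at h₁ h₂
        refine ⟨hx.trans h₁, ?_⟩
        simp only
        nlinarith [mul_nonneg (sub_nonneg.2 hx) (sub_nonneg.2 this)]) (fun _ _ _ _ h => h.elim)
    obtain ⟨D₁, hD₁, D₂, hD₂, h₁, h₂, hcard'⟩ := exists_halfplane_split (α := α) (β := β) D
      (hα.mono (by exact_mod_cast hD.trans hZA)) (-m') 1 (h - m' * s)
    refine ⟨D₁, hD₁.trans (hD.trans hZA), C, hC.trans hZA, D₂, hD₂.trans (hD.trans hZA),
      ?_, hCK, ?_, ?_⟩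
    · intro i hi j hj hij
      have h₃ := hDK i (hD₁ hi) j (hD₁ hj) hij
      have h₄ := h₁ i hi j hj hij
      generalize cross α β i j = z at *
      simp only [lowerCell, leftCell, Set.mem_ofPred_eq] at *
      refine ⟨?_, by linarith⟩
      by_contra! hc
      exact h₃ ⟨by by_contra! hs; nlinarith, hc.le⟩
    · intro i hi j hj hij
      have h₃ := hDK i (hD₂ hi) j (hD₂ hj) hij
      have h₄ := h₂ i hi j hj hij
      generalize cross α β i j = z at *
      simp only [leftCell, rightCell, Set.mem_ofPred_eq] at *
      refine ⟨?_, by linarith⟩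
      by_contra! hc
      exact h₃ ⟨hc.le, by nlinarith⟩
    · rw [Nat.mul_comm D₁.card]
      exact hfin Z hZA C hC D hD D₁ hD₁ D₂ hD₂ hZ hcard hcard'
  · have hZ := hrest (fun i => α i < m') hE
    set Z := A.filter fun i => ¬ (α i < m') with hZdef
    have hZA : Z ⊆ A := Finset.filter_subset _ _
    obtain ⟨C, hC, D, hD, hCK, hDK, hcard⟩ := exists_inside_outside (β := β) Z
      (hα.mono (by exact_mod_cast hZA)) (rightCell s h m') (fun _ => True) (by
        rintro i hi - x x' hx ⟨h₁, h₂⟩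
        have := not_lt.1 (Finset.mem_filter.1 hi).2
        simp only at h₁ h₂
        refine ⟨h₁.trans hx, ?_⟩
        simp only
        nlinarith [mul_nonneg (sub_nonneg.2 hx) (sub_nonneg.2 this)])
      (fun _ _ h => absurd trivial h) (fun _ _ _ _ _ h => absurd trivial h)
    obtain ⟨D₁, hD₁, D₂, hD₂, h₁, h₂, hcard'⟩ := exists_halfplane_split (α := α) (β := β) D
      (hα.mono (by exact_mod_cast hD.trans hZA)) (-m) 1 (h - m * s)
    refine ⟨D₁, hD₁.trans (hD.trans hZA), D₂, hD₂.trans (hD.trans hZA), C, hC.trans hZA,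
      ?_, ?_, hCK, ?_⟩
    · intro i hi j hj hij
      have h₃ := hDK i (hD₁ hi) j (hD₁ hj) hij
      have h₄ := h₁ i hi j hj hij
      generalize cross α β i j = z at *
      simp only [lowerCell, rightCell, Set.mem_ofPred_eq] at *
      refine ⟨by linarith, ?_⟩
      by_contra! hc
      exact h₃ ⟨by by_contra! hs; nlinarith, hc.le⟩
    · intro i hi j hj hij
      have h₃ := hDK i (hD₂ hi) j (hD₂ hj) hij
      have h₄ := h₂ i hi j hj hij
      generalize cross α β i j = z at *
      simp only [leftCell, rightCell, Set.mem_ofPred_eq] at *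
      refine ⟨?_, by linarith⟩
      by_contra! hc
      exact h₃ ⟨hc.le, by nlinarith⟩
    · rw [show D₁.card * D₂.card * C.card = C.card * D₁.card * D₂.card by ring]
      exact hfin Z hZA C hC D hD D₁ hD₁ D₂ hD₂ hZ hcard hcard'

end Combinatorics

section Sperner

/-- The parity cochain on edges of a three-labelled graph: `1` on edges labelled `{1, 2}`. -/
def edgeParity (x y : Fin 3) : ZMod 2 := if (x = 1 ∧ y = 2) ∨ (x = 2 ∧ y = 1) then 1 else 0

lemma edgeParity_triangle : ∀ x y z : Fin 3, ¬ (∀ l, l = x ∨ l = y ∨ l = z) →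
    edgeParity x y + edgeParity y z = edgeParity x z := by
  decide

/-- Sperner's lemma for a square grid with a three-labelling. -/
lemma exists_trichromatic_triangle (N : ℕ) (c : ℕ → ℕ → Fin 3)
    (hl : ∀ b ≤ N, c 0 b ≠ 1) (hr : ∀ b ≤ N, c N b ≠ 2)
    (hb : ∀ a ≤ N, c a 0 ≠ 0) (ht : ∀ a ≤ N, c a N = 0) :
    ∃ a < N, ∃ b < N, ∀ l, l = c a b ∨
      (l = c (a + 1) b ∨ l = c a (b + 1)) ∨ l = c (a + 1) (b + 1) := by
  by_contra! hno
  have htri₁ : ∀ a < N, ∀ b < N, edgeParity (c a b) (c (a + 1) b) +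
      edgeParity (c (a + 1) b) (c (a + 1) (b + 1)) =
      edgeParity (c a b) (c (a + 1) (b + 1)) := by
    intro a ha b hb'
    apply edgeParity_triangle
    intro h
    obtain ⟨l, h₁, ⟨h₂, h₃⟩, h₄⟩ := hno a ha b hb'
    rcases h l with h | h | h <;> contradiction
  have htri₂ : ∀ a < N, ∀ b < N, edgeParity (c a b) (c a (b + 1)) +
      edgeParity (c a (b + 1)) (c (a + 1) (b + 1)) =
      edgeParity (c a b) (c (a + 1) (b + 1)) := by
    intro a ha b hb'
    apply edgeParity_triangle
    intro h
    obtain ⟨l, h₁, ⟨h₂, h₃⟩, h₄⟩ := hno a ha b hb'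
    rcases h l with h | h | h <;> contradiction
  set S : ℕ → ZMod 2 := fun b => ∑ a ∈ Finset.range N, edgeParity (c a b) (c (a + 1) b) with hS
  have hstep : ∀ b < N, S (b + 1) = S b := by
    intro b hbN
    have h : ∀ n ≤ N, (∑ a ∈ Finset.range n, edgeParity (c a (b + 1)) (c (a + 1) (b + 1))) =
        (∑ a ∈ Finset.range n, edgeParity (c a b) (c (a + 1) b)) +
          edgeParity (c n b) (c n (b + 1)) - edgeParity (c 0 b) (c 0 (b + 1)) := by
      intro n
      induction n with
      | zero => intro _; simp
      | succ n ih =>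
        intro hn
        rw [Finset.sum_range_succ, Finset.sum_range_succ, ih (by omega)]
        linear_combination htri₂ n (by omega) b hbN - htri₁ n (by omega) b hbN
    have key₁ : ∀ x y : Fin 3, x ≠ 1 → y ≠ 1 → edgeParity x y = 0 := by decide
    have key₂ : ∀ x y : Fin 3, x ≠ 2 → y ≠ 2 → edgeParity x y = 0 := by decide
    have := h N le_rfl
    rw [key₂ _ _ (hr b hbN.le) (hr (b + 1) hbN), key₁ _ _ (hl b hbN.le) (hl (b + 1) hbN)] at this
    simpa using this
  have hall : ∀ b ≤ N, S b = S 0 := by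
    intro b
    induction b with
    | zero => simp
    | succ b ih => intro h; rw [hstep b (by omega), ih (by omega)]
  have htop : S N = 0 := by
    refine Finset.sum_eq_zero fun a ha => ?_
    have := Finset.mem_range.1 ha
    rw [ht a (by omega), ht (a + 1) (by omega)]
    decide
  have hbot : S 0 = 1 := by
    have key : ∀ x y z : Fin 3, x ≠ 0 → y ≠ 0 → z ≠ 0 →
      edgeParity x y + edgeParity y z = edgeParity x z := by decide
    have h : ∀ n ≤ N, ∑ a ∈ Finset.range n, edgeParity (c a 0) (c (a + 1) 0) =
        edgeParity (c 0 0) (c n 0) := by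
      intro n
      induction n with
      | zero =>
        intro _
        have : ∀ x : Fin 3, (0 : ZMod 2) = edgeParity x x := by decide
        simpa using this _
      | succ n ih =>
        intro hn
        rw [Finset.sum_range_succ, ih (by omega)]
        exact key _ _ _ (hb 0 (by omega)) (hb n (by omega)) (hb (n + 1) hn)
    have := h N le_rfl
    simp only [hS]
    rw [this]
    have key' : ∀ x y : Fin 3, x ≠ 0 → x ≠ 1 → y ≠ 0 → y ≠ 2 → edgeParity x y = 1 := by decide
    exact key' _ _ (hb 0 (by omega)) (hl 0 (by omega)) (hb N le_rfl) (hr 0 (by omega))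
  have := hall N le_rfl
  rw [htop, hbot] at this
  exact absurd this (by decide)

/-- A Knaster–Kuratowski–Mazurkiewicz lemma for closed covers of the unit square. -/
lemma kkm_unit_square (F : Fin 3 → Set (ℝ × ℝ)) (hF : ∀ l, IsClosed (F l))
    (hcov : ∀ x ∈ Set.Icc (0 : ℝ) 1, ∀ y ∈ Set.Icc (0 : ℝ) 1, ∃ l, (x, y) ∈ F l)
    (hl : ∀ y ∈ Set.Icc (0 : ℝ) 1, (0, y) ∉ F 1) (hr : ∀ y ∈ Set.Icc (0 : ℝ) 1, (1, y) ∉ F 2)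
    (hb : ∀ x ∈ Set.Icc (0 : ℝ) 1, (x, 0) ∉ F 0)
    (ht : ∀ x ∈ Set.Icc (0 : ℝ) 1, ∀ l, l ≠ 0 → (x, 1) ∉ F l) :
    ∃ p ∈ Set.Icc (0 : ℝ) 1 ×ˢ Set.Icc (0 : ℝ) 1, ∀ l, p ∈ F l := by
  have hmem : ∀ N a : ℕ, a ≤ N + 1 → (a / (N + 1 : ℝ)) ∈ Set.Icc (0 : ℝ) 1 := by
    intro N a ha
    have : (a : ℝ) ≤ N + 1 := by exact_mod_cast ha
    exact ⟨by positivity, (div_le_one (by positivity)).2 this⟩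
  have happrox : ∀ N : ℕ, ∃ p ∈ Set.Icc (0 : ℝ) 1 ×ˢ Set.Icc (0 : ℝ) 1,
      ∃ q : Fin 3 → ℝ × ℝ, ∀ l, q l ∈ F l ∧ dist (q l) p ≤ 1 / (N + 1 : ℝ) := by
    intro N
    have hex : ∀ a b : ℕ, ∃ l, a ≤ N + 1 → b ≤ N + 1 →
        ((a / (N + 1 : ℝ), b / (N + 1 : ℝ)) : ℝ × ℝ) ∈ F l := by
      intro a b
      by_cases h : a ≤ N + 1 ∧ b ≤ N + 1
      · obtain ⟨l, hl⟩ := hcov _ (hmem N a h.1) _ (hmem N b h.2)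
        exact ⟨l, fun _ _ => hl⟩
      · exact ⟨0, fun h₁ h₂ => absurd ⟨h₁, h₂⟩ h⟩
    choose c hc using hex
    have hN : (N + 1 : ℝ) ≠ 0 := by positivity
    obtain ⟨a, ha, b, hbN, htri⟩ := exists_trichromatic_triangle (N + 1) c
      (fun b hb' h => by
        have := hc 0 b (by omega) hb'
        rw [h] at this
        simp only [Nat.cast_zero, zero_div] at this
        exact hl _ (hmem N b hb') this)
      (fun b hb' h => by
        have := hc (N + 1) b le_rfl hb'
        rw [h] at this
        simp only [Nat.cast_add, Nat.cast_one, div_self hN] at this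
        exact hr _ (hmem N b hb') this)
      (fun a ha' h => by
        have := hc a 0 ha' (by omega)
        rw [h] at this
        simp only [Nat.cast_zero, zero_div] at this
        exact hb _ (hmem N a ha') this)
      (fun a ha' => by
        by_contra h
        have := hc a (N + 1) ha' le_rfl
        simp only [Nat.cast_add, Nat.cast_one, div_self hN] at this
        exact ht _ (hmem N a ha') _ h this)
    have hpos : (0 : ℝ) < 1 / (N + 1 : ℝ) := by positivity
    have hd : ∀ n : ℕ, dist (((n + 1 : ℕ) : ℝ) / (N + 1 : ℝ)) (n / (N + 1 : ℝ)) ≤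
        1 / (N + 1 : ℝ) := by
      intro n
      rw [Real.dist_eq, ← sub_div, Nat.cast_add, Nat.cast_one, add_sub_cancel_left,
        abs_of_pos hpos]
    refine ⟨((a / (N + 1 : ℝ), b / (N + 1 : ℝ)) : ℝ × ℝ),
      ⟨hmem N a ha.le, hmem N b hbN.le⟩, ?_⟩
    have : ∀ l, ∃ q, q ∈ F l ∧
        dist q ((a / (N + 1 : ℝ), b / (N + 1 : ℝ)) : ℝ × ℝ) ≤ 1 / (N + 1 : ℝ) := by
      intro l
      rcases htri l with h | (h | h) | h
      · exact ⟨_, h ▸ hc a b ha.le hbN.le, by rw [dist_self]; exact hpos.le⟩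
      · exact ⟨_, h ▸ hc (a + 1) b ha hbN.le, max_le (hd a) (by simp only [dist_self]; exact hpos.le)⟩
      · exact ⟨_, h ▸ hc a (b + 1) ha.le hbN, max_le (by simp only [dist_self]; exact hpos.le) (hd b)⟩
      · exact ⟨_, h ▸ hc (a + 1) (b + 1) ha hbN, max_le (hd a) (hd b)⟩
    choose q hq using this
    exact ⟨q, hq⟩
  choose p hp q hq using happrox
  obtain ⟨x, hx, φ, hφ, hlim⟩ := (isCompact_Icc.prod isCompact_Icc).tendsto_subseq hp
  refine ⟨x, hx, fun l => ?_⟩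
  have h₀ : Filter.Tendsto (fun n => 1 / ((φ n : ℝ) + 1)) Filter.atTop (nhds 0) :=
    tendsto_one_div_add_atTop_nhds_zero_nat.comp hφ.tendsto_atTop
  have h₁ : Filter.Tendsto (fun n => dist (q (φ n) l) (p (φ n))) Filter.atTop (nhds 0) :=
    squeeze_zero (fun _ => dist_nonneg) (fun n => (hq (φ n) l).2) h₀
  have h₂ : Filter.Tendsto (fun n => q (φ n) l) Filter.atTop (nhds x) :=
    (tendsto_iff_of_dist h₁).2 hlim
  exact (hF l).mem_of_tendsto h₂ (Filter.Eventually.of_forall fun n => (hq (φ n) l).1)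

/-- The covering lemma on a rectangle centred at the origin. -/
lemma kkm_rectangle {R H : ℝ} (hR : 0 < R) (hH : 0 < H) (F : Fin 3 → Set (ℝ × ℝ))
    (hF : ∀ l, IsClosed (F l))
    (hcov : ∀ x ∈ Set.Icc (-R) R, ∀ y ∈ Set.Icc (-H) H, ∃ l, (x, y) ∈ F l)
    (hl : ∀ y ∈ Set.Icc (-H) H, (-R, y) ∉ F 1) (hr : ∀ y ∈ Set.Icc (-H) H, (R, y) ∉ F 2)
    (hb : ∀ x ∈ Set.Icc (-R) R, (x, -H) ∉ F 0)
    (ht : ∀ x ∈ Set.Icc (-R) R, ∀ l, l ≠ 0 → (x, H) ∉ F l) :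
    ∃ p : ℝ × ℝ, p.1 ∈ Set.Icc (-R) R ∧ p.2 ∈ Set.Icc (-H) H ∧ ∀ l, p ∈ F l := by
  have hmem : ∀ {R : ℝ}, 0 < R → ∀ x ∈ Set.Icc (0 : ℝ) 1, 2 * R * x - R ∈ Set.Icc (-R) R := by
    intro R hR x hx
    constructor
    · nlinarith [hx.1]
    · nlinarith [hx.2]
  obtain ⟨p, hp, h⟩ := kkm_unit_square
    (fun l => (fun z : ℝ × ℝ => (2 * R * z.1 - R, 2 * H * z.2 - H)) ⁻¹' F l)
    (fun l => (hF l).preimage (by fun_prop))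
    (fun x hx y hy => hcov _ (hmem hR x hx) _ (hmem hH y hy))
    (fun y hy h => hl _ (hmem hH y hy) (by simpa using h))
    (fun y hy h => hr _ (hmem hH y hy) (by
      simp only [Set.mem_preimage] at h; convert h using 2; ring))
    (fun x hx h => hb _ (hmem hR x hx) (by simpa using h))
    (fun x hx l hl0 h => ht _ (hmem hR x hx) l hl0 (by
      simp only [Set.mem_preimage] at h; convert h using 2; ring))
  exact ⟨_, hmem hR _ hp.1, hmem hH _ hp.2, h⟩

end Sperner

section ContinuousRoots

variable {X : Type*} [TopologicalSpace X]

/-- Roots of a strictly monotone continuous family depend continuously on the parameter. -/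
lemma exists_continuous_root (G : X → ℝ → ℝ) (hG : Continuous fun z : X × ℝ => G z.1 z.2)
    (hmono : ∀ x, StrictMono (G x)) (hneg : ∀ x, ∃ y, G x y ≤ 0) (hpos : ∀ x, ∃ y, 0 ≤ G x y) :
    ∃ f : X → ℝ, Continuous f ∧ ∀ x, G x (f x) = 0 := by
  have hex : ∀ x, ∃ y, G x y = 0 := by
    intro x
    obtain ⟨a, ha⟩ := hneg x
    obtain ⟨b, hb⟩ := hpos x
    have hc : Continuous (G x) := hG.comp (by fun_prop : Continuous fun y : ℝ => (x, y))
    exact mem_range_of_exists_le_of_exists_ge hc ⟨a, ha⟩ ⟨b, hb⟩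
  choose f hf using hex
  refine ⟨f, continuous_iff_continuousAt.2 fun x => ?_, hf⟩
  have hsec : ∀ a, Continuous fun x => G x a := fun a =>
    hG.comp (by fun_prop : Continuous fun x : X => (x, a))
  refine tendsto_order.2 ⟨fun a ha => ?_, fun a ha => ?_⟩
  · have : G x a < 0 := by rw [← hf x]; exact hmono x ha
    filter_upwards [(hsec a).continuousAt.eventually_lt continuousAt_const this] with y hy
    rw [← hf y] at hy
    exact (hmono y).lt_iff_lt.1 hy
  · have : 0 < G x a := by rw [← hf x]; exact hmono x ha
    filter_upwards [continuousAt_const.eventually_lt (hsec a).continuousAt this] with y hy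
    rw [← hf y] at hy
    exact (hmono y).lt_iff_lt.1 hy

/-- Two bounded monotone families can be balanced by a common nonnegative excess `τ`, which
vanishes unless the two solutions cancel. -/
lemma exists_balanced_roots (F G : X → ℝ → ℝ) (hF : Continuous fun z : X × ℝ => F z.1 z.2)
    (hG : Continuous fun z : X × ℝ => G z.1 z.2) (hFm : ∀ x, Monotone (F x))
    (hGm : ∀ x, Monotone (G x)) {K ε : ℝ} (hε : 0 < ε) (hF0 : ∀ x y, 0 ≤ F x y)
    (hFK : ∀ x y, F x y ≤ K) (hG0 : ∀ x y, 0 ≤ G x y) (hGK : ∀ x y, G x y ≤ K) (c d : ℝ) :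
    ∃ u v τ : X → ℝ, Continuous u ∧ Continuous v ∧ ∀ x, 0 ≤ τ x ∧ 0 ≤ u x + v x ∧
      (τ x = 0 ∨ u x + v x = 0) ∧ F x (u x) + ε * u x = c + τ x ∧
      G x (v x) + ε * v x = d + τ x ∧ |u x| ≤ (|c| + |d| + K) / ε ∧
      |v x| ≤ (|c| + |d| + K) / ε := by
  have solve : ∀ F : X → ℝ → ℝ, Continuous (fun z : X × ℝ => F z.1 z.2) →
      (∀ x, Monotone (F x)) → (∀ x y, 0 ≤ F x y) → (∀ x y, F x y ≤ K) → ∀ c : ℝ,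
      ∃ u : X × ℝ → ℝ, Continuous u ∧ (∀ x τ, F x (u (x, τ)) + ε * u (x, τ) = c + τ) ∧
        (∀ x τ τ', τ < τ' → u (x, τ) < u (x, τ')) ∧
        ∀ x τ, u (x, τ) ≤ (c + τ) / ε ∧ (c + τ - K) / ε ≤ u (x, τ) := by
    intro F hF hFm hF0 hFK c
    have hsm : ∀ x, StrictMono fun y => F x y + ε * y := fun x y y' h =>
      add_lt_add_of_le_of_lt (hFm x h.le) (mul_lt_mul_of_pos_left h hε)
    obtain ⟨u, hu, hu'⟩ := exists_continuous_root
      (fun (z : X × ℝ) y => F z.1 y + ε * y - (c + z.2))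
      (by
        have : Continuous fun w : (X × ℝ) × ℝ => F w.1.1 w.2 :=
          hF.comp (by fun_prop : Continuous fun w : (X × ℝ) × ℝ => (w.1.1, w.2))
        fun_prop)
      (fun z y y' h => sub_lt_sub_right (hsm z.1 h) _)
      (fun z => ⟨(c + z.2 - K) / ε, by
        have := hFK z.1 ((c + z.2 - K) / ε)
        rw [mul_div_cancel₀ _ hε.ne']; linarith⟩)
      (fun z => ⟨(c + z.2) / ε, by
        have := hF0 z.1 ((c + z.2) / ε)
        rw [mul_div_cancel₀ _ hε.ne']; linarith⟩)
    have heq : ∀ x τ, F x (u (x, τ)) + ε * u (x, τ) = c + τ := fun x τ => by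
      have := hu' (x, τ)
      simp only at this
      linarith
    refine ⟨u, hu, heq, fun x τ τ' h => ?_, fun x τ => ⟨?_, ?_⟩⟩
    · refine (hsm x).lt_iff_lt.1 ?_
      simp only [heq]
      linarith
    · rw [le_div_iff₀ hε]
      have := heq x τ
      have := hF0 x (u (x, τ))
      linarith
    · rw [div_le_iff₀ hε]
      have := heq x τ
      have := hFK x (u (x, τ))
      linarith
  obtain ⟨u, hu, hueq, humono, hub⟩ := solve F hF hFm hF0 hFK c
  obtain ⟨v, hv, hveq, hvmono, hvb⟩ := solve G hG hGm hG0 hGK d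
  have hsum : ∀ x τ τ', τ < τ' → u (x, τ) + v (x, τ) < u (x, τ') + v (x, τ') := fun x τ τ' h =>
    add_lt_add (humono x τ τ' h) (hvmono x τ τ' h)
  obtain ⟨t, ht, ht'⟩ := exists_continuous_root (fun x τ => u (x, τ) + v (x, τ))
    (by fun_prop) (fun x τ τ' h => hsum x τ τ' h)
    (fun x => ⟨-(c + d) / 2, by
      have h₁ := (hub x (-(c + d) / 2)).1
      have h₂ := (hvb x (-(c + d) / 2)).1
      have : (c + -(c + d) / 2) / ε + (d + -(c + d) / 2) / ε = 0 := by
        field_simp; ring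
      linarith⟩)
    (fun x => ⟨K - (c + d) / 2, by
      have h₁ := (hub x (K - (c + d) / 2)).2
      have h₂ := (hvb x (K - (c + d) / 2)).2
      have : (c + (K - (c + d) / 2) - K) / ε + (d + (K - (c + d) / 2) - K) / ε = 0 := by
        field_simp; ring
      linarith⟩)
  refine ⟨fun x => u (x, max 0 (t x)), fun x => v (x, max 0 (t x)), fun x => max 0 (t x),
    by fun_prop, by fun_prop, fun x => ?_⟩
  have hnn : 0 ≤ u (x, max 0 (t x)) + v (x, max 0 (t x)) := by
    rcases (le_max_right 0 (t x)).eq_or_lt with h | h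
    · rw [← h, ht' x]
    · have := hsum x _ _ h
      rw [ht' x] at this
      exact this.le
  have hor : max 0 (t x) = 0 ∨ u (x, max 0 (t x)) + v (x, max 0 (t x)) = 0 := by
    rcases le_total (t x) 0 with h | h
    · exact Or.inl (max_eq_left h)
    · right
      rw [max_eq_right h, ht' x]
  have hτ : 0 ≤ max 0 (t x) := le_max_left _ _
  have hu₁ := hueq x (max 0 (t x))
  have hv₁ := hveq x (max 0 (t x))
  have hu₂ := hF0 x (u (x, max 0 (t x)))
  have hv₂ := hG0 x (v (x, max 0 (t x)))
  have hu₃ := hFK x (u (x, max 0 (t x)))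
  have hv₃ := hGK x (v (x, max 0 (t x)))
  refine ⟨hτ, hnn, hor, hu₁, hv₁, ?_, ?_⟩ <;> rw [abs_le, ← neg_div, le_div_iff₀ hε,
    div_le_iff₀ hε] <;> constructor <;>
    rcases hor with h | h <;>
    nlinarith [le_abs_self c, neg_abs_le c, le_abs_self d, neg_abs_le d]

end ContinuousRoots

section SoftCount

variable {ι : Type*} {α β : ι → ℝ} {A : Finset ι}

/-- The largest logarithmic size of a nonempty subfamily, penalised by the total `f`-weight of
its crossings. -/
noncomputable def softCount (α β : ι → ℝ) (A : Finset ι) (hA : A.Nonempty) (M : ℝ)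
    (f : ℝ × ℝ → ℝ) : ℝ :=
  (A.powerset.filter Finset.Nonempty).sup' ⟨A, by simpa using hA⟩ fun A' =>
    Real.log A'.card - M * ∑ e ∈ A'.offDiag, f (cross α β e.1 e.2)

lemma continuous_softCount {X : Type*} [TopologicalSpace X] (hA : A.Nonempty) (M : ℝ)
    (ρ : X → ℝ × ℝ → ℝ) (hρ : ∀ q, Continuous fun x => ρ x q) :
    Continuous fun x => softCount α β A hA M (ρ x) := by
  unfold softCount
  refine Continuous.finset_sup'_apply _ fun A' _ => ?_
  have := continuous_finsetSum A'.offDiag fun e _ => hρ (cross α β e.1 e.2)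
  fun_prop

lemma softCount_antitone (hA : A.Nonempty) {M : ℝ} (hM : 0 ≤ M) {f g : ℝ × ℝ → ℝ} (h : f ≤ g) :
    softCount α β A hA M g ≤ softCount α β A hA M f := by
  unfold softCount
  refine Finset.sup'_mono_fun fun A' _ => ?_
  have := Finset.sum_le_sum fun (e : ι × ι) (_ : e ∈ A'.offDiag) => h (cross α β e.1 e.2)
  have := mul_le_mul_of_nonneg_left this hM
  linarith

lemma log_card_le_softCount (hA : A.Nonempty) (M : ℝ) {f : ℝ × ℝ → ℝ} {Z : Finset ι}
    (hZ : Z ⊆ A) (hne : Z.Nonempty)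
    (hf : ∀ i ∈ Z, ∀ j ∈ Z, i ≠ j → f (cross α β i j) = 0) :
    Real.log Z.card ≤ softCount α β A hA M f := by
  have hs : ∑ e ∈ Z.offDiag, f (cross α β e.1 e.2) = 0 :=
    Finset.sum_eq_zero fun e he => by
      have := Finset.mem_offDiag.1 he
      exact hf _ this.1 _ this.2.1 this.2.2
  have := Finset.le_sup' (f := fun A' : Finset ι =>
    Real.log A'.card - M * ∑ e ∈ A'.offDiag, f (cross α β e.1 e.2))
    (show Z ∈ A.powerset.filter Finset.Nonempty by simp [hZ, hne])
  simp only [hs, mul_zero, sub_zero] at this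
  exact this

lemma softCount_nonneg (hA : A.Nonempty) (M : ℝ) (f : ℝ × ℝ → ℝ) :
    0 ≤ softCount α β A hA M f := by
  obtain ⟨i, hi⟩ := hA
  have := log_card_le_softCount (α := α) (β := β) (f := f) ⟨i, hi⟩ M (Finset.singleton_subset_iff.2 hi)
    (Finset.singleton_nonempty i) (by
      intro a ha b hb hab
      rw [Finset.mem_singleton] at ha hb
      exact absurd (ha.trans hb.symm) hab)
  simpa using this

lemma softCount_le (hA : A.Nonempty) {M : ℝ} (hM : 0 ≤ M) {f : ℝ × ℝ → ℝ} (hf : 0 ≤ f) :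
    softCount α β A hA M f ≤ Real.log A.card := by
  unfold softCount
  refine Finset.sup'_le _ _ fun A' hA' => ?_
  rw [Finset.mem_filter, Finset.mem_powerset] at hA'
  have h₁ : 0 ≤ M * ∑ e ∈ A'.offDiag, f (cross α β e.1 e.2) :=
    mul_nonneg hM (Finset.sum_nonneg fun e _ => hf _)
  have h₂ : Real.log A'.card ≤ Real.log A.card :=
    Real.log_le_log (by exact_mod_cast hA'.2.card_pos) (by exact_mod_cast Finset.card_le_card hA'.1)
  linarith

lemma hasCluster_of_le_softCount (hA : A.Nonempty) {M : ℝ} (hM : 0 ≤ M) {f : ℝ × ℝ → ℝ}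
    (hf : 0 ≤ f) {c : ℝ} (hc : c ≤ softCount α β A hA M f) :
    HasCluster α β A {q | M * f q ≤ Real.log A.card - c} (Real.exp c) := by
  unfold softCount at hc
  obtain ⟨A', hA', h⟩ := (Finset.le_sup'_iff _).1 hc
  rw [Finset.mem_filter, Finset.mem_powerset] at hA'
  have hpos : (0 : ℝ) < A'.card := by exact_mod_cast hA'.2.card_pos
  have hsum : 0 ≤ ∑ e ∈ A'.offDiag, f (cross α β e.1 e.2) :=
    Finset.sum_nonneg fun e _ => hf _
  have h₂ : Real.log A'.card ≤ Real.log A.card :=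
    Real.log_le_log hpos (by exact_mod_cast Finset.card_le_card hA'.1)
  refine ⟨A', hA'.1, ?_, fun i hi j hj hij => ?_⟩
  · rw [← Real.le_log_iff_exp_le hpos]
    have := mul_nonneg hM hsum
    linarith
  · have h₃ := Finset.single_le_sum (f := fun e : ι × ι => f (cross α β e.1 e.2))
      (fun e _ => hf _) (show (i, j) ∈ A'.offDiag from Finset.mem_offDiag.2 ⟨hi, hj, hij⟩)
    have := mul_le_mul_of_nonneg_left h₃ hM
    simp only [Set.mem_ofPred_eq] at this ⊢
    linarith

end SoftCount

section Clusters

variable {ι : Type*} {α β : ι → ℝ} {A B : Finset ι}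

lemma HasCluster.mono {K K' : Set (ℝ × ℝ)} {T T' : ℝ} (h : HasCluster α β A K T) (hK : K ⊆ K')
    (hT : T' ≤ T) : HasCluster α β A K' T' := by
  obtain ⟨A', hA', hc, hx⟩ := h
  exact ⟨A', hA', hT.trans hc, fun i hi j hj hij => hK (hx i hi j hj hij)⟩

lemma HasCluster.le_one {K : Set (ℝ × ℝ)} {T : ℝ} (h : HasCluster α β A K T)
    (hK : ∀ i ∈ A, ∀ j ∈ A, cross α β i j ∉ K) : T ≤ 1 := by
  obtain ⟨A', hA', hc, hx⟩ := h
  have : A'.card ≤ 1 := Finset.card_le_one.2 fun i hi j hj => by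
    by_contra hij
    exact hK i (hA' hi) j (hA' hj) (hx i hi j hj hij)
  have : (A'.card : ℝ) ≤ 1 := by exact_mod_cast this
  linarith

lemma isClosed_hasCluster {X : Type*} [TopologicalSpace X] (cell : X → Set (ℝ × ℝ)) (T : ℝ)
    (hcell : ∀ q, IsClosed {x | q ∈ cell x}) : IsClosed {x | HasCluster α β A (cell x) T} := by
  have : {x | HasCluster α β A (cell x) T} = ⋃ A' ∈ A.powerset, {x | T ≤ (A'.card : ℝ)} ∩
      ⋂ i ∈ A', ⋂ j ∈ A', ⋂ (_ : i ≠ j), {x | cross α β i j ∈ cell x} := by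
    ext x
    simp only [HasCluster, Set.mem_ofPred_eq, Set.mem_iUnion, Set.mem_inter_iff, Set.mem_iInter,
      Finset.mem_powerset, exists_prop]
  rw [this]
  refine A.powerset.finite_toSet.isClosed_biUnion fun A' _ => IsClosed.inter isClosed_const ?_
  exact isClosed_biInter fun i _ => isClosed_biInter fun j _ => isClosed_iInter fun _ => hcell _

lemma hasCluster_of_eventually {N : Type*} (𝒰 : Ultrafilter N) (cell : N → Set (ℝ × ℝ))
    (K : Set (ℝ × ℝ)) (T : N → ℝ) {t : ℝ} (hT : Filter.Tendsto T 𝒰 (nhds t))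
    (h : ∀ᶠ n in 𝒰, HasCluster α β A (cell n) (T n))
    (hK : ∀ q, (∀ᶠ n in 𝒰, q ∈ cell n) → q ∈ K) : HasCluster α β A K t := by
  have h' : ∀ᶠ n in 𝒰, ∃ A' ∈ (A.powerset : Set (Finset ι)), T n ≤ (A'.card : ℝ) ∧
      ∀ i ∈ A', ∀ j ∈ A', i ≠ j → cross α β i j ∈ cell n := by
    filter_upwards [h] with n hn
    obtain ⟨A', hA', hn'⟩ := hn
    exact ⟨A', by simpa using hA', hn'⟩
  obtain ⟨A', hA', h''⟩ := (Ultrafilter.eventually_exists_mem_iff A.powerset.finite_toSet).1 h'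
  refine ⟨A', by simpa using hA', le_of_tendsto hT (h''.mono fun n hn => hn.1),
    fun i hi j hj hij => hK _ (h''.mono fun n hn => hn.2 i hi j hj hij)⟩

lemma hasCluster_halfplane_or (hα : Set.InjOn α A) {T T' : ℝ}
    (hTT : T * T' ≤ A.card) (p q w : ℝ) :
    HasCluster α β A {z | p * z.1 + q * z.2 ≤ w} T ∨
      HasCluster α β A {z | w ≤ p * z.1 + q * z.2} T' := by
  obtain ⟨C, hC, D, hD, hCK, hDK, hcard⟩ := exists_halfplane_split (β := β) A hα p q w
  by_cases h : T ≤ C.card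
  · exact Or.inl ⟨C, hC, h, hCK⟩
  · refine Or.inr ⟨D, hD, ?_, hDK⟩
    push Not at h
    have hcard' : (A.card : ℝ) ≤ C.card * D.card := by exact_mod_cast hcard
    by_contra! hlt
    have hC0 : (0 : ℝ) ≤ C.card := by positivity
    have hD0 : (0 : ℝ) ≤ D.card := by positivity
    nlinarith

lemma exists_crossing_bound (A : Finset ι) : ∃ R : ℝ, 0 < R ∧ ∀ i ∈ A, ∀ j ∈ A,
    |(cross α β i j).1| < R ∧ |(cross α β i j).2| < R := by
  have h : ∀ f : ι × ι → ℝ, ∃ R : ℝ, 0 < R ∧ ∀ e ∈ A ×ˢ A, |f e| < R := by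
    intro f
    obtain ⟨R, hR⟩ := ((A ×ˢ A).image fun e => |f e|).bddAbove
    refine ⟨max R 0 + 1, by positivity, fun e he => ?_⟩
    have := hR (Finset.mem_coe.2 (Finset.mem_image_of_mem (fun e => |f e|) he))
    have := le_max_left R 0
    linarith
  obtain ⟨R₁, h₁, h₁'⟩ := h fun e => (cross α β e.1 e.2).1
  obtain ⟨R₂, h₂, h₂'⟩ := h fun e => (cross α β e.1 e.2).2
  refine ⟨max R₁ R₂, lt_max_of_lt_left h₁, fun i hi j hj => ⟨?_, ?_⟩⟩
  · exact lt_max_of_lt_left (h₁' (i, j) (Finset.mk_mem_product hi hj))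
  · exact lt_max_of_lt_right (h₂' (i, j) (Finset.mk_mem_product hi hj))

end Clusters

section Fan

/-- A measure of how far a point is from the left cell of a fan. -/
noncomputable def leftGap (s h m : ℝ) (q : ℝ × ℝ) : ℝ :=
  max 0 (q.1 - s) + max 0 (h + m * min 0 (q.1 - s) - q.2)

/-- A measure of how far a point is from the right cell of a fan. -/
noncomputable def rightGap (s h m' : ℝ) (q : ℝ × ℝ) : ℝ :=
  max 0 (s - q.1) + max 0 (h + m' * max 0 (q.1 - s) - q.2)

lemma leftGap_nonneg (s h m : ℝ) : 0 ≤ leftGap s h m := fun _ =>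
  add_nonneg (le_max_left _ _) (le_max_left _ _)

lemma rightGap_nonneg (s h m' : ℝ) : 0 ≤ rightGap s h m' := fun _ =>
  add_nonneg (le_max_left _ _) (le_max_left _ _)

lemma leftGap_eq_zero {s h m : ℝ} {q : ℝ × ℝ} (hq : q ∈ leftCell s h m) :
    leftGap s h m q = 0 := by
  obtain ⟨h₁, h₂⟩ := hq
  rw [leftGap, min_eq_right (by linarith), max_eq_left (by linarith), max_eq_left (by linarith),
    add_zero]

lemma rightGap_eq_zero {s h m' : ℝ} {q : ℝ × ℝ} (hq : q ∈ rightCell s h m') :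
    rightGap s h m' q = 0 := by
  obtain ⟨h₁, h₂⟩ := hq
  rw [rightGap, max_eq_right (a := 0) (b := q.1 - s) (by linarith), max_eq_left (by linarith),
    max_eq_left (by linarith), add_zero]

lemma leftGap_antitone (s h : ℝ) {m n : ℝ} (hmn : m ≤ n) : leftGap s h n ≤ leftGap s h m := by
  intro q
  unfold leftGap
  have := mul_le_mul_of_nonpos_right hmn (min_le_left 0 (q.1 - s))
  gcongr

lemma rightGap_monotone (s h : ℝ) {m n : ℝ} (hmn : m ≤ n) :
    rightGap s h m ≤ rightGap s h n := by
  intro q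
  unfold rightGap
  have := mul_le_mul_of_nonneg_right hmn (le_max_left 0 (q.1 - s))
  gcongr

variable {ι : Type*} {α β : ι → ℝ} {A B : Finset ι}

/-- A fan whose cells are exact for `B`; the lower cell is exact for `A`, while the other two
cells are approximate for `A`, with errors controlled by `M` and `ε`. -/
lemma exists_approximate_fan (hA : Set.InjOn α A) (hB : Set.InjOn α B) (hAne : A.Nonempty)
    {T₁ T₂ T₃ U₁ U₂ U₃ : ℝ} (hT₂ : 0 < T₂) (hT₃ : 0 < T₃)
    (hU₁ : 1 < U₁) (hU₂ : 1 < U₂) (hU₃ : 1 < U₃)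
    (hT : 3 * (T₁ * T₂ * T₃) ≤ 2 * A.card) (hU : 3 * (U₁ * U₂ * U₃) ≤ 2 * B.card)
    (hP : ∀ a b t : ℝ, (a, b) ≠ 0 →
      HasCluster α β B {z | a * z.1 + b * z.2 ≤ t} U₁ →
      HasCluster α β A {z | a * z.1 + b * z.2 ≤ t} T₁)
    {R : ℝ} (hR0 : 0 < R)
    (hR : ∀ i ∈ B, ∀ j ∈ B, |(cross α β i j).1| < R ∧ |(cross α β i j).2| < R)
    {M ε : ℝ} (hM : 0 ≤ M) (hε : 0 < ε) :
    ∃ s h m m' : ℝ, s ∈ Set.Icc (-R) R ∧ m' ≤ m ∧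
      HasCluster α β B (lowerCell s h m m') U₁ ∧ HasCluster α β B (leftCell s h m) U₂ ∧
      HasCluster α β B (rightCell s h m') U₃ ∧ HasCluster α β A (lowerCell s h m m') T₁ ∧
      HasCluster α β A {q | M * leftGap s h m q ≤ Real.log A.card - (Real.log T₂ - ε * m)}
        (Real.exp (Real.log T₂ - ε * m)) ∧
      HasCluster α β A {q | M * rightGap s h m' q ≤ Real.log A.card - (Real.log T₃ + ε * m')}
        (Real.exp (Real.log T₃ + ε * m')) := by
  obtain ⟨u, v, τ, hu, hv, huv⟩ := exists_balanced_roots (X := ℝ × ℝ)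
    (fun p m => softCount α β A hAne M (leftGap p.1 p.2 m))
    (fun p m => softCount α β A hAne M (rightGap p.1 p.2 (-m)))
    (continuous_softCount hAne M (fun (z : (ℝ × ℝ) × ℝ) => leftGap z.1.1 z.1.2 z.2)
      (fun q => by unfold leftGap; fun_prop))
    (continuous_softCount hAne M (fun (z : (ℝ × ℝ) × ℝ) => rightGap z.1.1 z.1.2 (-z.2))
      (fun q => by unfold rightGap; fun_prop))
    (fun p m n h => softCount_antitone hAne hM (leftGap_antitone _ _ h))
    (fun p m n h => softCount_antitone hAne hM (rightGap_monotone _ _ (neg_le_neg h)))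
    hε (fun _ _ => softCount_nonneg _ _ _)
    (fun _ _ => softCount_le hAne hM (leftGap_nonneg _ _ _))
    (fun _ _ => softCount_nonneg _ _ _)
    (fun _ _ => softCount_le hAne hM (rightGap_nonneg _ _ _)) (Real.log T₂) (Real.log T₃)
  set L := (|Real.log T₂| + |Real.log T₃| + Real.log A.card) / ε with hL
  have hL0 : 0 ≤ L := (abs_nonneg _).trans (huv (0, 0)).2.2.2.2.2.1
  set H := 2 * R * L + R with hH
  have hH0 : 0 < H := by positivity
  have hslope : ∀ m x s : ℝ, |m| ≤ L → |x| < R → s ∈ Set.Icc (-R) R →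
      |m * (x - s)| ≤ 2 * R * L := by
    intro m x s hm hx hs
    rw [abs_mul, mul_comm]
    have : |x - s| ≤ 2 * R := by
      rw [abs_lt] at hx
      rw [abs_le]
      constructor <;> linarith [hs.1, hs.2]
    gcongr
  have none : ∀ K U, 1 < U → HasCluster α β B K U →
      (∀ i ∈ B, ∀ j ∈ B, cross α β i j ∉ K) → False := fun K U hU hc h =>
    absurd (hc.le_one h) (not_le.2 hU)
  obtain ⟨p, hp₁, hp₂, hp⟩ := kkm_rectangle hR0 hH0
    ![{p | HasCluster α β B (lowerCell p.1 p.2 (u p) (-v p)) U₁},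
      {p | HasCluster α β B (leftCell p.1 p.2 (u p)) U₂},
      {p | HasCluster α β B (rightCell p.1 p.2 (-v p)) U₃}]
    (by
      intro l
      fin_cases l
      · refine isClosed_hasCluster (fun p : ℝ × ℝ => lowerCell p.1 p.2 (u p) (-v p)) _ fun q => ?_
        have h₁ : IsClosed {p : ℝ × ℝ | q.2 ≤ p.2 + u p * (q.1 - p.1)} := isClosed_le (by fun_prop) (by fun_prop)
        have h₂ : IsClosed {p : ℝ × ℝ | q.2 ≤ p.2 + -v p * (q.1 - p.1)} := isClosed_le (by fun_prop) (by fun_prop)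
        exact h₁.inter h₂
      · refine isClosed_hasCluster (fun p : ℝ × ℝ => leftCell p.1 p.2 (u p)) _ fun q => ?_
        have h₁ : IsClosed {p : ℝ × ℝ | q.1 ≤ p.1} := isClosed_le (by fun_prop) (by fun_prop)
        have h₂ : IsClosed {p : ℝ × ℝ | p.2 + u p * (q.1 - p.1) ≤ q.2} := isClosed_le (by fun_prop) (by fun_prop)
        exact h₁.inter h₂
      · refine isClosed_hasCluster (fun p : ℝ × ℝ => rightCell p.1 p.2 (-v p)) _ fun q => ?_
        have h₁ : IsClosed {p : ℝ × ℝ | p.1 ≤ q.1} := isClosed_le (by fun_prop) (by fun_prop)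
        have h₂ : IsClosed {p : ℝ × ℝ | p.2 + -v p * (q.1 - p.1) ≤ q.2} := isClosed_le (by fun_prop) (by fun_prop)
        exact h₁.inter h₂)
    (by
      intro x _ y _
      have hm : -v (x, y) ≤ u (x, y) := by linarith [(huv (x, y)).2.1]
      obtain ⟨Z₁, hZ₁, Z₂, hZ₂, Z₃, hZ₃, h₁, h₂, h₃, hc⟩ :=
        exists_fan_split (β := β) B hB (s := x) (h := y) hm
      by_contra! hno
      have n₁ : (Z₁.card : ℝ) < U₁ := by
        by_contra! h
        exact hno 0 ⟨Z₁, hZ₁, h, h₁⟩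
      have n₂ : (Z₂.card : ℝ) < U₂ := by
        by_contra! h
        exact hno 1 ⟨Z₂, hZ₂, h, h₂⟩
      have n₃ : (Z₃.card : ℝ) < U₃ := by
        by_contra! h
        exact hno 2 ⟨Z₃, hZ₃, h, h₃⟩
      have hc' : (2 * B.card : ℝ) ≤ 3 * (Z₁.card * Z₂.card * Z₃.card) := by exact_mod_cast hc
      have h₁₂ : (Z₁.card * Z₂.card : ℝ) < U₁ * U₂ :=
        mul_lt_mul'' n₁ n₂ (by positivity) (by positivity)
      have := mul_lt_mul'' h₁₂ n₃ (by positivity) (by positivity)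
      linarith)
    (by
      intro y _ h
      refine none _ _ hU₂ h fun i hi j hj hq => ?_
      have h₁ := hq.1
      have h₂ := abs_lt.1 (hR i hi j hj).1
      simp only at h₁
      linarith)
    (by
      intro y _ h
      refine none _ _ hU₃ h fun i hi j hj hq => ?_
      have h₁ := hq.1
      have h₂ := abs_lt.1 (hR i hi j hj).1
      simp only at h₁
      linarith)
    (by
      intro x hx h
      refine none _ _ hU₁ h fun i hi j hj hq => ?_
      have h₁ := hq.1
      have h₂ := abs_lt.1 (hR i hi j hj).2
      have h₃ := abs_le.1 (hslope (u (x, -H)) _ x (huv _).2.2.2.2.2.1 (hR i hi j hj).1 hx)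
      simp only at h₁
      linarith)
    (by
      intro x hx l hl h
      fin_cases l
      · exact hl rfl
      · refine none _ _ hU₂ h fun i hi j hj hq => ?_
        have h₁ := hq.2
        have h₂ := abs_lt.1 (hR i hi j hj).2
        have h₃ := abs_le.1 (hslope (u (x, H)) _ x (huv _).2.2.2.2.2.1 (hR i hi j hj).1 hx)
        simp only at h₁
        linarith
      · refine none _ _ hU₃ h fun i hi j hj hq => ?_
        have h₁ := hq.2
        have h₂ := abs_lt.1 (hR i hi j hj).2
        have h₃ := abs_le.1 (hslope (-v (x, H)) _ x
          (by rw [abs_neg]; exact (huv _).2.2.2.2.2.2) (hR i hi j hj).1 hx)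
        simp only at h₁
        linarith)
  have hlow : HasCluster α β B (lowerCell p.1 p.2 (u p) (-v p)) U₁ := hp 0
  obtain ⟨hτ, hsum, hor, hF, hG, -, -⟩ := huv p
  refine ⟨p.1, p.2, u p, -v p, hp₁, by linarith, hlow, hp 1, hp 2, ?_,
    hasCluster_of_le_softCount hAne hM (leftGap_nonneg _ _ _) (by linarith),
    hasCluster_of_le_softCount hAne hM (rightGap_nonneg _ _ _) (by linarith)⟩
  rcases hor with h0 | h0
  · obtain ⟨Z₁, hZ₁, Z₂, hZ₂, Z₃, hZ₃, h₁, h₂, h₃, hc⟩ :=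
      exists_fan_split (β := β) A hA (s := p.1) (h := p.2) (show -v p ≤ u p by linarith)
    refine ⟨Z₁, hZ₁, ?_, h₁⟩
    have hApos := hAne.card_pos
    have hne₂ : Z₂.Nonempty := by
      rw [Finset.nonempty_iff_ne_empty]
      rintro rfl
      simp at hc
      exact hAne.ne_empty hc
    have hne₃ : Z₃.Nonempty := by
      rw [Finset.nonempty_iff_ne_empty]
      rintro rfl
      simp at hc
      exact hAne.ne_empty hc
    have l₂ := log_card_le_softCount (α := α) (β := β) hAne M (f := leftGap p.1 p.2 (u p)) hZ₂ hne₂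
      fun i hi j hj hij => leftGap_eq_zero (h₂ i hi j hj hij)
    have l₃ := log_card_le_softCount (α := α) (β := β) hAne M (f := rightGap p.1 p.2 (-v p)) hZ₃
      hne₃ fun i hi j hj hij => rightGap_eq_zero (h₃ i hi j hj hij)
    have p₂ : (0 : ℝ) < Z₂.card := by exact_mod_cast hne₂.card_pos
    have p₃ : (0 : ℝ) < Z₃.card := by exact_mod_cast hne₃.card_pos
    have hlog : Real.log (Z₂.card * Z₃.card) ≤ Real.log (T₂ * T₃) := by
      rw [Real.log_mul p₂.ne' p₃.ne', Real.log_mul hT₂.ne' hT₃.ne']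
      have := mul_nonneg hε.le hsum
      linarith
    have hle := (Real.log_le_log_iff (by positivity) (by positivity)).1 hlog
    have hc' : (2 * A.card : ℝ) ≤ 3 * (Z₁.card * Z₂.card * Z₃.card) := by exact_mod_cast hc
    have hmul := mul_le_mul_of_nonneg_left hle (Nat.cast_nonneg (α := ℝ) Z₁.card)
    refine le_of_mul_le_mul_right ?_ (mul_pos hT₂ hT₃)
    linarith
  · have hv' : -v p = u p := by linarith
    rw [hv'] at hlow ⊢
    have hset : lowerCell p.1 p.2 (u p) (u p) =
        {z | -u p * z.1 + 1 * z.2 ≤ p.2 - u p * p.1} := by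
      ext z
      simp only [lowerCell, Set.mem_ofPred_eq, and_self]
      constructor <;> intro <;> linarith
    rw [hset] at hlow ⊢
    exact hP _ _ _ (by simp) hlow

end Fan

section Limits

open Filter Topology

lemma interior_line_eq_empty {a b t : ℝ} (h : (a, b, t) ≠ 0) :
    interior {z : ℝ × ℝ | a * z.1 + b * z.2 = t} = ∅ := by
  rw [Set.eq_empty_iff_forall_notMem]
  intro z hz
  obtain ⟨δ, hδ, hball⟩ := Metric.mem_nhds_iff.1 (mem_interior_iff_mem_nhds.1 hz)
  have h₀ := hball (Metric.mem_ball_self hδ)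
  have h₁ : (z.1 + δ / 2, z.2) ∈ Metric.ball z δ := by
    rw [Metric.mem_ball, Prod.dist_eq]
    simp only [dist_self, Real.dist_eq, add_sub_cancel_left]
    rw [abs_of_pos (by linarith)]
    exact max_lt (by linarith) hδ
  have h₂ : (z.1, z.2 + δ / 2) ∈ Metric.ball z δ := by
    rw [Metric.mem_ball, Prod.dist_eq]
    simp only [dist_self, Real.dist_eq, add_sub_cancel_left]
    rw [abs_of_pos (by linarith)]
    exact max_lt hδ (by linarith)
  have h₁ := hball h₁
  have h₂ := hball h₂
  simp only [Set.mem_ofPred_eq] at h₀ h₁ h₂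
  have ha : a * (δ / 2) = 0 := by linarith
  have hb : b * (δ / 2) = 0 := by linarith
  have ha' : a = 0 := (mul_eq_zero.1 ha).resolve_right (by linarith)
  have hb' : b = 0 := (mul_eq_zero.1 hb).resolve_right (by linarith)
  subst ha' hb'
  apply h
  have : t = 0 := by linarith
  rw [this]
  rfl

lemma convex_halfplane_le (a b t : ℝ) : Convex ℝ {z : ℝ × ℝ | a * z.1 + b * z.2 ≤ t} :=
  convex_halfSpace_le (f := fun z : ℝ × ℝ => a * z.1 + b * z.2)
    ⟨fun x y => by simp only [Prod.fst_add, Prod.snd_add]; ring,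
      fun c x => by simp only [Prod.smul_fst, Prod.smul_snd, smul_eq_mul]; ring⟩ t

lemma convex_halfplane_ge (a b t : ℝ) : Convex ℝ {z : ℝ × ℝ | t ≤ a * z.1 + b * z.2} :=
  convex_halfSpace_ge (f := fun z : ℝ × ℝ => a * z.1 + b * z.2)
    ⟨fun x y => by simp only [Prod.fst_add, Prod.snd_add]; ring,
      fun c x => by simp only [Prod.smul_fst, Prod.smul_snd, smul_eq_mul]; ring⟩ t

lemma isClosed_halfplane_le (a b t : ℝ) : IsClosed {z : ℝ × ℝ | a * z.1 + b * z.2 ≤ t} :=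
  isClosed_le (by fun_prop) (by fun_prop)

lemma isClosed_halfplane_ge (a b t : ℝ) : IsClosed {z : ℝ × ℝ | t ≤ a * z.1 + b * z.2} :=
  isClosed_le (by fun_prop) (by fun_prop)

lemma exists_normalized_limit {N : Type*} (𝒰 : Ultrafilter N) (v : N → ℝ × ℝ × ℝ)
    (hv : ∀ n, v n ≠ 0) :
    ∃ w, w ≠ 0 ∧ Tendsto (fun n => ‖v n‖⁻¹ • v n) 𝒰 (𝓝 w) := by
  have hmem : ∀ n, ‖v n‖⁻¹ • v n ∈ Metric.sphere (0 : ℝ × ℝ × ℝ) 1 := fun n => by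
    rw [mem_sphere_zero_iff_norm, norm_smul, norm_inv, norm_norm,
      inv_mul_cancel₀ (norm_ne_zero_iff.2 (hv n))]
  obtain ⟨w, hw, hlim⟩ := (isCompact_sphere (0 : ℝ × ℝ × ℝ) 1).ultrafilter_le_nhds'
    (𝒰.map fun n => ‖v n‖⁻¹ • v n) (Filter.mem_map.2 (Filter.univ_mem' hmem))
  refine ⟨w, ?_, hlim⟩
  rintro rfl
  simp at hw

variable {ι : Type*} {α β : ι → ℝ} {A B : Finset ι}

/-- The upper side cells (left for `σ = 1`, right for `σ = -1`) of approximate fans converge to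
cells which are exact for both families. -/
lemma hasCluster_side_limit (𝒰 : Ultrafilter ℕ) (h𝒰 : (𝒰 : Filter ℕ) ≤ atTop)
    {σ : ℝ} (hσ : σ ^ 2 = 1) {T U : ℝ} (hT : 0 < T) (hU : 1 < U)
    (hP : ∀ a b t : ℝ, (a, b) ≠ 0 →
      HasCluster α β B {z | a * z.1 + b * z.2 ≤ t} U →
      HasCluster α β A {z | a * z.1 + b * z.2 ≤ t} T)
    (s h p : ℕ → ℝ) {s₀ : ℝ} {w : ℝ × ℝ × ℝ} (hs : Tendsto s 𝒰 (𝓝 s₀))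
    (hlim : Tendsto (fun n => ‖(p n, (-1 : ℝ), p n * s n - h n)‖⁻¹ •
      (p n, (-1 : ℝ), p n * s n - h n)) 𝒰 (𝓝 w))
    (hBc : ∀ n, HasCluster α β B
      {q | σ * (q.1 - s n) ≤ 0 ∧ h n + p n * (q.1 - s n) ≤ q.2} U)
    (hAc : ∀ n : ℕ, HasCluster α β A {q | (n + 1 : ℝ) * (max 0 (σ * (q.1 - s n)) +
        max 0 (h n + σ * p n * min 0 (σ * (q.1 - s n)) - q.2)) ≤
          Real.log A.card - (Real.log T - σ * p n / (n + 1 : ℝ) ^ 2)}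
      (Real.exp (Real.log T - σ * p n / (n + 1 : ℝ) ^ 2))) :
    HasCluster α β A {z | σ * (z.1 - s₀) ≤ 0 ∧ w.1 * z.1 + w.2.1 * z.2 ≤ w.2.2} T ∧
    HasCluster α β B {z | σ * (z.1 - s₀) ≤ 0 ∧ w.1 * z.1 + w.2.1 * z.2 ≤ w.2.2} U := by
  have hσ1 : |σ| = 1 := by
    rw [← sq_abs] at hσ
    exact (pow_eq_one_iff_of_nonneg (abs_nonneg σ) two_ne_zero).1 hσ
  set N : ℕ → ℝ := fun n => ‖(p n, (-1 : ℝ), p n * s n - h n)‖ with hN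
  have hN1 : ∀ n, 1 ≤ N n := fun n => by
    have h₁ := norm_snd_le (p n, (-1 : ℝ), p n * s n - h n)
    have h₂ := norm_fst_le ((-1 : ℝ), p n * s n - h n)
    simp only [norm_neg, norm_one] at h₁ h₂
    exact h₂.trans h₁
  have hNp : ∀ n, |p n| ≤ N n := fun n => norm_fst_le (p n, (-1 : ℝ), p n * s n - h n)
  have hN0 : ∀ n, 0 < N n := fun n => by linarith [hN1 n]
  have hlim₁ : Tendsto (fun n => (N n)⁻¹ * p n) 𝒰 (𝓝 w.1) :=
    (continuous_fst.tendsto w).comp hlim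
  have hlim₂ : Tendsto (fun n => (N n)⁻¹ * (-1)) 𝒰 (𝓝 w.2.1) :=
    ((continuous_fst.comp continuous_snd).tendsto w).comp hlim
  have hlim₃ : Tendsto (fun n => (N n)⁻¹ * (p n * s n - h n)) 𝒰 (𝓝 w.2.2) :=
    ((continuous_snd.comp continuous_snd).tendsto w).comp hlim
  have hzero : Tendsto (fun n : ℕ => 1 / ((n : ℝ) + 1)) 𝒰 (𝓝 0) :=
    tendsto_one_div_add_atTop_nhds_zero_nat.mono_left h𝒰
  have hscale : ∀ n (q : ℝ × ℝ), (N n)⁻¹ * p n * q.1 + (N n)⁻¹ * (-1) * q.2 -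
      (N n)⁻¹ * (p n * s n - h n) = (N n)⁻¹ * (h n + p n * (q.1 - s n) - q.2) := by
    intro n q; ring
  have hlims : ∀ q : ℝ × ℝ, Tendsto (fun n => σ * (q.1 - s n)) 𝒰 (𝓝 (σ * (q.1 - s₀))) :=
    fun q => (tendsto_const_nhds.sub hs).const_mul σ
  have hlimw : ∀ q : ℝ × ℝ, Tendsto (fun n => (N n)⁻¹ * (h n + p n * (q.1 - s n) - q.2)) 𝒰
      (𝓝 (w.1 * q.1 + w.2.1 * q.2 - w.2.2)) := by
    intro q
    simp only [← hscale]
    exact ((hlim₁.mul_const _).add (hlim₂.mul_const _)).sub hlim₃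
  have hBlim : HasCluster α β B
      {z | σ * (z.1 - s₀) ≤ 0 ∧ w.1 * z.1 + w.2.1 * z.2 ≤ w.2.2} U := by
    refine hasCluster_of_eventually 𝒰 _ _ (fun _ => U) tendsto_const_nhds
      (Eventually.of_forall hBc) fun q hq => ⟨le_of_tendsto (hlims q) (hq.mono fun n hn => hn.1), ?_⟩
    refine sub_nonpos.1 (le_of_tendsto (hlimw q) (hq.mono fun n hn => ?_))
    exact mul_nonpos_of_nonneg_of_nonpos (inv_nonneg.2 (hN0 n).le) (by linarith [hn.2])
  refine ⟨?_, hBlim⟩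
  by_cases hcase : ∀ᶠ n in 𝒰, σ * p n < n + 1
  · set K := Real.log A.card - Real.log T + 1 with hK
    have hexp : Tendsto (fun n : ℕ => Real.exp (Real.log T - 1 / ((n : ℝ) + 1))) 𝒰 (𝓝 T) := by
      have := (Real.continuous_exp.tendsto _).comp (hzero.const_sub (Real.log T))
      rwa [sub_zero, Real.exp_log hT] at this
    have hKlim : Tendsto (fun n : ℕ => K * (1 / ((n : ℝ) + 1))) 𝒰 (𝓝 0) := by
      simpa using hzero.const_mul K
    have hKlim₂ : Tendsto (fun n : ℕ => 2 * (K * (1 / ((n : ℝ) + 1)))) 𝒰 (𝓝 0) := by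
      simpa using hKlim.const_mul 2
    refine hasCluster_of_eventually 𝒰
      (fun n => {q | max 0 (σ * (q.1 - s n)) +
        max 0 (h n + σ * p n * min 0 (σ * (q.1 - s n)) - q.2) ≤ K * (1 / ((n : ℝ) + 1))}) _ _ hexp
      ?_ fun q hq => ⟨?_, ?_⟩
    · filter_upwards [hcase] with n hn
      have hn0 : (0 : ℝ) < n + 1 := by positivity
      have hle : σ * p n / (n + 1 : ℝ) ^ 2 ≤ 1 / ((n : ℝ) + 1) := by
        rw [div_le_div_iff₀ (by positivity) hn0]
        nlinarith
      have hle1 : 1 / ((n : ℝ) + 1) ≤ 1 := by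
        rw [div_le_one hn0]
        have : (0 : ℝ) ≤ n := by positivity
        linarith
      refine (hAc n).mono (fun q hq => ?_) (Real.exp_le_exp.2 (by linarith))
      simp only [Set.mem_ofPred_eq] at hq ⊢
      rw [mul_one_div, le_div_iff₀ hn0]
      linarith
    · refine le_of_tendsto_of_tendsto (hlims q) hKlim (hq.mono fun n hn => ?_)
      simp only [Set.mem_ofPred_eq] at hn
      have h₁ := le_max_right 0 (σ * (q.1 - s n))
      have h₂ := le_max_left 0 (h n + σ * p n * min 0 (σ * (q.1 - s n)) - q.2)
      simp only at *
      linarith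
    · refine sub_nonpos.1 (le_of_tendsto_of_tendsto (hlimw q) hKlim₂ (hq.mono fun n hn => ?_))
      simp only [Set.mem_ofPred_eq] at hn ⊢
      have h₁ := le_max_left 0 (σ * (q.1 - s n))
      have h₂ := le_max_right 0 (h n + σ * p n * min 0 (σ * (q.1 - s n)) - q.2)
      have h₃ := le_max_left 0 (h n + σ * p n * min 0 (σ * (q.1 - s n)) - q.2)
      have hsplit : p n * (q.1 - s n) = σ * p n * min 0 (σ * (q.1 - s n)) +
          σ * p n * max 0 (σ * (q.1 - s n)) := by
        rw [← mul_add, min_add_max]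
        linear_combination (-(p n * (q.1 - s n))) * hσ
      have hσp : σ * p n ≤ N n := by
        refine (le_abs_self _).trans ?_
        rw [abs_mul, hσ1, one_mul]
        exact hNp n
      have h₄ := mul_le_mul_of_nonneg_right hσp h₁
      rw [inv_mul_le_iff₀ (hN0 n)]
      have h₅ := hN1 n
      nlinarith
  · rw [← Ultrafilter.eventually_not] at hcase
    have hge : ∀ᶠ n : ℕ in 𝒰, (n : ℝ) + 1 ≤ σ * p n := hcase.mono fun n hn => not_lt.1 hn
    have ha : 0 ≤ σ * w.1 := by
      refine ge_of_tendsto (hlim₁.const_mul σ) (hge.mono fun n hn => ?_)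
      have : 0 ≤ σ * p n := le_trans (by positivity) hn
      have := mul_nonneg (inv_nonneg.2 (hN0 n).le) this
      linarith
    have hb : w.2.1 = 0 := by
      refine tendsto_nhds_unique hlim₂ ?_
      refine squeeze_zero_norm' (hge.mono fun n hn => ?_) hzero
      have h₁ : (n : ℝ) + 1 ≤ N n := by
        refine hn.trans ((le_abs_self _).trans ?_)
        rw [abs_mul, hσ1, one_mul]
        exact hNp n
      rw [norm_mul, norm_neg, norm_one, mul_one, norm_inv, Real.norm_of_nonneg (hN0 n).le,
        ← one_div]
      exact one_div_le_one_div_of_le (by positivity) h₁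
    have hσ0 : σ ≠ 0 := by
      rintro rfl
      norm_num at hσ
    have hhalf : ∀ t, {z : ℝ × ℝ | σ * (z.1 - s₀) ≤ 0 ∧ w.1 * z.1 + w.2.1 * z.2 ≤ w.2.2} =
        {z | σ * z.1 + 0 * z.2 ≤ t} → HasCluster α β A
          {z | σ * (z.1 - s₀) ≤ 0 ∧ w.1 * z.1 + w.2.1 * z.2 ≤ w.2.2} T := by
      intro t ht
      rw [ht] at hBlim ⊢
      exact hP σ 0 t (by simpa using hσ0) hBlim
    rcases ha.eq_or_lt with ha0 | hapos
    · have hw1 : w.1 = 0 := (mul_eq_zero.1 ha0.symm).resolve_left hσ0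
      by_cases ht : 0 ≤ w.2.2
      · refine hhalf (σ * s₀) ?_
        ext z
        simp only [hb, hw1, Set.mem_ofPred_eq]
        constructor
        · rintro ⟨h₁, -⟩
          linarith
        · intro h₁
          exact ⟨by linarith, by linarith⟩
      · exfalso
        refine absurd (hBlim.le_one fun i _ j _ hq => ht ?_) (not_le.2 hU)
        have := hq.2
        rw [hb, hw1] at this
        linarith
    · refine hhalf (min (σ * s₀) (w.2.2 / (σ * w.1))) ?_
      ext z
      have hmul : σ * w.1 * (σ * z.1) = w.1 * z.1 := by linear_combination (w.1 * z.1) * hσ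
      simp only [hb, Set.mem_ofPred_eq, le_min_iff, le_div_iff₀ hapos]
      constructor
      · rintro ⟨h₁, h₂⟩
        exact ⟨by linarith, by linarith⟩
      · rintro ⟨h₁, h₂⟩
        exact ⟨by linarith, by linarith⟩

lemma rightGap_eq (s h m' : ℝ) (q : ℝ × ℝ) : rightGap s h m' q =
    max 0 (-1 * (q.1 - s)) + max 0 (h + -1 * m' * min 0 (-1 * (q.1 - s)) - q.2) := by
  have : min 0 (-1 * (q.1 - s)) = -max 0 (q.1 - s) := by
    rcases le_total (q.1 - s) 0 with h | h
    · rw [max_eq_left h, min_eq_left (by linarith), neg_zero]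
    · rw [max_eq_right h, min_eq_right (by linarith), neg_one_mul]
  rw [rightGap, this, neg_one_mul, neg_sub]
  ring_nf

/-- A balanced three-part convex partition of the plane. -/
lemma exists_three_cut (hA : Set.InjOn α A) (hB : Set.InjOn α B) (hAne : A.Nonempty)
    {T₁ T₂ T₃ U₁ U₂ U₃ : ℝ} (hT₂ : 0 < T₂) (hT₃ : 0 < T₃)
    (hU₁ : 1 < U₁) (hU₂ : 1 < U₂) (hU₃ : 1 < U₃)
    (hT : 3 * (T₁ * T₂ * T₃) ≤ 2 * A.card) (hU : 3 * (U₁ * U₂ * U₃) ≤ 2 * B.card)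
    (hP₁ : ∀ a b t : ℝ, (a, b) ≠ 0 → HasCluster α β B {z | a * z.1 + b * z.2 ≤ t} U₁ →
      HasCluster α β A {z | a * z.1 + b * z.2 ≤ t} T₁)
    (hP₂ : ∀ a b t : ℝ, (a, b) ≠ 0 → HasCluster α β B {z | a * z.1 + b * z.2 ≤ t} U₂ →
      HasCluster α β A {z | a * z.1 + b * z.2 ≤ t} T₂)
    (hP₃ : ∀ a b t : ℝ, (a, b) ≠ 0 → HasCluster α β B {z | a * z.1 + b * z.2 ≤ t} U₃ →
      HasCluster α β A {z | a * z.1 + b * z.2 ≤ t} T₃) :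
    ∃ C₁ C₂ C₃ : Set (ℝ × ℝ), ConvexPartition ![C₁, C₂, C₃] ∧
      HasCluster α β A C₁ T₁ ∧ HasCluster α β A C₂ T₂ ∧ HasCluster α β A C₃ T₃ ∧
      HasCluster α β B C₁ U₁ ∧ HasCluster α β B C₂ U₂ ∧ HasCluster α β B C₃ U₃ := by
  obtain ⟨R, hR0, hR⟩ := exists_crossing_bound (α := α) (β := β) B
  have hfan := fun n : ℕ => exists_approximate_fan hA hB hAne hT₂ hT₃ hU₁ hU₂ hU₃ hT hU hP₁ hR0 hR
    (M := n + 1) (ε := 1 / (n + 1 : ℝ) ^ 2) (by positivity) (by positivity)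
  choose s h m m' hs hm hB₁ hB₂ hB₃ hA₁ hA₂ hA₃ using hfan
  set 𝒰 : Ultrafilter ℕ := hyperfilter ℕ
  have h𝒰 : (𝒰 : Filter ℕ) ≤ atTop := Nat.hyperfilter_le_atTop
  have hv : ∀ (p s h : ℕ → ℝ) n, (p n, (-1 : ℝ), p n * s n - h n) ≠ 0 := by
    intro p s h n hn
    simp [Prod.ext_iff] at hn
  obtain ⟨w, hw, hlim⟩ := exists_normalized_limit 𝒰 _ (hv m s h)
  obtain ⟨w', hw', hlim'⟩ := exists_normalized_limit 𝒰 _ (hv m' s h)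
  obtain ⟨s₀, -, hs₀⟩ := isCompact_Icc.ultrafilter_le_nhds' (𝒰.map s)
    (Filter.mem_map.2 (Filter.univ_mem' hs))
  have hlims : Tendsto s 𝒰 (𝓝 s₀) := hs₀
  obtain ⟨hA₂', hB₂'⟩ := hasCluster_side_limit 𝒰 h𝒰 (σ := 1) (by norm_num) hT₂ hU₂ hP₂ s h m
    hlims hlim
    (fun n => (hB₂ n).mono (fun q hq => ⟨by linarith [hq.1], hq.2⟩) le_rfl)
    (fun n => by
      have := hA₂ n
      simp only [leftGap] at this
      simp only [one_mul]
      rwa [← one_div_mul_eq_div])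
  obtain ⟨hA₃', hB₃'⟩ := hasCluster_side_limit 𝒰 h𝒰 (σ := -1) (by norm_num) hT₃ hU₃ hP₃ s h m'
    hlims hlim'
    (fun n => (hB₃ n).mono (fun q hq => ⟨by linarith [hq.1], hq.2⟩) le_rfl)
    (fun n => by
      have := hA₃ n
      simp only [rightGap_eq] at this
      have e : Real.log T₃ - -1 * m' n / (n + 1 : ℝ) ^ 2 =
        Real.log T₃ + 1 / (n + 1 : ℝ) ^ 2 * m' n := by ring
      rwa [e])
  have hscale : ∀ (p : ℕ → ℝ) (w : ℝ × ℝ × ℝ), Tendsto (fun n =>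
      ‖(p n, (-1 : ℝ), p n * s n - h n)‖⁻¹ • (p n, (-1 : ℝ), p n * s n - h n)) 𝒰 (𝓝 w) →
      ∀ z : ℝ × ℝ, Tendsto (fun n => ‖(p n, (-1 : ℝ), p n * s n - h n)‖⁻¹ *
        (h n + p n * (z.1 - s n) - z.2)) 𝒰 (𝓝 (w.1 * z.1 + w.2.1 * z.2 - w.2.2)) := by
    intro p w hlim z
    have hlim₁ := (continuous_fst.tendsto w).comp hlim
    have hlim₂ := ((continuous_fst.comp continuous_snd).tendsto w).comp hlim
    have hlim₃ := ((continuous_snd.comp continuous_snd).tendsto w).comp hlim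
    refine (((hlim₁.mul_const z.1).add (hlim₂.mul_const z.2)).sub hlim₃).congr fun n => ?_
    simp only [Function.comp_apply, Prod.smul_fst, Prod.smul_snd, smul_eq_mul]
    ring
  have hup : ∀ (p : ℕ → ℝ) (w : ℝ × ℝ × ℝ), Tendsto (fun n =>
      ‖(p n, (-1 : ℝ), p n * s n - h n)‖⁻¹ • (p n, (-1 : ℝ), p n * s n - h n)) 𝒰 (𝓝 w) →
      ∀ z : ℝ × ℝ, (∀ᶠ n in 𝒰, h n + p n * (z.1 - s n) ≤ z.2) →
        w.1 * z.1 + w.2.1 * z.2 ≤ w.2.2 := fun p w hlim z hz =>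
    sub_nonpos.1 (le_of_tendsto (hscale p w hlim z) (hz.mono fun n hn =>
      mul_nonpos_of_nonneg_of_nonpos (inv_nonneg.2 (norm_nonneg _)) (by linarith)))
  have hdown : ∀ (p : ℕ → ℝ) (w : ℝ × ℝ × ℝ), Tendsto (fun n =>
      ‖(p n, (-1 : ℝ), p n * s n - h n)‖⁻¹ • (p n, (-1 : ℝ), p n * s n - h n)) 𝒰 (𝓝 w) →
      ∀ z : ℝ × ℝ, (∀ᶠ n in 𝒰, z.2 ≤ h n + p n * (z.1 - s n)) →
        w.2.2 ≤ w.1 * z.1 + w.2.1 * z.2 := fun p w hlim z hz =>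
    sub_nonneg.1 (ge_of_tendsto (hscale p w hlim z) (hz.mono fun n hn =>
      mul_nonneg (inv_nonneg.2 (norm_nonneg _)) (by linarith)))
  have hlow : ∀ q : ℝ × ℝ, (∀ᶠ n in 𝒰, q ∈ lowerCell (s n) (h n) (m n) (m' n)) →
      w.2.2 ≤ w.1 * q.1 + w.2.1 * q.2 ∧ w'.2.2 ≤ w'.1 * q.1 + w'.2.1 * q.2 := fun q hq =>
    ⟨hdown m w hlim q (hq.mono fun n hn => hn.1), hdown m' w' hlim' q (hq.mono fun n hn => hn.2)⟩
  refine ⟨{z | w.2.2 ≤ w.1 * z.1 + w.2.1 * z.2 ∧ w'.2.2 ≤ w'.1 * z.1 + w'.2.1 * z.2},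
    {z | 1 * (z.1 - s₀) ≤ 0 ∧ w.1 * z.1 + w.2.1 * z.2 ≤ w.2.2},
    {z | -1 * (z.1 - s₀) ≤ 0 ∧ w'.1 * z.1 + w'.2.1 * z.2 ≤ w'.2.2}, ⟨?_, ?_, ?_, ?_⟩,
    hasCluster_of_eventually 𝒰 _ _ _ tendsto_const_nhds (Eventually.of_forall hA₁) hlow,
    hA₂', hA₃',
    hasCluster_of_eventually 𝒰 _ _ _ tendsto_const_nhds (Eventually.of_forall hB₁) hlow,
    hB₂', hB₃'⟩
  · have hside : ∀ σ : ℝ, IsClosed {z : ℝ × ℝ | σ * (z.1 - s₀) ≤ 0} := fun σ =>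
      isClosed_le (by fun_prop) (by fun_prop)
    intro j
    fin_cases j
    · exact (isClosed_halfplane_ge _ _ _).inter (isClosed_halfplane_ge _ _ _)
    · exact (hside _).inter (isClosed_halfplane_le _ _ _)
    · exact (hside _).inter (isClosed_halfplane_le _ _ _)
  · have hside : ∀ σ : ℝ, Convex ℝ {z : ℝ × ℝ | σ * (z.1 - s₀) ≤ 0} := fun σ => by
      have : {z : ℝ × ℝ | σ * (z.1 - s₀) ≤ 0} = {z | σ * z.1 + 0 * z.2 ≤ σ * s₀} := by
        ext z
        simp only [Set.mem_ofPred_eq]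
        constructor <;> intro <;> linarith
      rw [this]
      exact convex_halfplane_le _ _ _
    intro j
    fin_cases j
    · exact (convex_halfplane_ge _ _ _).inter (convex_halfplane_ge _ _ _)
    · exact (hside _).inter (convex_halfplane_le _ _ _)
    · exact (hside _).inter (convex_halfplane_le _ _ _)
  · rw [Set.eq_univ_iff_forall]
    intro z
    rw [Set.mem_iUnion]
    have hcov : ∀ᶠ n in 𝒰, z ∈ lowerCell (s n) (h n) (m n) (m' n) ∨
        z ∈ leftCell (s n) (h n) (m n) ∨ z ∈ rightCell (s n) (h n) (m' n) := by
      refine Eventually.of_forall fun n => ?_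
      have hmn := hm n
      simp only [lowerCell, leftCell, rightCell, Set.mem_ofPred_eq]
      rcases le_total z.1 (s n) with h₁ | h₁
      · rcases le_total z.2 (h n + m n * (z.1 - s n)) with h₂ | h₂
        · exact Or.inl ⟨h₂, by nlinarith⟩
        · exact Or.inr (Or.inl ⟨h₁, h₂⟩)
      · rcases le_total z.2 (h n + m' n * (z.1 - s n)) with h₂ | h₂
        · exact Or.inl ⟨by nlinarith, h₂⟩
        · exact Or.inr (Or.inr ⟨h₁, h₂⟩)
    rw [Ultrafilter.eventually_or, Ultrafilter.eventually_or] at hcov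
    rcases hcov with hc | hc | hc
    · exact ⟨0, hlow z hc⟩
    · refine ⟨1, ?_, hup m w hlim z (hc.mono fun n hn => hn.2)⟩
      have := ge_of_tendsto hlims (hc.mono fun n hn => hn.1)
      linarith
    · refine ⟨2, ?_, hup m' w' hlim' z (hc.mono fun n hn => hn.2)⟩
      have := le_of_tendsto hlims (hc.mono fun n hn => hn.1)
      linarith
  · have hdisj : ∀ (K K' : Set (ℝ × ℝ)) (a b t : ℝ), (a, b, t) ≠ 0 →
        (∀ z ∈ K, z ∈ K' → a * z.1 + b * z.2 = t) → interior K ∩ interior K' = ∅ := by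
      intro K K' a b t hne hK
      rw [← interior_inter, ← Set.subset_empty_iff, ← interior_line_eq_empty hne]
      exact interior_mono fun z hz => hK z hz.1 hz.2
    have h01 := hdisj
      {z | w.2.2 ≤ w.1 * z.1 + w.2.1 * z.2 ∧ w'.2.2 ≤ w'.1 * z.1 + w'.2.1 * z.2}
      {z | 1 * (z.1 - s₀) ≤ 0 ∧ w.1 * z.1 + w.2.1 * z.2 ≤ w.2.2} _ _ _ hw
      fun z hz hz' => le_antisymm hz'.2 hz.1
    have h02 := hdisj
      {z | w.2.2 ≤ w.1 * z.1 + w.2.1 * z.2 ∧ w'.2.2 ≤ w'.1 * z.1 + w'.2.1 * z.2}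
      {z | -1 * (z.1 - s₀) ≤ 0 ∧ w'.1 * z.1 + w'.2.1 * z.2 ≤ w'.2.2} _ _ _ hw'
      fun z hz hz' => le_antisymm hz'.2 hz.2
    have h12 := hdisj {z | 1 * (z.1 - s₀) ≤ 0 ∧ w.1 * z.1 + w.2.1 * z.2 ≤ w.2.2}
      {z | -1 * (z.1 - s₀) ≤ 0 ∧ w'.1 * z.1 + w'.2.1 * z.2 ≤ w'.2.2} 1 0 s₀ (by simp)
      fun z hz hz' => by
        have h₁ := hz.1
        have h₂ := hz'.1
        linarith
    intro i j hij
    fin_cases i <;> fin_cases j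
    · exact absurd rfl hij
    · exact h01
    · exact h02
    · rw [Set.inter_comm]; exact h01
    · exact absurd rfl hij
    · exact h12
    · rw [Set.inter_comm]; exact h02
    · rw [Set.inter_comm]; exact h12
    · exact absurd rfl hij

end Limits

section HalfPlanes

variable {ι : Type*} {α β : ι → ℝ} {A B : Finset ι}

lemma exists_separator (S S' : Finset ℝ) (h : ∀ x ∈ S, ∀ y ∈ S', x ≤ y) :
    ∃ t, (∀ x ∈ S, x ≤ t) ∧ ∀ y ∈ S', t ≤ y := by
  rcases S.eq_empty_or_nonempty with rfl | hS
  · obtain ⟨t, ht⟩ := S'.bddBelow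
    exact ⟨t, by simp, fun y hy => ht hy⟩
  · exact ⟨S.max' hS, fun x hx => S.le_max' x hx, fun y hy => S.max'_le hS _ fun x hx => h x hx y hy⟩

/-- The values of a linear functional at the crossings of a family. -/
noncomputable def crossValues (α β : ι → ℝ) (A : Finset ι) (a b : ℝ) : Finset ℝ :=
  A.offDiag.image fun e => a * (cross α β e.1 e.2).1 + b * (cross α β e.1 e.2).2

lemma mem_crossValues {a b x : ℝ} : x ∈ crossValues α β A a b ↔
    ∃ i ∈ A, ∃ j ∈ A, i ≠ j ∧ a * (cross α β i j).1 + b * (cross α β i j).2 = x := by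
  simp only [crossValues, Finset.mem_image, Finset.mem_offDiag, Prod.exists]
  constructor
  · rintro ⟨i, j, ⟨hi, hj, hij⟩, h⟩
    exact ⟨i, hi, j, hj, hij, h⟩
  · rintro ⟨i, hi, j, hj, hij, h⟩
    exact ⟨i, j, ⟨hi, hj, hij⟩, h⟩

lemma isClosed_directions (T U : ℝ) : IsClosed {u : ℝ × ℝ | ∃ t,
    HasCluster α β A {z | t ≤ u.1 * z.1 + u.2 * z.2} T ∧
    HasCluster α β B {z | u.1 * z.1 + u.2 * z.2 ≤ t} U} := by
  have : {u : ℝ × ℝ | ∃ t, HasCluster α β A {z | t ≤ u.1 * z.1 + u.2 * z.2} T ∧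
      HasCluster α β B {z | u.1 * z.1 + u.2 * z.2 ≤ t} U} =
      ⋃ A' ∈ A.powerset, ⋃ B' ∈ B.powerset, {u | T ≤ (A'.card : ℝ) ∧ U ≤ (B'.card : ℝ)} ∩
        ⋂ e ∈ A'.offDiag, ⋂ f ∈ B'.offDiag,
          {u | u.1 * (cross α β f.1 f.2).1 + u.2 * (cross α β f.1 f.2).2 ≤
            u.1 * (cross α β e.1 e.2).1 + u.2 * (cross α β e.1 e.2).2} := by
    ext u
    simp only [Set.mem_ofPred_eq, Set.mem_iUnion, Set.mem_inter_iff, Set.mem_iInter,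
      Finset.mem_powerset, exists_prop]
    constructor
    · rintro ⟨t, ⟨A', hA', hT, hA⟩, ⟨B', hB', hU, hB⟩⟩
      refine ⟨A', hA', B', hB', ⟨hT, hU⟩, fun e he f hf => ?_⟩
      rw [Finset.mem_offDiag] at he hf
      exact (hB _ hf.1 _ hf.2.1 hf.2.2).trans (hA _ he.1 _ he.2.1 he.2.2)
    · rintro ⟨A', hA', B', hB', ⟨hT, hU⟩, h⟩
      obtain ⟨t, ht, ht'⟩ := exists_separator (crossValues α β B' u.1 u.2)
        (crossValues α β A' u.1 u.2) (by
          intro x hx y hy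
          obtain ⟨k, hk, l, hl, hkl, rfl⟩ := mem_crossValues.1 hx
          obtain ⟨i, hi, j, hj, hij, rfl⟩ := mem_crossValues.1 hy
          exact h (i, j) (Finset.mem_offDiag.2 ⟨hi, hj, hij⟩) (k, l)
            (Finset.mem_offDiag.2 ⟨hk, hl, hkl⟩))
      exact ⟨t, ⟨A', hA', hT, fun i hi j hj hij =>
          ht' _ (mem_crossValues.2 ⟨i, hi, j, hj, hij, rfl⟩)⟩,
        ⟨B', hB', hU, fun i hi j hj hij => ht _ (mem_crossValues.2 ⟨i, hi, j, hj, hij, rfl⟩)⟩⟩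
  rw [this]
  refine A.powerset.finite_toSet.isClosed_biUnion fun A' _ =>
    B.powerset.finite_toSet.isClosed_biUnion fun B' _ => IsClosed.inter isClosed_const ?_
  exact isClosed_biInter fun e _ => isClosed_biInter fun f _ =>
    isClosed_le (by fun_prop) (by fun_prop)

lemma exists_hasCluster_le {T : ℝ} (hT : T ≤ A.card) (a b : ℝ) :
    ∃ t, HasCluster α β A {z | a * z.1 + b * z.2 ≤ t} T := by
  obtain ⟨t, ht⟩ := (crossValues α β A a b).bddAbove
  exact ⟨t, A, subset_rfl, hT, fun i hi j hj hij =>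
    ht (Finset.mem_coe.2 (mem_crossValues.2 ⟨i, hi, j, hj, hij, rfl⟩))⟩

lemma exists_hasCluster_ge {T : ℝ} (hT : T ≤ A.card) (a b : ℝ) :
    ∃ t, HasCluster α β A {z | t ≤ a * z.1 + b * z.2} T := by
  obtain ⟨t, ht⟩ := (crossValues α β A a b).bddBelow
  exact ⟨t, A, subset_rfl, hT, fun i hi j hj hij =>
    ht (Finset.mem_coe.2 (mem_crossValues.2 ⟨i, hi, j, hj, hij, rfl⟩))⟩

/-- Between a level good above and a level good below, some level is good on both sides. -/
lemma exists_level_between (hα : Set.InjOn α A) {T T' : ℝ} (hTT : T * T' ≤ A.card) {a b t₁ t₂ : ℝ}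
    (h₁ : HasCluster α β A {z | t₁ ≤ a * z.1 + b * z.2} T')
    (h₂ : HasCluster α β A {z | a * z.1 + b * z.2 ≤ t₂} T) :
    ∃ t ∈ Set.uIcc t₁ t₂, HasCluster α β A {z | t ≤ a * z.1 + b * z.2} T' ∧
      HasCluster α β A {z | a * z.1 + b * z.2 ≤ t} T := by
  have := isPreconnected_closed_iff.1 (isPreconnected_uIcc (a := t₁) (b := t₂))
    {t | HasCluster α β A {z | t ≤ a * z.1 + b * z.2} T'}
    {t | HasCluster α β A {z | a * z.1 + b * z.2 ≤ t} T}
    (isClosed_hasCluster _ _ fun q => isClosed_Iic) (isClosed_hasCluster _ _ fun q => isClosed_Ici)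
    (fun t _ => (hasCluster_halfplane_or hα hTT a b t).symm)
    ⟨t₁, Set.left_mem_uIcc, h₁⟩ ⟨t₂, Set.right_mem_uIcc, h₂⟩
  obtain ⟨t, ht, ht'⟩ := this
  exact ⟨t, ht, ht'⟩

/-- In every direction, some line has one family rich above it and the other rich below it. -/
lemma exists_opposite_sides (hA : Set.InjOn α A) (hB : Set.InjOn α B) {T T' U U' : ℝ}
    (hT : T ≤ A.card) (hT' : T' ≤ A.card) (hTT : T * T' ≤ A.card) (hUU : U * U' ≤ B.card)
    (a b : ℝ) :
    (∃ t, HasCluster α β A {z | t ≤ a * z.1 + b * z.2} T' ∧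
      HasCluster α β B {z | a * z.1 + b * z.2 ≤ t} U) ∨
    ∃ t, HasCluster α β B {z | t ≤ a * z.1 + b * z.2} U' ∧
      HasCluster α β A {z | a * z.1 + b * z.2 ≤ t} T := by
  obtain ⟨t₁, h₁⟩ := exists_hasCluster_ge (α := α) (β := β) hT' a b
  obtain ⟨t₂, h₂⟩ := exists_hasCluster_le (α := α) (β := β) hT a b
  obtain ⟨t, -, h, h'⟩ := exists_level_between hA hTT h₁ h₂
  rcases hasCluster_halfplane_or (β := β) hB hUU a b t with hc | hc
  · exact Or.inl ⟨t, h, hc⟩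
  · exact Or.inr ⟨t, hc, h'⟩

/-- If no line is balanced, then one of the two families dominates the other throughout. -/
lemma dominates_or_dominates (hA : Set.InjOn α A) (hB : Set.InjOn α B) {T T' U U' : ℝ}
    (hT : T ≤ A.card) (hT' : T' ≤ A.card) (hTT : T * T' ≤ A.card) (hUU : U * U' ≤ B.card)
    (hno : ∀ a b t : ℝ, (a, b) ≠ 0 → ¬ (HasCluster α β A {z | a * z.1 + b * z.2 ≤ t} T ∧
      HasCluster α β A {z | t ≤ a * z.1 + b * z.2} T' ∧
      HasCluster α β B {z | a * z.1 + b * z.2 ≤ t} U ∧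
      HasCluster α β B {z | t ≤ a * z.1 + b * z.2} U')) :
    (∀ a b t : ℝ, (a, b) ≠ 0 → ¬ (HasCluster α β A {z | t ≤ a * z.1 + b * z.2} T' ∧
      HasCluster α β B {z | a * z.1 + b * z.2 ≤ t} U)) ∨
    ∀ a b t : ℝ, (a, b) ≠ 0 → ¬ (HasCluster α β B {z | t ≤ a * z.1 + b * z.2} U' ∧
      HasCluster α β A {z | a * z.1 + b * z.2 ≤ t} T) := by
  by_contra! hcon
  obtain ⟨⟨a, b, t, hab, hN⟩, ⟨a', b', t', hab', hN'⟩⟩ := hcon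
  have hconn : IsPreconnected ({0}ᶜ : Set (ℝ × ℝ)) :=
    (isConnected_compl_singleton_of_one_lt_rank (by
      refine Module.lt_rank_of_lt_finrank ?_
      simp) 0).isPreconnected
  obtain ⟨u, hu, ⟨t₁, h₁, k₁⟩, ⟨t₂, h₂, k₂⟩⟩ := isPreconnected_closed_iff.1 hconn _ _
    (isClosed_directions (α := α) (β := β) (A := A) (B := B) T' U)
    (isClosed_directions (α := α) (β := β) (A := B) (B := A) U' T)
    (fun u _ => exists_opposite_sides hA hB hT hT' hTT hUU u.1 u.2)
    ⟨(a, b), hab, t, hN⟩ ⟨(a', b'), hab', t', hN'⟩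
  rcases le_total t₁ t₂ with h | h
  · obtain ⟨s, hs, e₁, e₂⟩ := exists_level_between hA hTT h₁ k₂
    rw [Set.uIcc_of_le h] at hs
    exact hno u.1 u.2 s hu ⟨e₂, e₁, k₁.mono (fun z hz => le_trans hz hs.1) le_rfl,
      h₂.mono (fun z hz => le_trans hs.2 hz) le_rfl⟩
  · obtain ⟨s, hs, e₁, e₂⟩ := exists_level_between hB hUU h₂ k₁
    rw [Set.uIcc_of_le h] at hs
    exact hno u.1 u.2 s hu ⟨k₂.mono (fun z hz => le_trans hz hs.1) le_rfl,
      h₁.mono (fun z hz => le_trans hs.2 hz) le_rfl, e₂, e₁⟩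

lemma convexPartition_halfplanes {a b t : ℝ} (hab : (a, b) ≠ 0) :
    ConvexPartition ![{z : ℝ × ℝ | a * z.1 + b * z.2 ≤ t}, {z | t ≤ a * z.1 + b * z.2}] := by
  have hdisj : interior {z : ℝ × ℝ | a * z.1 + b * z.2 ≤ t} ∩
      interior {z : ℝ × ℝ | t ≤ a * z.1 + b * z.2} = ∅ := by
    have hne : (a, b, t) ≠ 0 := by
      intro h
      exact hab (Prod.mk_eq_zero.2 ⟨congrArg Prod.fst h, congrArg (fun z => z.2.1) h⟩)
    rw [← interior_inter, ← Set.subset_empty_iff, ← interior_line_eq_empty hne]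
    exact interior_mono fun z hz => le_antisymm hz.1 hz.2
  refine ⟨fun j => ?_, fun j => ?_, ?_, fun i j hij => ?_⟩
  · fin_cases j
    · exact isClosed_halfplane_le _ _ _
    · exact isClosed_halfplane_ge _ _ _
  · fin_cases j
    · exact convex_halfplane_le _ _ _
    · exact convex_halfplane_ge _ _ _
  · rw [Set.eq_univ_iff_forall]
    intro z
    rw [Set.mem_iUnion]
    rcases le_total (a * z.1 + b * z.2) t with h | h
    · exact ⟨0, h⟩
    · exact ⟨1, h⟩
  · fin_cases i <;> fin_cases j
    · exact absurd rfl hij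
    · exact hdisj
    · rw [Set.inter_comm]; exact hdisj
    · exact absurd rfl hij

/-- If `S` is antisymmetric under `i ↦ r - i`, then `r` splits into three positive parts on which
`S` has constant truth value. -/
lemma exists_monochromatic_triple {r : ℕ} (hr : 2 ≤ r) (S : ℕ → Prop)
    (hS : ∀ i, 0 < i → i < r → (S (r - i) ↔ ¬ S i)) :
    ∃ i j k, 0 < i ∧ 0 < j ∧ 0 < k ∧ i + j + k = r ∧
      ((S i ∧ S j ∧ S k) ∨ (¬ S i ∧ ¬ S j ∧ ¬ S k)) := by
  by_contra! hno
  have h : ∀ m, m + 1 < r → (S (m + 1) ↔ S 1) := by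
    intro m
    induction m with
    | zero => simp
    | succ m ih =>
      intro hm
      have ih := ih (by omega)
      have h₁ := hno 1 (m + 1) (r - (m + 1 + 1)) one_pos (by omega) (by omega) (by omega)
      have h₂ := hS (m + 1 + 1) (by omega) hm
      tauto
  have h₁ := h (r - 2) (by omega)
  have h₂ := hS 1 one_pos (by omega)
  rw [show r - 2 + 1 = r - 1 by omega] at h₁
  tauto

/-- The cut theorem when `A` dominates `B` for all three parts. -/
lemma exists_three_cut_of_dominates (hA : Set.InjOn α A) (hB : Set.InjOn α B) {r : ℕ}
    {T U : ℕ → ℝ} (hT : ∀ i, 0 < i → i < r → T i ≤ A.card)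
    (hU : ∀ i, 0 < i → i < r → U i ≤ B.card)
    (hTT : ∀ i, 0 < i → i < r → T i * T (r - i) ≤ A.card)
    (hTpos : ∀ i, A.Nonempty → 0 < T i) {i j k : ℕ} (hi : 0 < i) (hj : 0 < j) (hk : 0 < k)
    (hijk : i + j + k = r)
    (hTTT : 3 * (T i * T j * T k) ≤ 2 * A.card) (hUUU : 3 * (U i * U j * U k) ≤ 2 * B.card)
    (hS : ∀ l, l = i ∨ l = j ∨ l = k → ∀ a b t : ℝ, (a, b) ≠ 0 →
      ¬ (HasCluster α β A {z | t ≤ a * z.1 + b * z.2} (T (r - l)) ∧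
        HasCluster α β B {z | a * z.1 + b * z.2 ≤ t} (U l))) :
    ∃ C₁ C₂ C₃ : Set (ℝ × ℝ), ConvexPartition ![C₁, C₂, C₃] ∧
      HasCluster α β A C₁ (T i) ∧ HasCluster α β A C₂ (T j) ∧ HasCluster α β A C₃ (T k) ∧
      HasCluster α β B C₁ (U i) ∧ HasCluster α β B C₂ (U j) ∧ HasCluster α β B C₃ (U k) := by
  have hlr : ∀ l, l = i ∨ l = j ∨ l = k → 0 < l ∧ l < r ∧ 0 < r - l ∧ r - l < r := by
    rintro l (rfl | rfl | rfl) <;> omega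
  have hP : ∀ l, l = i ∨ l = j ∨ l = k → ∀ a b t : ℝ, (a, b) ≠ 0 →
      HasCluster α β B {z | a * z.1 + b * z.2 ≤ t} (U l) →
      HasCluster α β A {z | a * z.1 + b * z.2 ≤ t} (T l) := by
    intro l hl a b t hab hBl
    obtain ⟨h₁, h₂, h₃, h₄⟩ := hlr l hl
    rcases hasCluster_halfplane_or (β := β) hA (hTT l h₁ h₂) a b t with h | h
    · exact h
    · exact absurd ⟨h, hBl⟩ (hS l hl a b t hab)
  have hempty : ∀ (D : Finset ι) (K : Set (ℝ × ℝ)) (V : ℝ), V ≤ D.card → V ≤ 1 →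
      HasCluster α β D K V := by
    intro D K V hV hV1
    rcases D.eq_empty_or_nonempty with rfl | ⟨d, hd⟩
    · exact ⟨∅, subset_rfl, hV, by simp⟩
    · refine ⟨{d}, by simpa using hd, by simpa using hV1, fun i hi j hj hij => ?_⟩
      rw [Finset.mem_singleton] at hi hj
      exact absurd (hi.trans hj.symm) hij
  have hU1 : ∀ l, l = i ∨ l = j ∨ l = k → 1 < U l := by
    intro l hl
    obtain ⟨h₁, h₂, h₃, h₄⟩ := hlr l hl
    by_contra! hle
    obtain ⟨t, ht⟩ := exists_hasCluster_ge (α := α) (β := β) (hT _ h₃ h₄) 1 0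
    exact hS l hl 1 0 t (by simp) ⟨ht, hempty B _ _ (hU l h₁ h₂) hle⟩
  have hAne : A.Nonempty := by
    rw [Finset.nonempty_iff_ne_empty]
    rintro rfl
    obtain ⟨h₁, h₂, h₃, h₄⟩ := hlr i (Or.inl rfl)
    obtain ⟨t, ht⟩ := exists_hasCluster_le (α := α) (β := β) (hU _ h₁ h₂) 1 0
    have := hT _ h₃ h₄
    exact hS i (Or.inl rfl) 1 0 t (by simp) ⟨hempty ∅ _ _ this (this.trans (by simp)), ht⟩
  exact exists_three_cut hA hB hAne (hTpos j hAne) (hTpos k hAne) (hU1 i (by simp))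
    (hU1 j (by simp)) (hU1 k (by simp)) hTTT hUUU (hP i (by simp)) (hP j (by simp))
    (hP k (by simp))

/-- The equitable cut theorem for lines given by slopes and intercepts. -/
lemma exists_two_cut_or_three_cut (hA : Set.InjOn α A) (hB : Set.InjOn α B) {r : ℕ} (hr : 2 ≤ r)
    {T U : ℕ → ℝ} (hT : ∀ i, 0 < i → i < r → T i ≤ A.card)
    (hU : ∀ i, 0 < i → i < r → U i ≤ B.card)
    (hTT : ∀ i, 0 < i → i < r → T i * T (r - i) ≤ A.card)
    (hUU : ∀ i, 0 < i → i < r → U i * U (r - i) ≤ B.card)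
    (hTpos : ∀ i, A.Nonempty → 0 < T i) (hUpos : ∀ i, B.Nonempty → 0 < U i)
    (hTTT : ∀ i j k, 0 < i → 0 < j → 0 < k → i + j + k = r → 3 * (T i * T j * T k) ≤ 2 * A.card)
    (hUUU : ∀ i j k, 0 < i → 0 < j → 0 < k → i + j + k = r → 3 * (U i * U j * U k) ≤ 2 * B.card) :
    (∃ i j, 0 < i ∧ 0 < j ∧ i + j = r ∧ ∃ C₁ C₂ : Set (ℝ × ℝ), ConvexPartition ![C₁, C₂] ∧
      HasCluster α β A C₁ (T i) ∧ HasCluster α β A C₂ (T j) ∧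
      HasCluster α β B C₁ (U i) ∧ HasCluster α β B C₂ (U j)) ∨
    (∃ i j k, 0 < i ∧ 0 < j ∧ 0 < k ∧ i + j + k = r ∧
      ∃ C₁ C₂ C₃ : Set (ℝ × ℝ), ConvexPartition ![C₁, C₂, C₃] ∧
        HasCluster α β A C₁ (T i) ∧ HasCluster α β A C₂ (T j) ∧ HasCluster α β A C₃ (T k) ∧
        HasCluster α β B C₁ (U i) ∧ HasCluster α β B C₂ (U j) ∧ HasCluster α β B C₃ (U k)) := by
  by_cases hcut : ∃ i, 0 < i ∧ i < r ∧ ∃ a b t : ℝ, (a, b) ≠ 0 ∧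
      HasCluster α β A {z | a * z.1 + b * z.2 ≤ t} (T i) ∧
      HasCluster α β A {z | t ≤ a * z.1 + b * z.2} (T (r - i)) ∧
      HasCluster α β B {z | a * z.1 + b * z.2 ≤ t} (U i) ∧
      HasCluster α β B {z | t ≤ a * z.1 + b * z.2} (U (r - i))
  · obtain ⟨i, hi, hir, a, b, t, hab, h⟩ := hcut
    exact Or.inl ⟨i, r - i, hi, by omega, by omega, _, _, convexPartition_halfplanes hab, h⟩
  right
  push Not at hcut
  set S : ℕ → Prop := fun i => ∀ a b t : ℝ, (a, b) ≠ 0 →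
    ¬ (HasCluster α β A {z | t ≤ a * z.1 + b * z.2} (T (r - i)) ∧
      HasCluster α β B {z | a * z.1 + b * z.2 ≤ t} (U i)) with hS
  set S' : ℕ → Prop := fun i => ∀ a b t : ℝ, (a, b) ≠ 0 →
    ¬ (HasCluster α β B {z | t ≤ a * z.1 + b * z.2} (U (r - i)) ∧
      HasCluster α β A {z | a * z.1 + b * z.2 ≤ t} (T i)) with hS'
  have hor : ∀ i, 0 < i → i < r → S i ∨ S' i := fun i hi hir =>
    dominates_or_dominates hA hB (hT i hi hir) (hT (r - i) (by omega) (by omega)) (hTT i hi hir)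
      (hUU i hi hir) fun a b t hab h => hcut i hi hir a b t hab h.1 h.2.1 h.2.2.1 h.2.2.2
  have hnand : ∀ i, 0 < i → i < r → ¬ (S i ∧ S' i) := by
    rintro i hi hir ⟨h, h'⟩
    rcases exists_opposite_sides (β := β) hA hB (hT i hi hir) (hT (r - i) (by omega) (by omega))
      (hTT i hi hir) (hUU i hi hir) 1 0 with ⟨t, ht⟩ | ⟨t, ht⟩
    · exact h 1 0 t (by simp) ht
    · exact h' 1 0 t (by simp) ht
  have hle : ∀ a b t : ℝ, {z : ℝ × ℝ | -a * z.1 + -b * z.2 ≤ -t} =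
      {z | t ≤ a * z.1 + b * z.2} := fun a b t => by
    ext z
    simp only [Set.mem_ofPred_eq]
    constructor <;> intro <;> linarith
  have hge : ∀ a b t : ℝ, {z : ℝ × ℝ | -t ≤ -a * z.1 + -b * z.2} =
      {z | a * z.1 + b * z.2 ≤ t} := fun a b t => by
    ext z
    simp only [Set.mem_ofPred_eq]
    constructor <;> intro <;> linarith
  have hflip : ∀ i, i < r → (S (r - i) ↔ S' i) := by
    intro i hir
    have hrr : r - (r - i) = i := by omega
    simp only [hS, hS', hrr]
    constructor
    · rintro h a b t hab ⟨h₁, h₂⟩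
      refine h (-a) (-b) (-t) (by simpa using hab) ⟨?_, ?_⟩
      · rwa [hge]
      · rwa [hle]
    · rintro h a b t hab ⟨h₁, h₂⟩
      refine h (-a) (-b) (-t) (by simpa using hab) ⟨?_, ?_⟩
      · rwa [hge]
      · rwa [hle]
  obtain ⟨i, j, k, hi, hj, hk, hijk, h⟩ := exists_monochromatic_triple hr S fun i hi hir => by
    rw [hflip i hir]
    have h₁ := hor i hi hir
    have h₂ := hnand i hi hir
    tauto
  refine ⟨i, j, k, hi, hj, hk, hijk, ?_⟩
  rcases h with h | h
  · exact exists_three_cut_of_dominates hA hB hT hU hTT hTpos hi hj hk hijk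
      (hTTT i j k hi hj hk hijk) (hUUU i j k hi hj hk hijk)
      (by rintro l (rfl | rfl | rfl); exacts [h.1, h.2.1, h.2.2])
  · have hlr : ∀ l, l = i ∨ l = j ∨ l = k → 0 < l ∧ l < r := by
      rintro l (rfl | rfl | rfl) <;> omega
    have hS'l : ∀ l, l = i ∨ l = j ∨ l = k → ∀ a b t : ℝ, (a, b) ≠ 0 →
        ¬ (HasCluster α β B {z | t ≤ a * z.1 + b * z.2} (U (r - l)) ∧
          HasCluster α β A {z | a * z.1 + b * z.2 ≤ t} (T l)) := by
      intro l hl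
      refine (hor l (hlr l hl).1 (hlr l hl).2).resolve_left ?_
      rcases hl with rfl | rfl | rfl
      exacts [h.1, h.2.1, h.2.2]
    obtain ⟨C₁, C₂, C₃, hC, h₁, h₂, h₃, h₄, h₅, h₆⟩ := exists_three_cut_of_dominates hB hA hU hT
      hUU hUpos hi hj hk hijk (hUUU i j k hi hj hk hijk) (hTTT i j k hi hj hk hijk) hS'l
    exact ⟨C₁, C₂, C₃, hC, h₄, h₅, h₆, h₁, h₂, h₃⟩

end HalfPlanes

section Transfer

/-- After shearing by all but one factor, a line becomes the graph of an affine function. -/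
lemma IsLine.exists_sheared_equation {ℓ : Set (ℝ × ℝ)} (h : IsLine ℓ) :
    ∃ κ₀ : ℝ, ∀ κ ≠ κ₀, ∃ m q : ℝ, ∀ z : ℝ × ℝ, z ∈ ℓ ↔ z.2 = m * (z.1 - κ * z.2) + q := by
  obtain ⟨a, b, c, hab, rfl⟩ := h
  have key : ∀ κ, a * κ + b ≠ 0 → ∃ m q : ℝ, ∀ z : ℝ × ℝ,
      z ∈ {p : ℝ × ℝ | a * p.1 + b * p.2 = c} ↔ z.2 = m * (z.1 - κ * z.2) + q := by
    intro κ hκ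
    refine ⟨-a / (a * κ + b), c / (a * κ + b), fun z => ?_⟩
    have e : -a / (a * κ + b) * (z.1 - κ * z.2) + c / (a * κ + b) =
        (c - a * (z.1 - κ * z.2)) / (a * κ + b) := by ring
    rw [Set.mem_ofPred_eq, e, eq_div_iff hκ]
    constructor <;> intro h <;> linarith
  by_cases ha : a = 0
  · refine ⟨0, fun κ _ => key κ ?_⟩
    rintro h
    exact hab (Prod.ext ha (by simpa [ha] using h))
  · refine ⟨-b / a, fun κ hκ => key κ fun h => hκ ?_⟩
    rw [eq_div_iff ha]
    linarith

lemma exists_sheared_equations {L : Finset (Set (ℝ × ℝ))} (hL : ∀ ℓ ∈ L, IsLine ℓ) :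
    ∃ (κ : ℝ) (α β : Set (ℝ × ℝ) → ℝ), ∀ ℓ ∈ L, ∀ z : ℝ × ℝ,
      z ∈ ℓ ↔ z.2 = α ℓ * (z.1 - κ * z.2) + β ℓ := by
  have h : ∀ ℓ, ∃ κ₀ : ℝ, ℓ ∈ L → ∀ κ ≠ κ₀, ∃ m q : ℝ, ∀ z : ℝ × ℝ,
      z ∈ ℓ ↔ z.2 = m * (z.1 - κ * z.2) + q := by
    intro ℓ
    by_cases hℓ : ℓ ∈ L
    · obtain ⟨κ₀, hκ⟩ := (hL ℓ hℓ).exists_sheared_equation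
      exact ⟨κ₀, fun _ => hκ⟩
    · exact ⟨0, fun h => absurd h hℓ⟩
  choose κ₀ hκ₀ using h
  obtain ⟨κ, hκ⟩ := Infinite.exists_notMem_finset (L.image κ₀)
  have h' : ∀ ℓ, ∃ m q : ℝ, ℓ ∈ L → ∀ z : ℝ × ℝ, z ∈ ℓ ↔ z.2 = m * (z.1 - κ * z.2) + q := by
    intro ℓ
    by_cases hℓ : ℓ ∈ L
    · obtain ⟨m, q, hmq⟩ := hκ₀ ℓ hℓ κ (fun e => hκ (Finset.mem_image.2 ⟨ℓ, hℓ, e.symm⟩))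
      exact ⟨m, q, fun _ => hmq⟩
    · exact ⟨0, 0, fun h => absurd h hℓ⟩
  choose α β hαβ using h'
  exact ⟨κ, α, β, hαβ⟩

/-- The shear of the plane along the first coordinate. -/
def shear (κ : ℝ) : (ℝ × ℝ) ≃ₜ (ℝ × ℝ) where
  toFun z := (z.1 - κ * z.2, z.2)
  invFun z := (z.1 + κ * z.2, z.2)
  left_inv z := by simp
  right_inv z := by simp
  continuous_toFun := by fun_prop
  continuous_invFun := by fun_prop

lemma shear_apply (κ : ℝ) (z : ℝ × ℝ) : shear κ z = (z.1 - κ * z.2, z.2) := rfl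

lemma ConvexPartition.preimage_shear {k : ℕ} {C : Fin k → Set (ℝ × ℝ)} (h : ConvexPartition C)
    (κ : ℝ) : ConvexPartition fun i => shear κ ⁻¹' C i := by
  obtain ⟨hcl, hcv, hun, hdis⟩ := h
  refine ⟨fun j => (hcl j).preimage (shear κ).continuous, fun j => ?_, ?_, fun i j hij => ?_⟩
  · intro x hx y hy a b ha hb hab
    have e : shear κ (a • x + b • y) = a • shear κ x + b • shear κ y := by
      ext <;> simp [shear_apply]
      ring
    rw [Set.mem_preimage, e]
    exact hcv j hx hy ha hb hab
  · rw [← Set.preimage_iUnion, hun, Set.preimage_univ]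
  · beta_reduce
    rw [← Homeomorph.preimage_interior, ← Homeomorph.preimage_interior, ← Set.preimage_inter,
      hdis hij, Set.preimage_empty]

variable {L : Finset (Set (ℝ × ℝ))} {κ : ℝ} {α β : Set (ℝ × ℝ) → ℝ}

lemma slope_injOn (hL : PairwiseNonParallel L)
    (hαβ : ∀ ℓ ∈ L, ∀ z : ℝ × ℝ, z ∈ ℓ ↔ z.2 = α ℓ * (z.1 - κ * z.2) + β ℓ) :
    Set.InjOn α L := by
  intro ℓ₁ h₁ ℓ₂ h₂ he
  by_contra hne
  obtain ⟨p, ⟨hp₁, hp₂⟩, -⟩ := hL ℓ₁ h₁ ℓ₂ h₂ hne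
  rw [hαβ ℓ₁ h₁] at hp₁
  rw [hαβ ℓ₂ h₂, ← he] at hp₂
  refine hne (Set.ext fun z => ?_)
  rw [hαβ ℓ₁ h₁, hαβ ℓ₂ h₂, ← he, show β ℓ₁ = β ℓ₂ by linarith]

lemma HasCluster.le_mu {A : Finset (Set (ℝ × ℝ))} (hα : Set.InjOn α A)
    (hαβ : ∀ ℓ ∈ A, ∀ z : ℝ × ℝ, z ∈ ℓ ↔ z.2 = α ℓ * (z.1 - κ * z.2) + β ℓ)
    {K : Set (ℝ × ℝ)} {T : ℝ} (h : HasCluster α β A K T) :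
    T - 2 ≤ mu A (shear κ ⁻¹' K) := by
  obtain ⟨A', hA', hT, hK⟩ := h
  have hsub : incSet A' ⊆ shear κ ⁻¹' K := by
    rintro p ⟨ℓ₁, h₁, ℓ₂, h₂, hne, hp₁, hp₂⟩
    rw [hαβ ℓ₁ (hA' h₁)] at hp₁
    rw [hαβ ℓ₂ (hA' h₂)] at hp₂
    have hd : α ℓ₁ - α ℓ₂ ≠ 0 := sub_ne_zero.2 fun e => hne (hα (hA' h₁) (hA' h₂) e)
    have hx : crossX α β ℓ₁ ℓ₂ = p.1 - κ * p.2 := by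
      rw [crossX, div_eq_iff hd]
      linarith
    have hp : shear κ p = cross α β ℓ₁ ℓ₂ := by
      rw [shear_apply, cross, hx, ← hp₁]
    rw [Set.mem_preimage, hp]
    exact hK ℓ₁ h₁ ℓ₂ h₂ hne
  have hle : A'.card ≤ mu A (shear κ ⁻¹' K) :=
    Finset.le_sup (f := Finset.card) (Finset.mem_filter.2 ⟨Finset.mem_powerset.2 hA', hsub⟩)
  have : (A'.card : ℝ) ≤ mu A (shear κ ⁻¹' K) := by exact_mod_cast hle
  linarith

end Transfer

section Thresholds

variable (n : ℕ) {r : ℕ}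

lemma rpow_threshold_le {i : ℕ} (hi : 0 < i) (hir : i < r) :
    (2 * n / 3 : ℝ) ^ ((i : ℝ) / r) ≤ n := by
  have hr : (0 : ℝ) < r := by exact_mod_cast hi.trans hir
  have hi' : (0 : ℝ) < i := by exact_mod_cast hi
  have hexp : 0 < (i : ℝ) / r := div_pos hi' hr
  have hexp' : (i : ℝ) / r ≤ 1 := (div_le_one hr).2 (by exact_mod_cast hir.le)
  have hn : (0 : ℝ) ≤ n := n.cast_nonneg
  rcases n.eq_zero_or_pos with rfl | hpos
  · simp [Real.zero_rpow hexp.ne']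
  have h1 : (1 : ℝ) ≤ n := by exact_mod_cast hpos
  rcases le_total (2 * n / 3 : ℝ) 1 with h | h
  · exact (Real.rpow_le_one (by positivity) h hexp.le).trans h1
  · calc (2 * n / 3 : ℝ) ^ ((i : ℝ) / r) ≤ (2 * n / 3 : ℝ) ^ (1 : ℝ) :=
          Real.rpow_le_rpow_of_exponent_le h hexp'
      _ ≤ n := by rw [Real.rpow_one]; linarith

lemma rpow_threshold_mul {i j : ℕ} (hij : 0 < i + j) :
    (2 * n / 3 : ℝ) ^ ((i : ℝ) / r) * (2 * n / 3 : ℝ) ^ ((j : ℝ) / r) =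
      (2 * n / 3 : ℝ) ^ (((i + j : ℕ) : ℝ) / r) := by
  rcases r.eq_zero_or_pos with rfl | hr
  · simp
  have : (0 : ℝ) < (i + j : ℕ) := by exact_mod_cast hij
  have hr' : (0 : ℝ) < r := by exact_mod_cast hr
  rw [← Real.rpow_add' (by positivity)]
  · push_cast
    rw [add_div]
  · rw [← add_div, ← Nat.cast_add]
    positivity

lemma rpow_threshold_self (hr : 0 < r) : (2 * n / 3 : ℝ) ^ ((r : ℝ) / r) = 2 * n / 3 := by
  rw [div_self (by positivity), Real.rpow_one]

lemma rpow_threshold_mul_sub_le {i : ℕ} (hi : 0 < i) (hir : i < r) :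
    (2 * n / 3 : ℝ) ^ ((i : ℝ) / r) * (2 * n / 3 : ℝ) ^ (((r - i : ℕ) : ℝ) / r) ≤ n := by
  rw [rpow_threshold_mul n (by omega), Nat.add_sub_cancel' hir.le, rpow_threshold_self n (by omega)]
  have hn : (0 : ℝ) ≤ n := n.cast_nonneg
  linarith

lemma three_mul_rpow_threshold_le {i j k : ℕ} (hi : 0 < i) (hsum : i + j + k = r) :
    3 * ((2 * n / 3 : ℝ) ^ ((i : ℝ) / r) * (2 * n / 3 : ℝ) ^ ((j : ℝ) / r) *
      (2 * n / 3 : ℝ) ^ ((k : ℝ) / r)) ≤ 2 * n := by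
  rw [rpow_threshold_mul n (by omega), rpow_threshold_mul n (by omega), hsum,
    rpow_threshold_self n (by omega)]
  linarith

lemma rpow_threshold_pos {ι : Type*} {A : Finset ι} (i : ℕ) (hA : A.Nonempty) :
    0 < (2 * A.card / 3 : ℝ) ^ ((i : ℝ) / r) := by
  have : (0 : ℝ) < A.card := by exact_mod_cast hA.card_pos
  positivity

end Thresholds

/-- **Existence of equitable cuts.** For `A ∪ B` in general position and `r ≥ 2`, there is
either a pair `(r₁, r₂)` of positive integers summing to `r` admitting an equitable
`(r₁, r₂)` cut, or a triple `(r₁, r₂, r₃)` of positive integers summing to `r` admitting an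
equitable `(r₁, r₂, r₃)` cut. -/
theorem strong_equitable_cuts (A B : Finset (Set (ℝ × ℝ)))
    (hlines : ∀ ℓ ∈ A ∪ B, IsLine ℓ) (hgp : GenPos (A ∪ B)) (r : ℕ) (hr : 2 ≤ r) :
    (∃ r₁ r₂ : ℕ, 0 < r₁ ∧ 0 < r₂ ∧ r₁ + r₂ = r ∧
      ∃ C : Fin 2 → Set (ℝ × ℝ), EquitableCut A B r ![r₁, r₂] C) ∨
    (∃ r₁ r₂ r₃ : ℕ, 0 < r₁ ∧ 0 < r₂ ∧ 0 < r₃ ∧ r₁ + r₂ + r₃ = r ∧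
      ∃ C : Fin 3 → Set (ℝ × ℝ), EquitableCut A B r ![r₁, r₂, r₃] C) := by
  obtain ⟨κ, α, β, hαβ⟩ := exists_sheared_equations hlines
  have hinj := slope_injOn hgp.1 hαβ
  have hA : Set.InjOn α A := hinj.mono (by exact_mod_cast Finset.subset_union_left)
  have hB : Set.InjOn α B := hinj.mono (by exact_mod_cast Finset.subset_union_right)
  have hmA : ∀ {K T}, HasCluster α β A K T → T - 2 ≤ mu A (shear κ ⁻¹' K) := fun h =>
    h.le_mu hA fun ℓ hℓ => hαβ ℓ (Finset.mem_union_left _ hℓ)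
  have hmB : ∀ {K T}, HasCluster α β B K T → T - 2 ≤ mu B (shear κ ⁻¹' K) := fun h =>
    h.le_mu hB fun ℓ hℓ => hαβ ℓ (Finset.mem_union_right _ hℓ)
  rcases exists_two_cut_or_three_cut (β := β) hA hB hr
      (T := fun i => (2 * A.card / 3 : ℝ) ^ ((i : ℝ) / r))
      (U := fun i => (2 * B.card / 3 : ℝ) ^ ((i : ℝ) / r))
      (fun i => rpow_threshold_le _) (fun i => rpow_threshold_le _)
      (fun i => rpow_threshold_mul_sub_le _) (fun i => rpow_threshold_mul_sub_le _)
      rpow_threshold_pos rpow_threshold_pos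
      (fun i j k hi _ _ => three_mul_rpow_threshold_le _ hi)
      (fun i j k hi _ _ => three_mul_rpow_threshold_le _ hi) with
    ⟨i, j, hi, hj, hij, C₁, C₂, hC, a₁, a₂, b₁, b₂⟩ |
    ⟨i, j, k, hi, hj, hk, hijk, C₁, C₂, C₃, hC, a₁, a₂, a₃, b₁, b₂, b₃⟩
  · refine Or.inl ⟨i, j, hi, hj, hij, _, hC.preimage_shear κ, fun l => ?_⟩
    fin_cases l
    · exact ⟨hmA a₁, hmB b₁⟩
    · exact ⟨hmA a₂, hmB b₂⟩
  · refine Or.inr ⟨i, j, k, hi, hj, hk, hijk, _, hC.preimage_shear κ, fun l => ?_⟩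
    fin_cases l
    · exact ⟨hmA a₁, hmB b₁⟩
    · exact ⟨hmA a₂, hmB b₂⟩
    · exact ⟨hmA a₃, hmB b₃⟩
end
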